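/- arXiv:math/0210066 — 9 statements merged into one kernel-verified Lean document; each statement's English description precedes it below -/
import Mathlib

section
/- Let $R$ be an affine domain over an algebraically closed field of characteristic zero, and let $M$ be a finitely generated reflexive $R$-module of finite homological (projective) dimension such that $M$ is locally free outside a finite set of closed points of $\mathrm{Spec}\,R$ (i.e., there is a finite set of maximal ideals $\mathfrak{m}_1,\dots,\mathfrak{m}_r$ such that $M_{\mathfrak{p}}$ is free for every prime $\mathfrak{p}$ not among them). If $\mathrm{rank}\,M \geq \dim R$ (Krull dimension), then $M$ is cancellative. -/
open TensorProduct

/-- `M` has finite homological (projective) dimension over `R`: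
it admits a projective resolution that vanishes in large degrees. -/
def FiniteProjectiveDimension (R : Type) [CommRing R]
    (M : Type) [AddCommGroup M] [Module R M] : Prop :=
  ∃ (P : ℕ → ModuleCat R) (d : ∀ i, P (i + 1) ⟶ P i) (ε : P 0 ⟶ ModuleCat.of R M) (n : ℕ),
    (∀ i, CategoryTheory.Projective (P i)) ∧
    Function.Surjective ε ∧
    Function.Exact (d 0) ε ∧
    (∀ i, Function.Exact (d (i + 1)) (d i)) ∧
    (∀ i, n ≤ i → Subsingleton (P i))


namespace RMC

def Uni {A X : Type*} [CommRing A] [AddCommGroup X] [Module A X] (a : A) (m : X) : Prop :=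
  ∃ (y : A) (g : X →ₗ[A] A), y * a + g m = 1

def Kills {A X : Type*} [CommRing A] [AddCommGroup X] [Module A X] (a : A) (m : X) : Prop :=
  ∃ ψ : (A × X) →ₗ[A] X, Function.Surjective ψ ∧ ψ (a, m) = 0

def HasSplit {A : Type*} [CommRing A] (n : ℕ) (X : Type*) [AddCommGroup X] [Module A X]
    (q : Ideal A) : Prop :=
  ∃ (e : Fin n → X) (f : Fin n → X →ₗ[A] A) (D : A), D ∉ q ∧
    ∀ i j, f i (e j) = if i = j then D else 0

/-- the order ideal -/
def Ord {A X : Type*} [CommRing A] [AddCommGroup X] [Module A X] (m : X) : Ideal A :=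
  LinearMap.range (Module.Dual.eval A X m)

section basic
variable {A X : Type*} [CommRing A] [AddCommGroup X] [Module A X]

theorem mem_Ord {m : X} {r : A} : r ∈ Ord (A := A) m ↔ ∃ g : X →ₗ[A] A, g m = r := by
  constructor
  · rintro ⟨g, hg⟩
    exact ⟨g, hg⟩
  · rintro ⟨g, hg⟩
    exact ⟨g, hg⟩

theorem apply_mem_Ord (m : X) (g : X →ₗ[A] A) : g m ∈ Ord (A := A) m := mem_Ord.2 ⟨g, rfl⟩

theorem Kills.of_left {a : A} {m : X} (g : X →ₗ[A] A) (h : Kills (a + g m) m) : Kills a m := by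
  obtain ⟨ψ, hs, h0⟩ := h
  refine ⟨ψ ∘ₗ (LinearMap.prod (LinearMap.fst A A X + g ∘ₗ LinearMap.snd A A X)
    (LinearMap.snd A A X)), ?_, ?_⟩
  · intro y
    obtain ⟨⟨r, x⟩, hx⟩ := hs y
    exact ⟨(r - g x, x), by simpa using hx⟩
  · simpa using h0

theorem Kills.of_right {a : A} {m : X} (x : X) (h : Kills a (m + a • x)) : Kills a m := by
  obtain ⟨ψ, hs, h0⟩ := h
  refine ⟨ψ ∘ₗ (LinearMap.prod (LinearMap.fst A A X)
    (LinearMap.snd A A X + (LinearMap.fst A A X).smulRight x)), ?_, ?_⟩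
  · intro y
    obtain ⟨⟨r, z⟩, hx⟩ := hs y
    exact ⟨(r, z - r • x), by simpa using hx⟩
  · simpa using h0

theorem Uni.left {a : A} {m : X} (g : X →ₗ[A] A) (h : Uni a m) : Uni (a + g m) m := by
  obtain ⟨y, f, h⟩ := h
  refine ⟨y, f - y • g, ?_⟩
  simp only [LinearMap.sub_apply, LinearMap.smul_apply, smul_eq_mul]
  linear_combination h

theorem Uni.right {a : A} {m : X} (x : X) (h : Uni a m) : Uni a (m + a • x) := by
  obtain ⟨y, f, h⟩ := h
  refine ⟨y - f x, f, ?_⟩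
  simp only [map_add, map_smul, smul_eq_mul]
  linear_combination h

/-- order ideal full implies Kills -/
theorem Kills.of_ord_top {a : A} {m : X} (h : Ord (A := A) m = ⊤) : Kills a m := by
  obtain ⟨g, hg⟩ := mem_Ord.1 (h ▸ Submodule.mem_top : (1 - a) ∈ Ord (A := A) m)
  apply Kills.of_left g
  rw [hg, add_sub_cancel]
  apply Kills.of_right (-m)
  refine ⟨LinearMap.snd A A X, fun y => ⟨(0, y), rfl⟩, by simp⟩

theorem ord_le_of_sub {m m' x : X} {h : A} (e : m' = m + h • x) :
    Ord (A := A) m ≤ Ord (A := A) m' ⊔ Ideal.span {h} := by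
  intro r hr
  obtain ⟨g, rfl⟩ := mem_Ord.1 hr
  have : g m = g m' + -(h * g x) := by subst e; simp
  rw [this]
  exact Submodule.add_mem_sup (apply_mem_Ord _ _)
    (Ideal.mem_span_singleton.2 (by simp))

theorem equiv_of_surj {N : Type*} [AddCommGroup N] [Module A N] [Module.Finite A X]
    (E : (A × X) ≃ₗ[A] (A × N)) (φ : N →ₗ[A] X) (hφ : Function.Surjective φ) :
    Nonempty (X ≃ₗ[A] N) := by
  let F : (A × X) →ₗ[A] (A × X) := (LinearMap.prodMap LinearMap.id φ) ∘ₗ E.toLinearMap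
  have hs : Function.Surjective F := by
    have : Function.Surjective (LinearMap.prodMap (LinearMap.id : A →ₗ[A] A) φ) :=
      Function.Surjective.prodMap Function.surjective_id hφ
    exact this.comp E.surjective
  have hi : Function.Injective F := OrzechProperty.injective_of_surjective_endomorphism F hs
  have hφi : Function.Injective φ := by
    rw [injective_iff_map_eq_zero]
    intro x hx
    have : F (E.symm (0, x)) = 0 := by simp [F, hx]
    have h2 := (injective_iff_map_eq_zero F).1 hi _ this
    have h3 : ((0 : A), x) = 0 := by
      simpa using congrArg E h2
    simpa using congrArg Prod.snd h3
  exact ⟨(LinearEquiv.ofBijective φ ⟨hφi, hφ⟩).symm⟩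

theorem equiv_of_kills {N : Type*} [AddCommGroup N] [Module A N] [Module.Finite A X]
    (hK : ∀ (a : A) (m : X), Uni a m → Kills a m)
    (E : (A × X) ≃ₗ[A] (A × N)) : Nonempty (X ≃ₗ[A] N) := by
  obtain ⟨a, m, ham⟩ : ∃ a m, E.symm (1, 0) = (a, m) := ⟨_, _, rfl⟩
  have hu : Uni a m := by
    let f : (A × X) →ₗ[A] A := LinearMap.fst A A N ∘ₗ E.toLinearMap
    refine ⟨f (1, 0), f ∘ₗ LinearMap.inr A A X, ?_⟩
    have h1 : f (a, m) = 1 := by simp [f, ← ham]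
    have h2 : ((a, m) : A × X) = a • (1, 0) + (0, m) := by simp
    rw [h2, map_add, map_smul] at h1
    simpa [mul_comm] using h1
  obtain ⟨ψ, hs, h0⟩ := hK a m hu
  refine equiv_of_surj E (ψ ∘ₗ E.symm.toLinearMap ∘ₗ LinearMap.inr A A N) ?_
  intro y
  obtain ⟨p, hp⟩ := hs y
  obtain ⟨⟨r, x⟩, rfl⟩ := E.symm.surjective p
  refine ⟨x, ?_⟩
  have : ((r, x) : A × N) = r • (1, 0) + (0, x) := by simp
  rw [this, map_add, map_smul, map_add, map_smul, ham, h0] at hp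
  simpa using hp

end basic

/-- iterated cancellation -/
theorem cancel_iter {A : Type} [CommRing A]
    (C : ∀ (X : Type) [AddCommGroup X] [Module A X], Prop)
    (h1 : ∀ (X : Type) [AddCommGroup X] [Module A X], C X → C (A × X))
    (h2 : ∀ (X : Type) [AddCommGroup X] [Module A X], C X → Module.Finite A X)
    (h3 : ∀ (X : Type) [AddCommGroup X] [Module A X], C X →
      ∀ (a : A) (m : X), Uni a m → Kills a m) (r : ℕ) :
    ∀ (X Y : Type) [AddCommGroup X] [Module A X] [AddCommGroup Y] [Module A Y], C X →
      Nonempty (((Fin r → A) × X) ≃ₗ[A] ((Fin r → A) × Y)) → Nonempty (X ≃ₗ[A] Y) := by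
  have ex : ∀ (r : ℕ) (X : Type) [AddCommGroup X] [Module A X],
      Nonempty (((Fin (r + 1) → A) × X) ≃ₗ[A] ((Fin r → A) × (A × X))) := by
    intro r X _ _
    exact ⟨((Fin.consLinearEquiv A (fun _ : Fin (r+1) => A)).symm.prodCongr
      (LinearEquiv.refl A X)) ≪≫ₗ ((LinearEquiv.prodComm A A (Fin r → A)).prodCongr
      (LinearEquiv.refl A X)) ≪≫ₗ (LinearEquiv.prodAssoc A (Fin r → A) A X)⟩
  induction r with
  | zero =>
    rintro X Y _ _ _ _ - ⟨E⟩
    let u : ∀ (X : Type) [AddCommGroup X] [Module A X], ((Fin 0 → A) × X) ≃ₗ[A] X :=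
      fun X _ _ => LinearEquiv.uniqueProd
    exact ⟨(u X).symm ≪≫ₗ E ≪≫ₗ u Y⟩
  | succ r ih =>
    rintro X Y _ _ _ _ hC ⟨E⟩
    obtain ⟨e1⟩ := ex r X
    obtain ⟨e2⟩ := ex r Y
    obtain ⟨E'⟩ := ih (A × X) (A × Y) (h1 X hC) ⟨e1.symm ≪≫ₗ E ≪≫ₗ e2⟩
    haveI := h2 X hC
    exact equiv_of_kills (h3 X hC) E'

end RMC

namespace RMC

section avoid
variable {A : Type*} [CommRing A]

theorem avoid (T : Finset (Ideal A)) (hT : ∀ q ∈ T, q.IsPrime)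
    (hinc : ∀ q ∈ T, ∀ q' ∈ T, q ≤ q' → q = q') (K : Ideal A) (u : A)
    (hK : ∀ q ∈ T, u ∈ q → ¬ K ≤ q) : ∃ z ∈ K, ∀ q ∈ T, u + z ∉ q := by
  classical
  have hP : ∀ q ∈ T, (∏ q ∈ T.filter (fun q => u ∉ q), q) ≤ q → u ∉ q := by
    intro q hq h
    rw [Ideal.IsPrime.prod_le (hT q hq)] at h
    obtain ⟨q', hq', hle'⟩ := h
    rw [Finset.mem_filter] at hq'
    obtain rfl := hinc q' hq'.1 q hq hle'
    exact hq'.2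
  have hP2 : ∀ q ∈ T, u ∉ q → (∏ q ∈ T.filter (fun q => u ∉ q), q) ≤ q := by
    intro q hq hu
    rw [Ideal.IsPrime.prod_le (hT q hq)]
    exact ⟨q, Finset.mem_filter.2 ⟨hq, hu⟩, le_rfl⟩
  generalize (∏ q ∈ T.filter (fun q => u ∉ q), q) = P at hP hP2
  have hJ : ∃ z ∈ K * P, ∀ q ∈ T, u ∈ q → z ∉ q := by
    by_contra! hcon
    obtain ⟨q, hq, hle⟩ := (Ideal.subset_union_prime (s := T.filter (fun q => u ∈ q))
      (f := fun q : Ideal A => q)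
      (⊥ : Ideal A) (⊥ : Ideal A) (fun q hq _ _ => hT q (Finset.mem_filter.1 hq).1)
      (I := K * P)).1 (by
        intro z hz
        obtain ⟨q, hq, hu, hzq⟩ := hcon z hz
        refine Set.mem_iUnion₂.2 ⟨q, ?_, hzq⟩
        exact Finset.mem_coe.2 (Finset.mem_filter.2 ⟨hq, hu⟩))
    obtain ⟨hq1, hq2⟩ := Finset.mem_filter.1 hq
    rcases (Ideal.IsPrime.mul_le (hT q hq1)).1 hle with h | h
    · exact hK q hq1 hq2 h
    · exact hP q hq1 h hq2
  obtain ⟨z, hz, hz'⟩ := hJ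
  have hzK : z ∈ K := (Ideal.mul_le_left : K * P ≤ K) hz
  have hzP : z ∈ P := (Ideal.mul_le_right : K * P ≤ P) hz
  refine ⟨z, hzK, fun q hq h => ?_⟩
  by_cases hu : u ∈ q
  · have h2 : z ∈ q := by simpa using q.sub_mem h hu
    exact hz' q hq hu h2
  · have h3 : z ∈ q := hP2 q hq hu hzP
    have h2 : u ∈ q := by simpa using q.sub_mem h h3
    exact hu h2

theorem exists_indicator (T : Finset (Ideal A)) (hT : ∀ q ∈ T, q.IsPrime)
    (hinc : ∀ q ∈ T, ∀ q' ∈ T, q ≤ q' → q = q') (q : Ideal A) (hq : q ∈ T) :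
    ∃ t : A, t ∉ q ∧ ∀ q' ∈ T, q' ≠ q → t ∈ q' := by
  classical
  have hp := hT q hq
  have : ¬ (∏ q' ∈ T.erase q, q') ≤ q := by
    rw [Ideal.IsPrime.prod_le hp]
    rintro ⟨q', hq', hle⟩
    rw [Finset.mem_erase] at hq'
    exact hq'.1 (hinc q' hq'.2 q hq hle)
  obtain ⟨t, ht, ht'⟩ := SetLike.not_le_iff_exists.1 this
  refine ⟨t, ht', fun q' hq' hne => ?_⟩
  have hp' := hT q' hq'
  refine (?_ : (∏ q' ∈ T.erase q, q') ≤ q') ht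
  rw [Ideal.IsPrime.prod_le hp']
  exact ⟨q', Finset.mem_erase.2 ⟨hne, hq'⟩, le_rfl⟩

variable {X : Type*} [AddCommGroup X] [Module A X]

/-- make a pairing matrix scalar -/
theorem exact_dual {n : ℕ} (e : Fin n → X) (f : Fin n → X →ₗ[A] A) :
    ∃ f' : Fin n → X →ₗ[A] A, ∀ i j, f' i (e j) =
      if i = j then (Matrix.of fun i j => f i (e j)).det else 0 := by
  set F : Matrix (Fin n) (Fin n) A := Matrix.of fun i j => f i (e j) with hF
  refine ⟨fun i => ∑ k, F.adjugate i k • f k, fun i j => ?_⟩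
  have := congrFun (congrFun (Matrix.adjugate_mul F) i) j
  rw [Matrix.mul_apply] at this
  simp only [LinearMap.sum_apply, LinearMap.smul_apply, smul_eq_mul]
  rw [Matrix.smul_apply, Matrix.one_apply] at this
  simpa [hF] using this

theorem combine {n : ℕ} (T : Finset (Ideal A)) (hT : ∀ q ∈ T, q.IsPrime)
    (hinc : ∀ q ∈ T, ∀ q' ∈ T, q ≤ q' → q = q') (hs : ∀ q ∈ T, HasSplit n X q) :
    ∃ (e : Fin n → X) (f : Fin n → X →ₗ[A] A) (D : A), (∀ q ∈ T, D ∉ q) ∧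
    ∀ i j, f i (e j) = if i = j then D else 0 := by
  classical
  have hs' : ∀ q : Ideal A, ∃ (e : Fin n → X) (f : Fin n → X →ₗ[A] A) (D : A),
      q ∈ T → (D ∉ q ∧ ∀ i j, f i (e j) = if i = j then D else 0) := by
    intro q
    by_cases hq : q ∈ T
    · obtain ⟨e, f, D, h⟩ := hs q hq
      exact ⟨e, f, D, fun _ => h⟩
    · exact ⟨0, 0, 0, fun h => absurd h hq⟩
  choose e f D heD using hs'
  have ht : ∀ q : Ideal A, ∃ t : A, q ∈ T → (t ∉ q ∧ ∀ q' ∈ T, q' ≠ q → t ∈ q') := by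
    intro q
    by_cases hq : q ∈ T
    · obtain ⟨t, h⟩ := exists_indicator T hT hinc q hq
      exact ⟨t, fun _ => h⟩
    · exact ⟨0, fun h => absurd h hq⟩
  choose t ht using ht
  let E : Fin n → X := fun j => ∑ q ∈ T, t q • e q j
  let G : Fin n → X →ₗ[A] A := fun i => ∑ q ∈ T, t q • f q i
  obtain ⟨f', hf'⟩ := exact_dual E G
  refine ⟨E, f', _, fun q hq => ?_, hf'⟩
  have hp := hT q hq
  rw [← Ideal.Quotient.eq_zero_iff_mem, RingHom.map_det]
  have : (Ideal.Quotient.mk q).mapMatrix (Matrix.of fun i j => G i (E j)) =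
      Matrix.diagonal (fun _ => Ideal.Quotient.mk q (t q * t q * D q)) := by
    ext i j
    have h1 : ∀ q' ∈ T, q' ≠ q → Ideal.Quotient.mk q (t q') = 0 := by
      intro q' hq' hne
      exact Ideal.Quotient.eq_zero_iff_mem.2 ((ht q' hq').2 q hq hne.symm)
    simp only [RingHom.mapMatrix_apply, Matrix.map_apply, Matrix.of_apply, G, E,
      LinearMap.sum_apply, LinearMap.smul_apply, map_sum, map_smul, smul_eq_mul, map_mul,
      Finset.mul_sum]
    rw [Finset.sum_eq_single q, Finset.sum_eq_single q]
    · rw [(heD q hq).2 i j, Matrix.diagonal_apply]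
      split_ifs <;> simp [mul_assoc]
    · intro q' hq' hne
      simp [h1 q' hq' hne]
    · intro h; exact absurd hq h
    · intro q' hq' hne
      simp [h1 q' hq' hne]
    · intro h; exact absurd hq h
  rw [this, Matrix.det_diagonal, Finset.prod_const]
  have := Ideal.Quotient.isDomain q
  apply pow_ne_zero
  rw [Ne, Ideal.Quotient.eq_zero_iff_mem]
  intro h
  rcases hp.mem_or_mem h with h | h
  · rcases hp.mem_or_mem h with h | h <;> exact (ht q hq).1 h
  · exact (heD q hq).1 h

end avoid

section U
variable {A : Type*} [CommRing A] [IsNoetherianRing A]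
variable {X : Type*} [AddCommGroup X] [Module A X]

theorem exists_min_le (I : Ideal A) (q : PrimeSpectrum A) (h : I ≤ q.asIdeal) :
    ∃ q0 : PrimeSpectrum A, q0.asIdeal ∈ I.minimalPrimes ∧ q0 ≤ q := by
  obtain ⟨p, hp, hle⟩ := Ideal.exists_minimalPrimes_le h
  exact ⟨⟨p, hp.1.1⟩, hp, hle⟩

theorem minPrimes_inc {I : Ideal A} {q q' : Ideal A} (h : q ∈ I.minimalPrimes)
    (h' : q' ∈ I.minimalPrimes) (hle : q ≤ q') : q = q' :=
  le_antisymm hle (h'.2 h.1 hle)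

theorem genpos (n : ℕ) (S : Set (Ideal A)) (hS : ∀ q ∈ S, q.IsMaximal)
    (hsplit : ∀ q : PrimeSpectrum A, q.asIdeal ∉ S → HasSplit n X q.asIdeal) (e : ℕ) :
    ∀ (I : Ideal A), (∀ q : PrimeSpectrum A, I ≤ q.asIdeal → q.asIdeal ∉ S →
      Order.coheight q < e) → ∀ (a : A) (m : X), Uni a m →
      ∃ x : X, ∀ q : PrimeSpectrum A, I ≤ q.asIdeal → Ord (m + a • x) ≤ q.asIdeal →
        q.asIdeal ∉ S → Order.coheight q + n < e := by
  classical
  have hSmin : ∀ q0 q : PrimeSpectrum A, q0 ≤ q → q.asIdeal ∉ S → q0.asIdeal ∉ S := by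
    intro q0 q hle hq h
    have := (hS _ h).eq_of_le q.2.ne_top hle
    exact hq (this ▸ h)
  induction e with
  | zero =>
    intro I hI a m _
    exact ⟨0, fun q hq _ hqS => absurd (hI q hq hqS) (by simp)⟩
  | succ e ih =>
    intro I hI a m hu
    let T : Finset (Ideal A) := (Ideal.finite_minimalPrimes_of_isNoetherianRing A I).toFinset.filter
      (fun q => q ∉ S)
    have hTmem : ∀ q, q ∈ T ↔ q ∈ I.minimalPrimes ∧ q ∉ S := by
      intro q; simp [T]
    obtain ⟨v, f, D, hD, hfv⟩ := combine (X := X) (n := n) T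
      (fun q hq => ((hTmem q).1 hq).1.1.1)
      (fun q hq q' hq' hle => minPrimes_inc ((hTmem q).1 hq).1 ((hTmem q').1 hq').1 hle)
      (fun q hq => hsplit ⟨q, ((hTmem q).1 hq).1.1.1⟩ ((hTmem q).1 hq).2)
    obtain ⟨x1, hx1⟩ := ih (I ⊔ Ideal.span {D}) (by
      intro q hq hqS
      obtain ⟨q0, hq0, hle⟩ := exists_min_le I q (le_sup_left.trans hq)
      have hDq : D ∈ q.asIdeal := hq (Ideal.mem_sup_right (Ideal.mem_span_singleton_self D))
      have hq0S := hSmin q0 q hle hqS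
      have hlt : q0 < q := lt_of_le_of_ne hle (by
        rintro rfl
        exact hD _ ((hTmem _).2 ⟨hq0, hq0S⟩) hDq)
      have h1 := hI q0 hq0.1.2 hq0S
      have h2 := Order.coheight_add_one_le hlt
      have h3 := h2.trans_lt h1
      push_cast at h3
      exact lt_of_add_lt_add_right h3) a m hu
    have hu1 := hu.right x1
    set m1 := m + a • x1 with hm1
    have key : ∀ j : ℕ, ∃ z : Fin n → A, ∀ q : PrimeSpectrum A, I ≤ q.asIdeal →
        (∀ i : Fin n, (i : ℕ) < j → f i m1 + a * D * D * z i ∈ q.asIdeal) → a * D ∉ q.asIdeal →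
        q.asIdeal ∉ S → j ≤ n → Order.coheight q + j < (e + 1 : ℕ) := by
      intro j
      induction j with
      | zero =>
        refine ⟨0, fun q hq _ _ hqS _ => ?_⟩
        simpa using hI q hq hqS
      | succ j ihj =>
        obtain ⟨z, hz⟩ := ihj
        by_cases hjn : j < n
        swap
        · exact ⟨z, fun q _ _ _ _ h => absurd h (by omega)⟩
        let j' : Fin n := ⟨j, hjn⟩
        let I' : Ideal A := I ⊔ Ideal.span {r | ∃ i : Fin n, (i : ℕ) < j ∧
          r = f i m1 + a * D * D * z i}
        let T' : Finset (Ideal A) :=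
          (Ideal.finite_minimalPrimes_of_isNoetherianRing A I').toFinset.filter
          (fun q => a * D ∉ q)
        have hT' : ∀ q, q ∈ T' ↔ q ∈ I'.minimalPrimes ∧ a * D ∉ q := by
          intro q; simp [T']
        obtain ⟨y, hy, hy'⟩ := avoid T' (fun q hq => ((hT' q).1 hq).1.1.1)
          (fun q hq q' hq' hle => minPrimes_inc ((hT' q).1 hq).1 ((hT' q').1 hq').1 hle)
          (Ideal.span {a * D * D}) (f j' m1) (by
            intro q hq _ hle
            have hp : q.IsPrime := ((hT' q).1 hq).1.1.1
            have h1 := hle (Ideal.mem_span_singleton_self _)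
            have h2 := ((hT' q).1 hq).2
            rcases hp.mem_or_mem h1 with h | h
            · exact h2 h
            · exact h2 (Ideal.mul_mem_left _ _ h))
        obtain ⟨c, rfl⟩ := Ideal.mem_span_singleton.1 hy
        refine ⟨Function.update z j' c, fun q hq hqi haD hqS _ => ?_⟩
        have hI'q : I' ≤ q.asIdeal := by
          refine sup_le hq (Ideal.span_le.2 ?_)
          rintro r ⟨i, hi, rfl⟩
          have := hqi i (by omega)
          rwa [Function.update_of_ne] at this
          intro h; rw [h] at hi; simp [j'] at hi
        obtain ⟨q0, hq0, hle⟩ := exists_min_le I' q hI'q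
        have haD0 : a * D ∉ q0.asIdeal := fun h => haD (hle h)
        have hlt : q0 < q := lt_of_le_of_ne hle (by
          rintro rfl
          have := hqi j' (by simp [j'])
          rw [Function.update_self] at this
          exact hy' _ ((hT' _).2 ⟨hq0, haD0⟩) this)
        have h1 := hz q0 (le_sup_left.trans hq0.1.2) (fun i hi =>
          hq0.1.2 (Ideal.mem_sup_right (Ideal.subset_span ⟨i, hi, rfl⟩))) haD0
          (hSmin q0 q hle hqS) (by omega)
        have h2 := Order.coheight_add_one_le hlt
        calc Order.coheight q + ((j + 1 : ℕ) : ℕ∞) = (Order.coheight q + 1) + j := by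
              push_cast; ring
          _ ≤ Order.coheight q0 + j := by gcongr
          _ < _ := h1
    obtain ⟨z, hz⟩ := key n
    refine ⟨x1 + D • ∑ i, z i • v i, fun q hq hord hqS => ?_⟩
    have hm2 : m + a • (x1 + D • ∑ i, z i • v i) = m1 + (a * D) • ∑ i, z i • v i := by
      rw [hm1, smul_add, add_assoc, smul_smul]
    rw [hm2] at hord
    have hf : ∀ i, f i (m1 + (a * D) • ∑ i, z i • v i) = f i m1 + a * D * D * z i := by
      intro i
      simp only [map_add, map_smul, map_sum, hfv, smul_eq_mul, mul_ite, mul_zero,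
        Finset.sum_ite_eq, Finset.mem_univ, if_true]
      ring
    by_cases hDq : D ∈ q.asIdeal
    · have := hx1 q (sup_le hq (by simpa [Ideal.span_le] using hDq)) (by
        refine (ord_le_of_sub (h := D) (x := a • ∑ i, z i • v i)
          (m' := m1 + (a * D) • ∑ i, z i • v i) (by rw [smul_smul, mul_comm D a])).trans ?_
        exact sup_le hord (by simpa [Ideal.span_le] using hDq)) hqS
      refine this.trans ?_
      exact_mod_cast Nat.lt_succ_self e
    · by_cases haq : a ∈ q.asIdeal
      · exfalso
        obtain ⟨y, g, hyg⟩ := hu1.right (D • ∑ i, z i • v i)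
        apply q.2.ne_top
        rw [Ideal.eq_top_iff_one, ← hyg]
        rw [smul_smul]
        exact add_mem (Ideal.mul_mem_left _ _ haq) (hord (apply_mem_Ord _ _))
      · refine hz q hq (fun i _ => ?_) ?_ hqS le_rfl
        · rw [← hf]
          exact hord (apply_mem_Ord _ _)
        · intro h
          rcases q.2.mem_or_mem h with h | h
          · exact haq h
          · exact hDq h
end U
end RMC

namespace RMC
section key
variable {A M : Type*} [CommRing A] [AddCommGroup M] [Module A M]

theorem key_lemma (n : ℕ) (w : Fin (n + 1) → M) (f : Fin (n + 1) → M →ₗ[A] A) (δ b c : A)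
    (hδ : δ = 1 + b * c) (hf : ∀ i j, f i (w j) = if i = j then δ else 0)
    (hgen : ∀ N : Submodule A M, (∀ i, w i ∈ N) → (∀ x, b • x ∈ N) → N = ⊤) :
    Kills (b ^ (n + 1)) (w 0) := by
  have inv : ∀ j : ℕ, j ≤ n → ∃ (θ : M →ₗ[A] M) (z : M), b ^ (j + 1) • z = θ (w 0) ∧
      (∀ i : Fin (n + 1), j < (i : ℕ) → θ (w i) = b • w i) ∧
      ∀ N : Submodule A M, (∀ x, θ x ∈ N) → z ∈ N →
        (∀ i : Fin (n + 1), j < (i : ℕ) → w i ∈ N) → N = ⊤ := by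
    intro j
    induction j with
    | zero =>
      intro _
      refine ⟨b • LinearMap.id, w 0, by simp, by simp, fun N h1 h2 h3 => hgen N ?_ ?_⟩
      · intro i
        by_cases hi : i = 0
        · rwa [hi]
        · exact h3 i (Nat.pos_of_ne_zero (fun h => hi (Fin.ext h)))
      · intro x; simpa using h1 x
    | succ j ih =>
      intro hj
      obtain ⟨θ, z, hz, hθ, hN⟩ := ih (by omega)
      let v : Fin (n + 1) := ⟨j + 1, by omega⟩
      have hv : θ (w v) = b • w v := hθ v (by simp [v])
      have hv0 : v ≠ 0 := by intro h; simpa [v] using congrArg Fin.val h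
      have hε : ∃ ε : A, 1 - δ * δ = b * ε := ⟨-(2 * c + b * c * c), by rw [hδ]; ring⟩
      obtain ⟨ε, hε⟩ := hε
      let θ' : M →ₗ[A] M := θ + (b ^ (j + 1) • f 0).smulRight (θ (w v)) -
        (f v + (b ^ (j + 1) * δ) • f 0).smulRight z
      have hθ' : ∀ x, θ' x = θ x + (b ^ (j + 1) * f 0 x) • θ (w v) -
        (f v x + b ^ (j + 1) * δ * f 0 x) • z := by intro x; simp [θ']
      have hθv : θ' (w v) = b • w v - δ • z := by
        rw [hθ', hf 0 v, hf v v, if_neg (Ne.symm hv0), if_pos rfl, hv]; simp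
      refine ⟨θ', ε • z + δ • w v, ?_, ?_, ?_⟩
      · rw [hθ', hf 0 0, hf v 0, if_neg hv0, if_pos rfl, hv, ← hz]
        have h1 : b ^ (j + 1 + 1) * ε = b ^ (j + 1) * (1 - δ * δ) := by rw [hε]; ring
        rw [smul_add, smul_smul, smul_smul, h1, smul_smul]
        module
      · intro i hi
        have h0 : (0 : Fin (n + 1)) ≠ i := by rintro rfl; simp at hi
        have h1 : v ≠ i := by rintro rfl; simp [v] at hi
        rw [hθ', hf 0 i, hf v i, if_neg h0, if_neg h1, hθ i (by omega)]; simp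
      · intro N h1 h2 h3
        have hvN : b • w v - δ • z ∈ N := hθv ▸ h1 (w v)
        have hzN : z ∈ N := by
          have : z = b • (ε • z + δ • w v) - δ • (b • w v - δ • z) := by
            have : z = (b * ε + δ * δ) • z := by rw [← hε]; simp
            nth_rw 1 [this]; module
          rw [this]
          exact N.sub_mem (N.smul_mem _ h2) (N.smul_mem _ hvN)
        have hwN : w v ∈ N := by
          have : w v = δ • (ε • z + δ • w v) + ε • (b • w v - δ • z) := by
            have : w v = (b * ε + δ * δ) • w v := by rw [← hε]; simp
            nth_rw 1 [this]; module
          rw [this]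
          exact N.add_mem (N.smul_mem _ h2) (N.smul_mem _ hvN)
        refine hN N (fun x => ?_) hzN (fun i hi => ?_)
        · have : θ x = θ' x - (b ^ (j + 1) * f 0 x) • (b • w v) +
            (f v x + b ^ (j + 1) * δ * f 0 x) • z := by rw [hθ', hv]; module
          rw [this]
          exact N.add_mem (N.sub_mem (h1 x) (N.smul_mem _ (N.smul_mem _ hwN)))
            (N.smul_mem _ hzN)
        · by_cases h : i = v
          · rwa [h]
          · refine h3 i ?_
            have : (i : ℕ) ≠ j + 1 := fun h' => h (Fin.ext h')
            omega
  obtain ⟨θ, z, hz, -, hN⟩ := inv n le_rfl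
  let ψ : (A × M) →ₗ[A] M := θ ∘ₗ LinearMap.snd A A M - (LinearMap.fst A A M).smulRight z
  refine ⟨ψ, ?_, ?_⟩
  · rw [← LinearMap.range_eq_top]
    refine hN _ (fun x => ⟨(0, x), by simp [ψ]⟩) ⟨(-1, 0), by simp [ψ]⟩ (fun i hi => ?_)
    omega
  · simp [ψ, hz]

/-- M is free of rank n modulo b with a good lift. -/
def FreeMod (n : ℕ) (M : Type*) [AddCommGroup M] [Module A M] (b : A) : Prop :=
  ∃ (w : Fin n → M) (f : Fin n → M →ₗ[A] A),
    (∀ i j, b ∣ f i (w j) - if i = j then 1 else 0) ∧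
    ∀ N : Submodule A M, (∀ i, w i ∈ N) → (∀ x, b • x ∈ N) → N = ⊤
end key
end RMC

namespace RMC
section key2

theorem completion {B : Type*} [CommRing B] (n : ℕ)
    (hS : ∀ (a : B) (p : Fin n → B), Uni a p → Kills a p)
    (p g : Fin (n + 1) → B) (hg : ∑ i, g i * p i = 1) :
    ∃ U V : Matrix (Fin (n + 1)) (Fin (n + 1)) B, U * V = 1 ∧ V * U = 1 ∧ ∀ i, V i 0 = p i := by
  let c := Fin.consLinearEquiv B (fun _ : Fin (n + 1) => B)
  have hc : ∀ q : Fin (n + 1) → B, c.symm q = (q 0, fun i => q i.succ) := by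
    intro q
    rw [LinearEquiv.symm_apply_eq]
    ext i
    refine Fin.cases ?_ (fun i => ?_) i <;> simp [c, Fin.consLinearEquiv]
  obtain ⟨ψ, hs, h0⟩ := hS (p 0) (fun i => p i.succ) ⟨g 0, ∑ i : Fin n, g i.succ •
    (LinearMap.proj i : (Fin n → B) →ₗ[B] B), by
      rw [← hg, Fin.sum_univ_succ]; simp⟩
  let G : (Fin (n + 1) → B) →ₗ[B] B := ∑ i, g i • LinearMap.proj i
  have hG : G p = 1 := by simp [G, hg]
  let Φ : (Fin (n + 1) → B) →ₗ[B] (Fin (n + 1) → B) :=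
    c.toLinearMap ∘ₗ (LinearMap.prod G (ψ ∘ₗ c.symm.toLinearMap))
  have hψp : ψ (c.symm p) = 0 := by rw [hc, h0]
  have hΦp : Φ p = Pi.single 0 1 := by
    have : Φ p = c (1, 0) := by simp [Φ, hG, hψp]
    rw [this]
    ext i
    refine Fin.cases ?_ (fun i => ?_) i <;> simp [c, Fin.consLinearEquiv]
  have hΦs : Function.Surjective Φ := by
    intro y
    obtain ⟨⟨s, y⟩, rfl⟩ := c.surjective y
    obtain ⟨x, hx⟩ := hs y
    obtain ⟨x, rfl⟩ := c.symm.surjective x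
    refine ⟨x + (s - G x) • p, ?_⟩
    simp [Φ, hG, hψp, hx]
  have hΦi : Function.Injective Φ := OrzechProperty.injective_of_surjective_endomorphism Φ hΦs
  let E := LinearEquiv.ofBijective Φ ⟨hΦi, hΦs⟩
  have hE : E.symm (Pi.single 0 1) = p := by
    rw [LinearEquiv.symm_apply_eq]; exact hΦp.symm
  refine ⟨LinearMap.toMatrix' E.toLinearMap, LinearMap.toMatrix' E.symm.toLinearMap, ?_, ?_, ?_⟩
  · rw [← LinearMap.toMatrix'_comp]; simp
  · rw [← LinearMap.toMatrix'_comp]; simp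
  · intro i
    rw [LinearMap.toMatrix'_apply]
    simp [hE]

variable {A M : Type*} [CommRing A] [AddCommGroup M] [Module A M]

theorem key2 (n : ℕ) (b : A) (hF : FreeMod (n + 1) M b)
    (hS : ∀ (a : A ⧸ Ideal.span {b}) (p : Fin n → A ⧸ Ideal.span {b}), Uni a p → Kills a p)
    (m : M) (hm : ∃ (g : M →ₗ[A] A) (c : A), g m + b * c = 1) : Kills (b ^ (n + 1)) m := by
  obtain ⟨w, f, hfw, hgen⟩ := hF
  obtain ⟨g, c, hg⟩ := hm
  let π := Ideal.Quotient.mk (Ideal.span {b})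
  have hπ : ∀ x y : A, π x = π y ↔ b ∣ x - y := by
    intro x y
    rw [Ideal.Quotient.eq, Ideal.mem_span_singleton]
  have hπb : ∀ x : A, π (b * x) = 0 := by
    intro x
    rw [Ideal.Quotient.eq_zero_iff_mem, Ideal.mem_span_singleton]; exact dvd_mul_right _ _
  have hfw' : ∀ i j, π (f i (w j)) = if i = j then 1 else 0 := by
    intro i j
    have := (hπ _ _).2 (hfw i j)
    rw [this]; split_ifs <;> simp
  have hcong : ∀ (F : M →ₗ[A] A) (x y t : M), x = y + b • t → π (F x) = π (F y) := by
    intro F x y t h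
    rw [h, map_add, map_smul, smul_eq_mul, map_add, hπb, add_zero]
  -- every element is a combination
  have hspan : ∀ x : M, ∃ (d : Fin (n + 1) → A) (t : M), x = ∑ i, d i • w i + b • t := by
    have := hgen (Submodule.span A (Set.range w) ⊔ LinearMap.range (b • (LinearMap.id : M →ₗ[A] M)))
      (fun i => Submodule.mem_sup_left (Submodule.subset_span ⟨i, rfl⟩))
      (fun x => Submodule.mem_sup_right ⟨x, by simp⟩)
    intro x
    have hx : x ∈ (⊤ : Submodule A M) := trivial
    rw [← this, Submodule.mem_sup] at hx
    obtain ⟨y, hy, z, ⟨t, rfl⟩, rfl⟩ := hx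
    obtain ⟨d, rfl⟩ := (Submodule.mem_span_range_iff_exists_fun A).1 hy
    exact ⟨d, t, by simp⟩
  obtain ⟨d, t, hmd⟩ := hspan m
  have hfd : ∀ i, π (f i m) = π (d i) := by
    intro i
    rw [hcong (f i) _ _ t hmd]
    simp [hfw']
  obtain ⟨U', V', hUV, hVU, hV0⟩ := completion n hS (fun i => π (f i m)) (fun i => π (g (w i))) (by
    have h1 : π (g m) = 1 := by
      have := congrArg π hg
      rwa [map_add, hπb, add_zero, map_one] at this
    rw [← h1, hcong g _ _ t hmd]
    simp [hfd, mul_comm])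
  have hsurj : Function.Surjective π := Ideal.Quotient.mk_surjective
  choose σ hσ using hsurj
  obtain ⟨U, hU⟩ : ∃ U : Fin (n + 1) → Fin (n + 1) → A, ∀ i j, π (U i j) = U' i j :=
    ⟨fun i j => σ (U' i j), fun i j => hσ _⟩
  obtain ⟨V, hV⟩ : ∃ V : Fin (n + 1) → Fin (n + 1) → A, ∀ i j, π (V i j) = V' i j :=
    ⟨fun i j => σ (V' i j), fun i j => hσ _⟩
  have hUV' : ∀ i j, π (∑ k, U i k * V k j) = if i = j then 1 else 0 := by
    intro i j
    have := congrFun (congrFun hUV i) j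
    rw [Matrix.mul_apply, Matrix.one_apply] at this
    rw [← this]; simp [hU, hV]
  have hVU' : ∀ i j, π (∑ k, V i k * U k j) = if i = j then 1 else 0 := by
    intro i j
    have := congrFun (congrFun hVU i) j
    rw [Matrix.mul_apply, Matrix.one_apply] at this
    rw [← this]; simp [hU, hV]
  have hdiv : ∀ x y : A, π x = π y → ∃ s, x = y + b * s := by
    intro x y h
    obtain ⟨s, hs⟩ := (hπ x y).1 h
    exact ⟨s, by rw [← hs]; ring⟩
  let w2 : Fin (n + 1) → M := fun j => ∑ l, V l j • w l
  have hw20 : ∃ t, m = w2 0 + b • t := by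
    have : ∀ l, ∃ s, d l = V l 0 + b * s := by
      intro l; apply hdiv; rw [hV, hV0, hfd]
    choose s hs using this
    refine ⟨∑ l, s l • w l + t, ?_⟩
    rw [hmd]
    simp only [w2, hs, add_smul, mul_smul, Finset.sum_add_distrib, smul_add, Finset.smul_sum]
    abel
  obtain ⟨t2, ht2⟩ := hw20
  let w' : Fin (n + 1) → M := Function.update w2 0 m
  have hw' : ∀ j, ∃ t, w' j = w2 j + b • t := by
    intro j
    by_cases hj : j = 0
    · subst hj; exact ⟨t2, by simp [w', ← ht2]⟩
    · exact ⟨0, by simp [w', hj]⟩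
  let f' : Fin (n + 1) → M →ₗ[A] A := fun i => ∑ k, U i k • f k
  have hf' : ∀ i j, π (f' i (w' j)) = if i = j then 1 else 0 := by
    intro i j
    obtain ⟨t, ht⟩ := hw' j
    rw [hcong _ _ _ t ht, ← hUV']
    simp [f', w2, hfw', mul_comm]
  obtain ⟨f'', hf''⟩ := exact_dual w' f'
  set δ := (Matrix.of fun i j => f' i (w' j)).det with hδ
  have hδ1 : π δ = π 1 := by
    rw [hδ, RingHom.map_det, map_one]
    have : π.mapMatrix (Matrix.of fun i j => f' i (w' j)) = 1 := by
      ext i j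
      simp [hf', Matrix.one_apply]
    rw [this, Matrix.det_one]
  obtain ⟨s, hs⟩ := hdiv _ _ hδ1
  have := key_lemma n w' f'' δ b s hs hf'' (by
    intro N hN hb
    have h2 : ∀ j, w2 j ∈ N := by
      intro j
      obtain ⟨t, ht⟩ := hw' j
      have : w2 j = w' j - b • t := by rw [ht]; abel
      rw [this]; exact N.sub_mem (hN j) (hb t)
    refine hgen N (fun i => ?_) hb
    have h3 : ∑ j, U j i • w2 j ∈ N := N.sum_mem (fun j _ => N.smul_mem _ (h2 j))
    have h4 : ∑ j, U j i • w2 j = ∑ l, (∑ k, V l k * U k i) • w l := by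
      simp only [w2, Finset.smul_sum, Finset.sum_smul]
      rw [Finset.sum_comm]
      refine Finset.sum_congr rfl fun l _ => Finset.sum_congr rfl fun k _ => ?_
      rw [smul_smul, mul_comm]
    have h5 : ∀ l, ∃ s, (∑ k, V l k * U k i) = (if l = i then 1 else 0) + b * s := by
      intro l; apply hdiv; rw [hVU']; split_ifs <;> simp
    choose s hs using h5
    have h6 : w i = ∑ j, U j i • w2 j - b • ∑ l, s l • w l := by
      rw [h4]
      simp only [hs, add_smul, mul_smul, Finset.sum_add_distrib, Finset.smul_sum, ite_smul,
        one_smul, zero_smul, Finset.sum_ite_eq', Finset.mem_univ, if_true]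
      abel
    rw [h6]
    exact N.sub_mem h3 (hb _))
  simpa [w'] using this
end key2
end RMC

namespace RMC
section root
variable (k : Type) [Field k] [IsAlgClosed k] [CharZero k]

theorem root_artinian (C : Type) [CommRing C] [Algebra k C] [Algebra.FiniteType k C]
    [IsArtinianRing C] (n : ℕ) (hn : 0 < n) (a : C) (ha : IsUnit a) : ∃ b : C, b ^ n = a := by
  have h1 : ∃ b : C, IsNilpotent (b ^ n - a) := by
    have hred : IsReduced (C ⧸ nilradical C) :=
      (Ideal.isRadical_iff_quotient_reduced _).1 (Ideal.radical_isRadical _)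
    have : ∀ I : MaximalSpectrum (C ⧸ nilradical C), ∃ z : (C ⧸ nilradical C) ⧸ I.asIdeal,
        z ^ n = Ideal.Quotient.mk _ (Ideal.Quotient.mk _ a) := by
      intro I
      letI := Ideal.Quotient.field I.asIdeal
      haveI : Algebra.FiniteType k (C ⧸ nilradical C) :=
        Algebra.FiniteType.of_surjective (Ideal.Quotient.mkₐ k (nilradical C))
          (Ideal.Quotient.mk_surjective)
      haveI : Algebra.FiniteType k ((C ⧸ nilradical C) ⧸ I.asIdeal) :=
        Algebra.FiniteType.of_surjective (Ideal.Quotient.mkₐ k I.asIdeal)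
          (Ideal.Quotient.mk_surjective)
      haveI := finite_of_finite_type_of_isJacobsonRing k ((C ⧸ nilradical C) ⧸ I.asIdeal)
      obtain ⟨y, hy⟩ := (IsAlgClosed.algebraMap_bijective_of_isIntegral (k := k)
        (K := (C ⧸ nilradical C) ⧸ I.asIdeal)).2 (Ideal.Quotient.mk _ (Ideal.Quotient.mk _ a))
      obtain ⟨z, hz⟩ := IsAlgClosed.exists_pow_nat_eq y hn
      exact ⟨algebraMap k _ z, by rw [← map_pow, hz, hy]⟩
    choose z hz using this
    obtain ⟨b, hb⟩ := (IsArtinianRing.equivPi (C ⧸ nilradical C)).surjective z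
    obtain ⟨b, rfl⟩ := Ideal.Quotient.mk_surjective b
    refine ⟨b, ?_⟩
    rw [← mem_nilradical, ← Ideal.Quotient.eq, map_pow]
    apply (IsArtinianRing.equivPi (C ⧸ nilradical C)).injective
    rw [map_pow, hb]
    funext I
    rw [Pi.pow_apply, hz, IsArtinianRing.equivPi_apply]
  obtain ⟨b, hb⟩ := h1
  let P : Polynomial C := Polynomial.X ^ n - Polynomial.C a
  have hbu : IsUnit b := by
    have : IsUnit (b ^ n) := by
      have := hb.isUnit_add_left_of_commute ha (Commute.all _ _)
      simpa using this
    exact (isUnit_pow_iff hn.ne').1 this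
  obtain ⟨r, ⟨-, hr⟩, -⟩ := Polynomial.existsUnique_nilpotent_sub_and_aeval_eq_zero (P := P) (x := b)
    (by simpa [P] using hb) (by
      simp only [P, Polynomial.derivative_sub, Polynomial.derivative_X_pow,
        Polynomial.derivative_C, sub_zero, map_mul, map_pow, Polynomial.aeval_X,
        Polynomial.aeval_C]
      refine IsUnit.mul ?_ (hbu.pow _)
      have hnu : IsUnit (n : k) := (Nat.cast_ne_zero.2 hn.ne').isUnit
      have := hnu.map (algebraMap k C)
      simpa using this)
  exact ⟨r, by simpa [P, sub_eq_zero] using hr⟩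

theorem root_mod (A : Type) [CommRing A] [Algebra k A] [Algebra.FiniteType k A]
    (K : Ideal A) (hK : ∀ q : Ideal A, q.IsPrime → K ≤ q → q.IsMaximal)
    (n : ℕ) (hn : 0 < n) (a : A) (ha : Ideal.span {a} ⊔ K = ⊤) : ∃ b : A, b ^ n - a ∈ K := by
  haveI : Algebra.FiniteType k (A ⧸ K) :=
        Algebra.FiniteType.of_surjective (Ideal.Quotient.mkₐ k K)
          (Ideal.Quotient.mk_surjective)
  haveI : IsNoetherianRing (A ⧸ K) := Algebra.FiniteType.isNoetherianRing k _
  haveI : IsArtinianRing (A ⧸ K) := by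
    rw [isArtinianRing_iff_isNoetherianRing_krullDimLE_zero]
    refine ⟨inferInstance, Ring.krullDimLE_zero_iff.2 ?_⟩
    intro I hI
    have := hK (I.comap (Ideal.Quotient.mk K)) inferInstance (by
      intro x hx
      rw [Ideal.mem_comap, Ideal.Quotient.eq_zero_iff_mem.2 hx]; exact I.zero_mem)
    have h2 := Ideal.map_eq_top_or_isMaximal_of_surjective (Ideal.Quotient.mk K)
      Ideal.Quotient.mk_surjective this
    rw [Ideal.map_comap_of_surjective _ Ideal.Quotient.mk_surjective] at h2
    exact h2.resolve_left hI.ne_top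
  obtain ⟨b, hb⟩ := root_artinian k (A ⧸ K) n hn (Ideal.Quotient.mk K a) (by
    have h1 : (1 : A) ∈ Ideal.span {a} ⊔ K := ha ▸ Submodule.mem_top
    obtain ⟨x, hx, y, hy, hxy⟩ := Submodule.mem_sup.1 h1
    obtain ⟨c, rfl⟩ := Ideal.mem_span_singleton.1 hx
    refine IsUnit.of_mul_eq_one (Ideal.Quotient.mk K c) ?_
    rw [← map_mul, ← map_one (Ideal.Quotient.mk K), ← hxy, map_add,
      Ideal.Quotient.eq_zero_iff_mem.2 hy, add_zero])
  obtain ⟨b, rfl⟩ := Ideal.Quotient.mk_surjective b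
  exact ⟨b, by rw [← Ideal.Quotient.eq, map_pow, hb]⟩
end root
end RMC

namespace RMC
section Z

theorem coheight_le_of_dim {A : Type*} [CommRing A] {n : ℕ} (h : ringKrullDim A ≤ n)
    (q : PrimeSpectrum A) : Order.coheight q ≤ n := by
  have := (Order.coheight_le_krullDim q).trans h
  exact_mod_cast this

theorem dim_le_of_coheight {A : Type*} [CommRing A] {n : ℕ}
    (h : ∀ q : PrimeSpectrum A, Order.coheight q ≤ n) : ringKrullDim A ≤ n := by
  rw [ringKrullDim, Order.krullDim_eq_iSup_coheight]
  refine iSup_le fun q => ?_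
  exact_mod_cast h q

theorem dim_quot_le {A : Type*} [CommRing A] {n : ℕ} (I : Ideal A)
    (h : ∀ q : PrimeSpectrum A, I ≤ q.asIdeal → Order.coheight q ≤ n) :
    ringKrullDim (A ⧸ I) ≤ n := by
  refine dim_le_of_coheight fun q => ?_
  have hs : StrictMono (PrimeSpectrum.comap (Ideal.Quotient.mk I)) := by
    refine Monotone.strictMono_of_injective ?_
      (PrimeSpectrum.comap_injective_of_surjective _ Ideal.Quotient.mk_surjective)
    intro x y hxy
    exact Ideal.comap_mono hxy
  refine (Order.coheight_le_coheight_apply_of_strictMono _ hs q).trans (h _ ?_)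
  intro x hx
  change Ideal.Quotient.mk I x ∈ q.asIdeal
  rw [Ideal.Quotient.eq_zero_iff_mem.2 hx]
  exact zero_mem _

theorem dim_quot_lt {A : Type*} [CommRing A] {n : ℕ} (h : ringKrullDim A ≤ (n + 1 : ℕ))
    (b : A) (hb : ∀ q ∈ minimalPrimes A, b ∉ q) : ringKrullDim (A ⧸ Ideal.span {b}) ≤ n := by
  refine dim_quot_le _ fun q hq => ?_
  obtain ⟨p, hp, hle⟩ := Ideal.exists_minimalPrimes_le (I := ⊥) (J := q.asIdeal) bot_le
  have hbq : b ∈ q.asIdeal := hq (Ideal.mem_span_singleton_self b)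
  have hlt : (⟨p, hp.1.1⟩ : PrimeSpectrum A) < q := lt_of_le_of_ne hle (by
    rintro rfl
    exact hb p hp hbq)
  have h1 := (Order.coheight_add_one_le hlt).trans (coheight_le_of_dim h _)
  push_cast at h1
  exact (ENat.add_le_add_iff_right (by simp)).1 h1

theorem eq_top_of_max {A : Type*} [CommRing A] (I : Ideal A)
    (h : ∀ q : PrimeSpectrum A, q.asIdeal.IsMaximal → I ≤ q.asIdeal → False) : I = ⊤ := by
  by_contra hI
  obtain ⟨q, hq, hle⟩ := Ideal.exists_le_maximal I hI
  exact h ⟨q, hq.isPrime⟩ hq hle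

/-- unimodular elements of rank n free modules are killed -/
def SProp (k : Type) [Field k] (n : ℕ) : Prop :=
  ∀ (B : Type) [CommRing B] [Algebra k B] [Algebra.FiniteType k B], ringKrullDim B ≤ n →
    ∀ (a : B) (p : Fin n → B), Uni a p → Kills a p

variable (k : Type) [Field k] [IsAlgClosed k] [CharZero k]

theorem Zstep (n : ℕ) (hSn : SProp k n)
    (A : Type) [CommRing A] [Algebra k A] [Algebra.FiniteType k A]
    (hdim : ringKrullDim A ≤ (n + 1 : ℕ)) (M : Type) [AddCommGroup M] [Module A M]
    (S : Finset (Ideal A)) (hSmax : ∀ q ∈ S, q.IsMaximal) (h : A) (hhS : ∀ q ∈ S, h ∉ q)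
    (hsplit : ∀ q : PrimeSpectrum A, q.asIdeal ∉ S → HasSplit (n + 1) M q.asIdeal)
    (hh : ∀ q : PrimeSpectrum A, h ∈ q.asIdeal → Order.coheight q < (n + 1 : ℕ))
    (H3 : ∀ b : A, IsCoprime b h → (∀ q ∈ S, b ∉ q) → (∀ q ∈ minimalPrimes A, b ∉ q) →
      FreeMod (n + 1) M b)
    (a : A) (m : M) (hu : Uni a m) : Kills a m := by
  classical
  haveI : IsNoetherianRing A := Algebra.FiniteType.isNoetherianRing k A
  have hUq : ∀ (a : A) (m : M), Uni a m → ∀ q : Ideal A, q ≠ ⊤ → a ∈ q → ¬ Ord m ≤ q := by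
    rintro a m ⟨y, g, hyg⟩ q hq haq hle
    apply hq
    rw [Ideal.eq_top_iff_one, ← hyg]
    exact add_mem (Ideal.mul_mem_left _ _ haq) (hle (apply_mem_Ord _ _))
  have hmaxeq : ∀ q' ∈ S, ∀ q : Ideal A, q ≠ ⊤ → q' ≤ q → q' = q := by
    intro q' hq' q hq hle
    exact (hSmax q' hq').eq_of_le hq hle
  -- step 1
  obtain ⟨z, hz, hzS⟩ := avoid S (fun q hq => (hSmax q hq).isPrime)
    (fun q hq q' hq' hle => hmaxeq q hq q' (hSmax q' hq').ne_top hle) (Ord m) a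
    (fun q hq haq => hUq a m hu q (hSmax q hq).ne_top haq)
  obtain ⟨g, rfl⟩ := mem_Ord.1 hz
  refine Kills.of_left g ?_
  replace hu := hu.left g
  generalize a + g m = a1 at hu hzS
  clear hz g a
  -- step 2
  obtain ⟨x1, hx1⟩ := genpos (n + 1) (↑S : Set (Ideal A)) hSmax hsplit (n + 1)
    (Ideal.span {h}) (fun q hq _ => hh q (hq (Ideal.mem_span_singleton_self h))) a1 m hu
  refine Kills.of_right x1 ?_
  replace hu := hu.right x1
  generalize m + a1 • x1 = m1 at hu hx1
  have hord1 : Ord m1 ⊔ Ideal.span {h} = ⊤ := by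
    refine eq_top_of_max _ fun q hq hle => ?_
    have hhq : h ∈ q.asIdeal := hle (Ideal.mem_sup_right (Ideal.mem_span_singleton_self h))
    have := hx1 q (le_sup_right.trans hle) (le_sup_left.trans hle) (fun hqS => hhS _ hqS hhq)
    exact absurd this (not_lt.2 le_add_self)
  clear hx1 x1 m
  -- step 3
  have hu1 : Uni (a1 * h) m1 := by
    obtain ⟨y, g, hyg⟩ := hu
    have h1 : (1 : A) ∈ Ord m1 ⊔ Ideal.span {h} := hord1 ▸ Submodule.mem_top
    obtain ⟨s, hs, t, ht, hst⟩ := Submodule.mem_sup.1 h1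
    obtain ⟨g', rfl⟩ := mem_Ord.1 hs
    obtain ⟨c, rfl⟩ := Ideal.mem_span_singleton.1 ht
    refine ⟨y * c, (y * a1) • g' + g, ?_⟩
    simp only [LinearMap.add_apply, LinearMap.smul_apply, smul_eq_mul]
    linear_combination hyg + (y * a1) * hst
  obtain ⟨x2, hx2⟩ := genpos (n + 1) (↑S : Set (Ideal A)) hSmax hsplit (n + 2) ⊥
    (fun q _ _ => lt_of_le_of_lt (coheight_le_of_dim hdim q) (by exact_mod_cast Nat.lt_succ_self _))
    (a1 * h) m1 hu1
  rw [mul_smul] at hx2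
  refine Kills.of_right (h • x2) ?_
  replace hu := hu.right (h • x2)
  have hord2 : Ord (m1 + a1 • h • x2) ⊔ Ideal.span {h} = ⊤ := by
    rw [eq_top_iff, ← hord1]
    refine sup_le ?_ le_sup_right
    exact ord_le_of_sub (x := a1 • x2) (by rw [smul_comm])
  generalize m1 + a1 • h • x2 = m2 at hu hx2 hord2
  clear hord1 hu1 m1
  have hmax2 : ∀ q : Ideal A, q.IsPrime → Ord m2 ≤ q → q.IsMaximal := by
    intro q hq hle
    by_cases hqS : q ∈ S
    · exact hSmax q hqS
    have h1 := hx2 ⟨q, hq⟩ bot_le hle hqS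
    have h2 : Order.coheight (⟨q, hq⟩ : PrimeSpectrum A) = 0 := by
      by_contra hne
      have h3 : (1 : ℕ∞) ≤ Order.coheight (⟨q, hq⟩ : PrimeSpectrum A) :=
        Order.one_le_iff_pos.2 (pos_iff_ne_zero.2 hne)
      have h4 : ((n + 2 : ℕ) : ℕ∞) ≤ Order.coheight (⟨q, hq⟩ : PrimeSpectrum A) + ((n + 1 : ℕ) : ℕ∞) := by
        calc ((n + 2 : ℕ) : ℕ∞) = 1 + ((n + 1 : ℕ) : ℕ∞) := by push_cast; ring
          _ ≤ _ := by gcongr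
      exact absurd h1 (not_lt.2 h4)
    rw [Order.coheight_eq_zero] at h2
    obtain ⟨q', hq', hle'⟩ := Ideal.exists_le_maximal q hq.ne_top
    have h5 := h2 (show (⟨q, hq⟩ : PrimeSpectrum A) ≤ ⟨q', hq'.isPrime⟩ from hle')
    have : q = q' := le_antisymm hle' h5
    rwa [this]
  clear hx2
  -- step 4
  obtain ⟨K, hKO, hKS, hKp⟩ : ∃ K : Ideal A, K ≤ Ord m2 ∧ (∀ q ∈ S, K ≤ q) ∧
      ∀ q : Ideal A, q.IsPrime → K ≤ q → Ord m2 ≤ q ∨ q ∈ S := by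
    refine ⟨Ord m2 * ∏ q ∈ S, q, Ideal.mul_le_left, fun q hq => Ideal.mul_le_right.trans ?_, ?_⟩
    · rw [Ideal.IsPrime.prod_le (hSmax q hq).isPrime]
      exact ⟨q, hq, le_rfl⟩
    · intro q hq hle
      rcases (Ideal.IsPrime.mul_le hq).1 hle with h | h
      · exact Or.inl h
      · rw [Ideal.IsPrime.prod_le hq] at h
        obtain ⟨q', hq', hle'⟩ := h
        right
        rwa [← hmaxeq q' hq' q hq.ne_top hle']
  have hKmax : ∀ q : Ideal A, q.IsPrime → K ≤ q → q.IsMaximal := by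
    intro q hq hle
    rcases hKp q hq hle with h | h
    · exact hmax2 q hq h
    · exact hSmax q h
  have haK' : ∀ q : Ideal A, q.IsPrime → K ≤ q → a1 ∉ q := by
    intro q hq hle haq
    rcases hKp q hq hle with h | h
    · exact hUq a1 m2 hu q hq.ne_top haq h
    · exact hzS q h haq
  have haK : Ideal.span {a1} ⊔ K = ⊤ := by
    refine eq_top_of_max _ fun q hq hle => ?_
    exact haK' q.asIdeal q.2 (le_sup_right.trans hle)
      (hle (Ideal.mem_sup_left (Ideal.mem_span_singleton_self _)))
  obtain ⟨b0, hb0⟩ := root_mod k A K hKmax (n + 1) (Nat.succ_pos n) a1 haK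
  have hhK : Ideal.span {h} ⊔ K = ⊤ := by
    refine eq_top_of_max _ fun q hq hle => ?_
    have hhq : h ∈ q.asIdeal := hle (Ideal.mem_sup_left (Ideal.mem_span_singleton_self h))
    rcases hKp q.asIdeal q.2 (le_sup_right.trans hle) with h' | h'
    · have : Ord m2 ⊔ Ideal.span {h} ≤ q.asIdeal := sup_le h' (le_sup_left.trans hle)
      rw [hord2] at this
      exact q.2.ne_top (top_le_iff.1 this)
    · exact hhS _ h' hhq
  obtain ⟨t, ht, κ, hκ, htκ⟩ := Submodule.mem_sup.1
    (show (1 : A) ∈ Ideal.span {h} ⊔ K from hhK ▸ Submodule.mem_top)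
  obtain ⟨c, rfl⟩ := Ideal.mem_span_singleton.1 ht
  clear ht
  have hpow : ∀ x : A, x - b0 ∈ K → x ^ (n + 1) - a1 ∈ K := by
    intro x hx
    have h1 : x ^ (n + 1) - b0 ^ (n + 1) ∈ K :=
      Ideal.mem_of_dvd _ (sub_dvd_pow_sub_pow x b0 (n + 1)) hx
    have := K.add_mem h1 hb0
    simpa using this
  have hnotin : ∀ x : A, x - b0 ∈ K → ∀ q : Ideal A, q.IsPrime → K ≤ q → x ∉ q := by
    intro x hx q hq hle hxq
    apply haK' q hq hle
    have h1 : x ^ (n + 1) ∈ q := Ideal.pow_mem_of_mem _ hxq _ (Nat.succ_pos n)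
    have := q.sub_mem h1 (hle (hpow x hx))
    simpa using this
  obtain ⟨b1, hb1K, hb1h⟩ : ∃ b1 : A, b1 - b0 ∈ K ∧ h ∣ b1 - 1 := by
    refine ⟨b0 * (h * c) + κ, ?_, b0 * c - c, ?_⟩
    · have : b0 * (h * c) + κ - b0 = (1 - b0) * κ := by linear_combination b0 * htκ
      rw [this]; exact K.mul_mem_left _ hκ
    · linear_combination htκ
  have hfin := Ideal.finite_minimalPrimes_of_isNoetherianRing A (⊥ : Ideal A)
  obtain ⟨z, hz, hzT⟩ := avoid hfin.toFinset
    (fun q hq => (hfin.mem_toFinset.1 hq).1.1)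
    (fun q hq q' hq' hle => minPrimes_inc (hfin.mem_toFinset.1 hq) (hfin.mem_toFinset.1 hq') hle)
    (K * Ideal.span {h}) b1 (by
      intro q hq hbq hle
      have hp : q.IsPrime := (hfin.mem_toFinset.1 hq).1.1
      rcases (Ideal.IsPrime.mul_le hp).1 hle with h' | h'
      · exact hnotin b1 hb1K q hp h' hbq
      · have hhq : h ∈ q := h' (Ideal.mem_span_singleton_self h)
        apply hp.ne_top
        rw [Ideal.eq_top_iff_one]
        have := q.sub_mem hbq (Ideal.mem_of_dvd q hb1h hhq)
        simpa using this)
  have hzK : z ∈ K := (Ideal.mul_le_left : K * Ideal.span {h} ≤ K) hz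
  have hzh : h ∣ z := Ideal.mem_span_singleton.1
    ((Ideal.mul_le_right : K * Ideal.span {h} ≤ Ideal.span {h}) hz)
  have hbK : b1 + z - b0 ∈ K := by
    have := K.add_mem hb1K hzK
    rwa [show b1 - b0 + z = b1 + z - b0 by ring] at this
  have hbh : h ∣ (b1 + z) - 1 := by
    have := dvd_add hb1h hzh
    rwa [show b1 - 1 + z = b1 + z - 1 by ring] at this
  have hbT : ∀ q ∈ minimalPrimes A, b1 + z ∉ q := fun q hq => hzT q (hfin.mem_toFinset.2 hq)
  generalize b1 + z = b at hbK hbh hbT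
  obtain ⟨g, hg⟩ := mem_Ord.1 (hKO (hpow b hbK))
  refine Kills.of_left g ?_
  replace hu := hu.left g
  have hab : a1 + g m2 = b ^ (n + 1) := by rw [hg]; ring
  rw [hab] at hu ⊢
  have hFM : FreeMod (n + 1) M b := by
    refine H3 b ?_ (fun q hq => hnotin b hbK q (hSmax q hq).isPrime (hKS q hq)) hbT
    obtain ⟨s, hs⟩ := hbh
    exact ⟨1, -s, by linear_combination hs⟩
  haveI : Algebra.FiniteType k (A ⧸ Ideal.span {b}) :=
    Algebra.FiniteType.of_surjective (Ideal.Quotient.mkₐ k (Ideal.span {b}))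
      (Ideal.Quotient.mk_surjective)
  refine key2 n b hFM (hSn (A ⧸ Ideal.span {b}) (dim_quot_lt hdim b hbT)) m2 ?_
  obtain ⟨y, g', hyg⟩ := hu
  exact ⟨g', y * b ^ n, by rw [← hyg]; ring⟩

theorem HasSplit.pi {A : Type*} [CommRing A] (n : ℕ) (q : Ideal A) (hq : q ≠ ⊤) :
    HasSplit n (Fin n → A) q := by
  refine ⟨fun j => Pi.single j 1, fun i => LinearMap.proj i, 1, ?_, fun i j => ?_⟩
  · rwa [← Ideal.eq_top_iff_one]
  · simp [Pi.single_apply]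

theorem FreeMod.pi {A : Type*} [CommRing A] (n : ℕ) (b : A) :
    FreeMod n (Fin n → A) b := by
  refine ⟨fun j => Pi.single j 1, fun i => LinearMap.proj i, fun i j => ?_, fun N hN _ => ?_⟩
  · simp [Pi.single_apply]
  · rw [eq_top_iff]
    intro x _
    have hx : x = ∑ i, Pi.single i (x i) := (Finset.univ_sum_single x).symm
    rw [hx]
    refine N.sum_mem fun i _ => ?_
    have := N.smul_mem (x i) (hN i)
    rwa [← Pi.single_smul, smul_eq_mul, mul_one] at this

theorem sprop (n : ℕ) : SProp k n := by
  induction n with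
  | zero =>
    intro B _ _ _ _ a p _
    exact ⟨0, fun y => ⟨0, Subsingleton.elim _ _⟩, rfl⟩
  | succ n ih =>
    intro B _ _ _ hdim a p hu
    refine Zstep k n ih B hdim (Fin (n + 1) → B) ∅ (by simp) 1 (by simp)
      (fun q _ => HasSplit.pi _ _ q.2.ne_top) (fun q hq => ?_) (fun b _ _ _ => FreeMod.pi _ _) a p hu
    exact absurd ((Ideal.eq_top_iff_one _).2 hq) q.2.ne_top
end Z
end RMC

namespace RMC
section loc
variable {R : Type} [CommRing R] [IsDomain R] {X : Type} [AddCommGroup X] [Module R X]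

theorem tf_of_reflexive (h : Module.IsReflexive R X) (r : R) (x : X) (hx : r • x = 0) :
    r = 0 ∨ x = 0 := by
  by_cases hr : r = 0
  · exact Or.inl hr
  right
  apply (Module.bijective_dual_eval R X).1
  rw [map_zero]
  ext g
  have : r * g x = 0 := by rw [← smul_eq_mul, ← map_smul, hx, map_zero]
  simpa [hr] using this

theorem full_of_rank (hTF : ∀ (r : R) (x : X), r • x = 0 → r = 0 ∨ x = 0) (n : ℕ)
    (hrk : Module.rank R X = n) (e : Fin n → X) (f : Fin n → X →ₗ[R] R) (D : R) (hD : D ≠ 0)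
    (hfe : ∀ i j, f i (e j) = if i = j then D else 0) (x : X) : ∑ i, f i x • e i = D • x := by
  by_contra hne
  set y : X := D • x - ∑ i, f i x • e i with hy
  have hy0 : y ≠ 0 := fun h => hne (sub_eq_zero.1 h).symm
  have hfy : ∀ i, f i y = 0 := by
    intro i
    simp only [hy, map_sub, map_smul, map_sum, hfe, smul_eq_mul, mul_ite, mul_zero,
      Finset.sum_ite_eq, Finset.mem_univ, if_true]
    ring
  have hli : LinearIndependent R (Fin.cons y e : Fin (n + 1) → X) := by
    rw [Fintype.linearIndependent_iff]
    intro c hc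
    rw [Fin.sum_univ_succ] at hc
    simp only [Fin.cons_zero, Fin.cons_succ] at hc
    have h1 : ∀ i : Fin n, c i.succ = 0 := by
      intro i
      have := congrArg (f i) hc
      simp only [map_add, map_smul, hfy, smul_zero, zero_add, map_sum, hfe, smul_eq_mul, mul_ite,
        mul_zero, Finset.sum_ite_eq, Finset.mem_univ, if_true, map_zero] at this
      simpa [hD] using this
    have h0 : c 0 = 0 := by
      simp only [h1, zero_smul, Finset.sum_const_zero, add_zero] at hc
      exact (hTF _ _ hc).resolve_right hy0
    intro i
    exact Fin.cases h0 h1 i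
  have := hli.cardinal_le_rank
  rw [hrk] at this
  simp only [Cardinal.mk_fin] at this
  have := Nat.cast_le.1 this
  omega

theorem hasSplit_of_free [IsNoetherianRing R] [Module.Finite R X] (n : ℕ)
    (hrk : Module.rank R X = n) (q : Ideal R) [q.IsPrime]
    (hfree : Module.Free (Localization.AtPrime q) (LocalizedModule q.primeCompl X)) :
    HasSplit n X q := by
  let L := Localization.AtPrime q
  have hp : q.primeCompl ≤ nonZeroDivisors R := q.primeCompl_le_nonZeroDivisors
  have hrk2 : Module.rank L (LocalizedModule q.primeCompl X) = n := by
    rw [IsLocalization.rank_eq (R := R) L q.primeCompl hp,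
      IsLocalizedModule.rank_eq q.primeCompl hp (LocalizedModule.mkLinearMap q.primeCompl X), hrk]
  have hinj : Function.Injective (algebraMap R L) := IsLocalization.injective L hp
  haveI : Nontrivial L := hinj.nontrivial
  have hfr : Module.finrank L (LocalizedModule q.primeCompl X) = n :=
    Module.finrank_eq_of_rank_eq hrk2
  let β : Module.Basis (Fin n) L (LocalizedModule q.primeCompl X) := Module.finBasisOfFinrankEq _ _ hfr
  have he : ∀ j, ∃ (e : X) (t : q.primeCompl),
      LocalizedModule.mkLinearMap q.primeCompl X e = (t : R) • β j := by
    intro j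
    obtain ⟨⟨e, t⟩, h⟩ := IsLocalizedModule.surj q.primeCompl
      (LocalizedModule.mkLinearMap q.primeCompl X) (β j)
    exact ⟨e, t, h.symm⟩
  choose e t het using he
  haveI : Module.FinitePresentation R X := Module.finitePresentation_of_finite R X
  have hf : ∀ i, ∃ (f : X →ₗ[R] R) (s : q.primeCompl), ∀ x, algebraMap R L (f x) =
      (s : R) • β.coord i (LocalizedModule.mkLinearMap q.primeCompl X x) := by
    intro i
    obtain ⟨f, s, h⟩ := Module.FinitePresentation.exists_lift_of_isLocalizedModule q.primeCompl
      (Algebra.linearMap R L) ((β.coord i).restrictScalars R ∘ₗ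
        LocalizedModule.mkLinearMap q.primeCompl X)
    refine ⟨f, s, fun x => ?_⟩
    exact LinearMap.congr_fun h x
  choose f s hfs using hf
  have hfe : ∀ i j, f i (e j) = if i = j then (s i : R) * (t i : R) else 0 := by
    intro i j
    apply hinj
    rw [hfs, het]
    have : β.coord i ((t j : R) • β j) = (t j : R) • (if i = j then 1 else 0) := by
      rw [← IsScalarTower.algebraMap_smul L (t j : R) (β j), map_smul, Module.Basis.coord_apply,
        Module.Basis.repr_self, Finsupp.single_apply, algebraMap_smul]
      simp [eq_comm]
    rw [this]
    split_ifs with h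
    · subst h
      simp [Algebra.smul_def]
    · simp
  obtain ⟨f', hf'⟩ := exact_dual e f
  refine ⟨e, f', _, ?_, hf'⟩
  have : (Matrix.of fun i j => f i (e j)) = Matrix.diagonal (fun i => (s i : R) * (t i : R)) := by
    ext i j
    simp [hfe, Matrix.diagonal_apply]
  rw [this, Matrix.det_diagonal]
  exact prod_mem (S := q.primeCompl) fun i _ => mul_mem (s i).2 (t i).2

theorem hasSplit_of_projective [IsNoetherianRing R] [Module.Finite R X] [Module.Projective R X]
    (n : ℕ) (hrk : Module.rank R X = n) (q : Ideal R) [q.IsPrime] : HasSplit n X q := by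
  apply hasSplit_of_free n hrk
  haveI : Module.Flat (Localization.AtPrime q) (LocalizedModule q.primeCompl X) := inferInstance
  exact Module.free_of_flat_of_isLocalRing

theorem exists_rank [IsNoetherianRing R] [Module.Finite R X] : ∃ n : ℕ, Module.rank R X = n :=
  ⟨Module.finrank R X, (Module.finrank_eq_rank R X).symm⟩

theorem rank_of_frac (n : ℕ)
    (hrank : Module.rank (FractionRing R) (TensorProduct R (FractionRing R) X) = n) :
    Module.rank R X = n := by
  rw [← hrank, IsLocalization.rank_eq (R := R) (FractionRing R) (nonZeroDivisors R) le_rfl,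
      IsLocalizedModule.rank_eq (nonZeroDivisors R) le_rfl (TensorProduct.mk R (FractionRing R) X 1)]

end loc
end RMC

namespace RMC
section appr
variable {R : Type} [CommRing R]

/-- multiplication by r factors through a projective module -/
def Fac (X : Type) [AddCommGroup X] [Module R X] (r : R) : Prop :=
  ∃ (P : Type) (_ : AddCommGroup P) (_ : Module R P) (_ : Module.Projective R P)
    (α : X →ₗ[R] P) (β : P →ₗ[R] X), ∀ x, β (α x) = r • x

/-- X and Y are isomorphic modulo b in a strong sense -/
def Appr (b : R) (X Y : Type) [AddCommGroup X] [Module R X] [AddCommGroup Y] [Module R Y] : Prop :=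
  ∃ (φ : X →ₗ[R] Y) (ψ : Y →ₗ[R] X) (r : R), b ∣ r - 1 ∧ (∀ x, ψ (φ x) = r • x) ∧
    ∀ y, φ (ψ y) = r • y

variable {X Y Z : Type} [AddCommGroup X] [Module R X] [AddCommGroup Y] [Module R Y]
  [AddCommGroup Z] [Module R Z]

theorem Appr.of_equiv (b : R) (E : X ≃ₗ[R] Y) : Appr b X Y :=
  ⟨E.toLinearMap, E.symm.toLinearMap, 1, by simp, by simp, by simp⟩

theorem Appr.symm {b : R} (h : Appr b X Y) : Appr b Y X := by
  obtain ⟨φ, ψ, r, hr, h1, h2⟩ := h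
  exact ⟨ψ, φ, r, hr, h2, h1⟩

theorem Appr.trans {b : R} (h : Appr b X Y) (h' : Appr b Y Z) : Appr b X Z := by
  obtain ⟨φ, ψ, r, ⟨c, hr⟩, h1, h2⟩ := h
  obtain ⟨φ', ψ', r', ⟨c', hr'⟩, h1', h2'⟩ := h'
  refine ⟨φ' ∘ₗ φ, ψ ∘ₗ ψ', r * r', ⟨c * r' + c', ?_⟩, ?_, ?_⟩
  · linear_combination r' * hr + hr'
  · intro x; simp [h1', h1, mul_smul, smul_comm r r']
  · intro x; simp [h2', h2, mul_smul]

theorem Appr.prod {b : R} (h : Appr b X Y) (Z : Type) [AddCommGroup Z] [Module R Z] :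
    Appr b (X × Z) (Y × Z) := by
  obtain ⟨φ, ψ, r, hr, h1, h2⟩ := h
  refine ⟨φ.prodMap LinearMap.id, ψ.prodMap (r • LinearMap.id), r, hr, ?_, ?_⟩
  · rintro ⟨x, z⟩; simp [h1]
  · rintro ⟨x, z⟩; simp [h2]

theorem Fac.add {r s : R} (h : Fac X r) (h' : Fac X s) : Fac X (r + s) := by
  obtain ⟨P, _, _, _, α, β, h⟩ := h
  obtain ⟨P', _, _, _, α', β', h'⟩ := h'
  refine ⟨P × P', inferInstance, inferInstance, inferInstance, α.prod α', β.coprod β', ?_⟩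
  intro x; simp [h, h', add_smul]

theorem Fac.smul {r : R} (s : R) (h : Fac X r) : Fac X (s * r) := by
  obtain ⟨P, _, _, _, α, β, h⟩ := h
  exact ⟨P, inferInstance, inferInstance, inferInstance, α, s • β, by intro x; simp [h, mul_smul]⟩

/-- the ideal of r with Fac -/
def FacIdeal (X : Type) [AddCommGroup X] [Module R X] : Ideal R where
  carrier := {r | Fac X r}
  add_mem' := fun h h' => Fac.add h h'
  zero_mem' := ⟨R, inferInstance, inferInstance, inferInstance, 0, 0, by simp⟩
  smul_mem' := fun s r h => Fac.smul s h

theorem resolve {r b : R} (hr : b ∣ r - 1) (hX : Fac X r) (F : Type) [AddCommGroup F] [Module R F]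
    [Module.Projective R F]
    (π : F →ₗ[R] X) (hπ : Function.Surjective π) :
    Fac (LinearMap.ker π) r ∧ Appr b (X × LinearMap.ker π) F := by
  obtain ⟨P, _, _, _, α, β, h⟩ := hX
  obtain ⟨β', hβ'⟩ := Module.projective_lifting_property π β hπ
  let σ : X →ₗ[R] F := β' ∘ₗ α
  have hσ : ∀ x, π (σ x) = r • x := by
    intro x
    rw [← h]
    exact LinearMap.congr_fun hβ' (α x)
  let ρ : F →ₗ[R] LinearMap.ker π := LinearMap.codRestrict (LinearMap.ker π)
    (r • LinearMap.id - σ ∘ₗ π) (by intro z; simp [hσ])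
  have hρ : ∀ z, (ρ z : F) = r • z - σ (π z) := by intro z; rfl
  have hρk : ∀ y : LinearMap.ker π, ρ y = r • y := by
    intro y
    ext
    rw [hρ, y.2]
    simp
  refine ⟨⟨F, inferInstance, inferInstance, inferInstance, (LinearMap.ker π).subtype, ρ, hρk⟩,
    σ.coprod (LinearMap.ker π).subtype, π.prod ρ, r, hr, ?_, ?_⟩
  · rintro ⟨x, y⟩
    have h1 : π (y : F) = 0 := y.2
    have h2 : ρ (σ x) = 0 := by
      ext
      rw [hρ, hσ]; simp
    simp [hσ, h1, h2, hρk]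
  · intro z
    simp [hρ]

end appr

section pd
open CategoryTheory

variable {R : Type} [CommRing R]

/-- the short complex of a surjection -/
theorem kerShort {F X : Type} [AddCommGroup F] [Module R F] [AddCommGroup X] [Module R X]
    (π : F →ₗ[R] X) (hπ : Function.Surjective π) :
    ∃ S : ShortComplex (ModuleCat.{0} R), S.ShortExact ∧
      S.X₁ = ModuleCat.of R (LinearMap.ker π) ∧ S.X₂ = ModuleCat.of R F ∧
      S.X₃ = ModuleCat.of R X := by
  refine ⟨⟨ModuleCat.ofHom (LinearMap.ker π).subtype, ModuleCat.ofHom π, by ext x; exact x.2⟩,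
    ?_, rfl, rfl, rfl⟩
  refine ShortComplex.ShortExact.mk' ?_ ?_ ?_
  · rw [ShortComplex.moduleCat_exact_iff]
    intro x hx
    exact ⟨⟨x, hx⟩, rfl⟩
  · rw [ModuleCat.mono_iff_injective]
    exact Subtype.val_injective
  · rw [ModuleCat.epi_iff_surjective]
    exact hπ

theorem pd_of_res (n : ℕ) : ∀ (P : ℕ → ModuleCat.{0} R) (d : ∀ i, P (i + 1) ⟶ P i) (X : Type)
    [AddCommGroup X] [Module R X] (ε : P 0 ⟶ ModuleCat.of R X),
    (∀ i, CategoryTheory.Projective (P i)) → Function.Surjective ε → Function.Exact (d 0) ε →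
    (∀ i, Function.Exact (d (i + 1)) (d i)) → (∀ i, n ≤ i → Subsingleton (P i)) →
    HasProjectiveDimensionLT (ModuleCat.of R X) n := by
  induction n with
  | zero =>
    intro P d X _ _ ε _ hs _ _ hn
    apply Limits.IsZero.hasProjectiveDimensionLT_zero
    have := hn 0 le_rfl
    have : Subsingleton (ModuleCat.of R X) := hs.subsingleton
    exact ModuleCat.isZero_of_subsingleton _
  | succ n ih =>
    intro P d X _ _ ε hP hs h0 hex hn
    have hmem : ∀ x : P 1, (d 0).hom x ∈ LinearMap.ker ε.hom := by
      intro x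
      exact h0.apply_apply_eq_zero x
    have h1 := ih (fun i => P (i + 1)) (fun i => d (i + 1)) (LinearMap.ker ε.hom)
      (ModuleCat.ofHom (LinearMap.codRestrict (LinearMap.ker ε.hom) (d 0).hom hmem))
      (fun i => hP (i + 1)) ?_ ?_ (fun i => hex (i + 1)) (fun i hi => hn (i + 1) (by omega))
    · obtain ⟨S, hS, e1, e2, e3⟩ := kerShort ε.hom hs
      rw [← e3]
      rw [← e1] at h1
      refine hS.hasProjectiveDimensionLT_X₃ n h1 ?_
      rw [e2]
      have : CategoryTheory.Projective (ModuleCat.of R (P 0)) := hP 0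
      exact hasProjectiveDimensionLT_of_ge _ 1 _ (by omega)
    · rintro ⟨y, hy⟩
      obtain ⟨x, hx⟩ := (h0 y).1 hy
      exact ⟨x, Subtype.ext hx⟩
    · intro x
      rw [← (hex 0) x]
      exact Subtype.ext_iff

theorem pd_ker {F X : Type} [AddCommGroup F] [Module R F] [AddCommGroup X] [Module R X]
    (hF : Module.Projective R F)
    (π : F →ₗ[R] X) (hπ : Function.Surjective π) (n : ℕ)
    (h : HasProjectiveDimensionLT (ModuleCat.of R X) (n + 2)) :
    HasProjectiveDimensionLT (ModuleCat.of R (LinearMap.ker π)) (n + 1) := by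
  obtain ⟨S, hS, e1, e2, e3⟩ := kerShort π hπ
  rw [← e1]
  rw [← e3] at h
  refine (hS.hasProjectiveDimensionLT_X₃_iff n ?_).1 h
  rw [e2]
  exact (IsProjective.iff_projective F).1 hF

theorem pd_one {X : Type} [AddCommGroup X] [Module R X]
    (h : HasProjectiveDimensionLT (ModuleCat.of R X) 1) : Module.Projective R X :=
  (IsProjective.iff_projective X).2 (projective_iff_hasProjectiveDimensionLT_one.2 h)

end pd

section stably

variable {R : Type} [CommRing R] [IsDomain R] [IsNoetherianRing R]

theorem stably (S : Finset (Ideal R)) (hS : ∀ q ∈ S, q.IsMaximal) (hne : S.Nonempty) (l : ℕ) :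
    ∀ (X : Type) [AddCommGroup X] [Module R X] [Module.Finite R X],
      CategoryTheory.HasProjectiveDimensionLT (ModuleCat.of R X) (l + 1) →
      ∃ h : R, h ≠ 0 ∧ (∀ q ∈ S, h ∉ q) ∧ ∀ b r : R, IsCoprime b h → b ∣ r - 1 → Fac X r →
        ∃ u v : ℕ, Appr b (X × (Fin u → R)) (Fin v → R) := by
  induction l with
  | zero =>
    intro X _ _ _ hpd
    have hproj : Module.Projective R X := pd_one hpd
    obtain ⟨n, hn⟩ := exists_rank (R := R) (X := X)
    obtain ⟨e, f, D, hD, hfe⟩ := combine (X := X) (n := n) S (fun q hq => (hS q hq).isPrime)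
      (fun q hq q' hq' hle => (hS q hq).eq_of_le (hS q' hq').ne_top hle)
      (fun q hq => by
        have := (hS q hq).isPrime
        exact hasSplit_of_projective n hn q)
    have hD0 : D ≠ 0 := by
      obtain ⟨q, hq⟩ := hne
      rintro rfl
      exact hD q hq q.zero_mem
    have hTF : ∀ (r : R) (x : X), r • x = 0 → r = 0 ∨ x = 0 := by
      intro r x h
      exact smul_eq_zero.1 h
    have hfull := full_of_rank hTF n hn e f D hD0 hfe
    refine ⟨D, hD0, hD, fun b r hb _ _ => ⟨0, n, ?_⟩⟩
    obtain ⟨y, c, hyc⟩ := hb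
    refine Appr.trans (Y := X) (Appr.of_equiv b LinearEquiv.prodUnique) ?_
    refine ⟨LinearMap.pi f, c • ∑ i, (LinearMap.proj i : (Fin n → R) →ₗ[R] R).smulRight (e i),
      c * D, ⟨-y, by linear_combination hyc⟩, ?_, ?_⟩
    · intro x
      simp only [LinearMap.smul_apply, LinearMap.sum_apply, LinearMap.smulRight_apply,
        LinearMap.proj_apply, LinearMap.pi_apply, hfull, mul_smul]
    · intro z
      ext i
      simp [hfe, mul_comm, mul_left_comm]
  | succ l ih =>
    intro X _ _ _ hpd
    obtain ⟨w, π, hπ⟩ := Module.Finite.exists_fin' R X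
    obtain ⟨h, h0, hhS, H⟩ := ih (LinearMap.ker π) (pd_ker inferInstance π hπ l hpd)
    refine ⟨h, h0, hhS, fun b r hb hr hX => ?_⟩
    obtain ⟨hK, hA⟩ := resolve hr hX (Fin w → R) π hπ
    obtain ⟨u, v, hB⟩ := H b r hb hr hK
    refine ⟨v, w + u, ?_⟩
    have s1 : Appr b (X × (Fin v → R)) ((Fin v → R) × X) :=
      Appr.of_equiv b (LinearEquiv.prodComm R _ _)
    have s2 := (hB.symm.prod X)
    have s3 : Appr b ((LinearMap.ker π × (Fin u → R)) × X)
        ((X × LinearMap.ker π) × (Fin u → R)) :=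
      Appr.of_equiv b ((LinearEquiv.prodComm R _ _) ≪≫ₗ (LinearEquiv.prodAssoc R _ _ _).symm)
    have s4 := hA.prod (Fin u → R)
    have s5 : Appr b ((Fin w → R) × (Fin u → R)) (Fin (w + u) → R) :=
      Appr.of_equiv b ((LinearEquiv.sumArrowLequivProdArrow (Fin w) (Fin u) R R).symm ≪≫ₗ
        LinearEquiv.funCongrLeft R R finSumFinEquiv.symm)
    exact s1.trans (s2.trans (s3.trans (s4.trans s5)))
end stably
end RMC

namespace RMC
section fin

theorem HasSplit.prod {A : Type*} [CommRing A] {n : ℕ} {X : Type*} [AddCommGroup X] [Module A X]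
    {q : Ideal A} (h : HasSplit n X q) : HasSplit (n + 1) (A × X) q := by
  obtain ⟨e, f, D, hD, h⟩ := h
  refine ⟨Fin.cons (D, 0) (fun i => (0, e i)), Fin.cons (LinearMap.fst A A X)
    (fun i => f i ∘ₗ LinearMap.snd A A X), D, hD, ?_⟩
  intro i j
  refine Fin.cases ?_ (fun i => ?_) i <;> refine Fin.cases ?_ (fun j => ?_) j
  · simp
  · simp [(Fin.succ_ne_zero _).symm]
  · simp [(Fin.succ_ne_zero _)]
  · simp [h]

theorem FreeMod.prod {A : Type*} [CommRing A] {n : ℕ} {X : Type*} [AddCommGroup X] [Module A X]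
    {b : A} (h : FreeMod n X b) : FreeMod (n + 1) (A × X) b := by
  obtain ⟨w, f, h, hg⟩ := h
  refine ⟨Fin.cons (1, 0) (fun i => (0, w i)), Fin.cons (LinearMap.fst A A X)
    (fun i => f i ∘ₗ LinearMap.snd A A X), ?_, ?_⟩
  · intro i j
    refine Fin.cases ?_ (fun i => ?_) i <;> refine Fin.cases ?_ (fun j => ?_) j
    · simp
    · simp [(Fin.succ_ne_zero _).symm]
    · simp [(Fin.succ_ne_zero _)]
    · simpa using h i j
  · intro N hN hb
    have h1 : ((1 : A), (0 : X)) ∈ N := by simpa using hN 0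
    have h2 : N.comap (LinearMap.inr A A X) = ⊤ := by
      apply hg
      · intro i
        simpa using hN i.succ
      · intro x
        simpa using hb (0, x)
    rw [eq_top_iff]
    rintro ⟨r, x⟩ -
    have h3 : ((0 : A), x) ∈ N := by
      have : x ∈ N.comap (LinearMap.inr A A X) := by rw [h2]; trivial
      simpa using this
    have := add_mem (N.smul_mem r h1) h3
    simpa using this

theorem bass {B : Type} [CommRing B] [IsNoetherianRing B] (n : ℕ)
    (hB : ∀ q : PrimeSpectrum B, Order.coheight q < n) (u : ℕ) (Y : Type) [AddCommGroup Y]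
    [Module B Y] (h : Nonempty (((Fin u → B) × (Fin n → B)) ≃ₗ[B] ((Fin u → B) × Y))) :
    Nonempty ((Fin n → B) ≃ₗ[B] Y) := by
  refine cancel_iter (A := B) (fun X _ _ => Module.Finite B X ∧
    ∃ m : ℕ, n ≤ m ∧ ∀ q : PrimeSpectrum B, HasSplit m X q.asIdeal) ?_ ?_ ?_ u (Fin n → B) Y ?_ h
  · rintro X _ _ ⟨h1, m, hm, h2⟩
    exact ⟨inferInstance, m + 1, by omega, fun q => (h2 q).prod⟩
  · rintro X _ _ ⟨h1, _⟩
    exact h1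
  · rintro X _ _ ⟨h1, r, hr, h2⟩ a m hu
    obtain ⟨x, hx⟩ := genpos r (∅ : Set (Ideal B)) (by simp) (fun q _ => h2 q) r ⊥
      (fun q _ _ => (hB q).trans_le (by exact_mod_cast hr)) a m hu
    apply Kills.of_right x
    apply Kills.of_ord_top
    apply eq_top_of_max
    intro q _ hq
    have := hx q bot_le hq (by simp)
    exact absurd this (by simp)
  · exact ⟨inferInstance, n, le_rfl, fun q => HasSplit.pi _ _ q.2.ne_top⟩

end fin

section fm
variable {R : Type} [CommRing R] [IsDomain R] [IsNoetherianRing R]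
variable {M : Type} [AddCommGroup M] [Module R M] [Module.Finite R M]

theorem rank_appr (hTF : ∀ (r : R) (x : M), r • x = 0 → r = 0 ∨ x = 0) (n u v : ℕ)
    (hrk : Module.rank R M = n) (b : R) (hb : ¬ IsUnit b)
    (h : Appr b (M × (Fin u → R)) (Fin v → R)) : v = u + n := by
  obtain ⟨φ, ψ, r, hr, h1, h2⟩ := h
  have hr0 : r ≠ 0 := by
    rintro rfl
    apply hb
    rw [zero_sub, dvd_neg] at hr
    exact isUnit_of_dvd_one hr
  have i1 : Function.Injective φ := by
    rw [injective_iff_map_eq_zero]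
    rintro ⟨x, y⟩ hx
    have := h1 (x, y)
    rw [hx, map_zero] at this
    have e1 := congrArg Prod.fst this
    have e2 := congrArg Prod.snd this
    simp only [Prod.fst_zero, Prod.snd_zero, Prod.smul_fst, Prod.smul_snd] at e1 e2
    have e1' := (hTF r x e1.symm).resolve_left hr0
    have e2' := (smul_eq_zero.1 e2.symm).resolve_left hr0
    rw [e1', e2']; rfl
  have i2 : Function.Injective ψ := by
    rw [injective_iff_map_eq_zero]
    intro x hx
    have := h2 x
    rw [hx, map_zero] at this
    exact (smul_eq_zero.1 this.symm).resolve_left hr0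
  have r1 := LinearMap.rank_le_of_injective φ i1
  have r2 := LinearMap.rank_le_of_injective ψ i2
  have e := r1.antisymm r2
  have e3 : Module.rank R (M × (Fin u → R)) = u + n := by
    rw [LinearMap.rank_eq_of_surjective (f := LinearMap.snd R M (Fin u → R)) LinearMap.snd_surjective]
    rw [LinearMap.ker_snd, LinearEquiv.rank_eq (LinearEquiv.ofInjective _ LinearMap.inl_injective).symm,
      hrk]
    simp
  rw [e3] at e
  simp at e
  exact_mod_cast e.symm

open TensorProduct in
theorem bc_equiv {R B X Y : Type} [CommRing R] [CommRing B] [Algebra R B] [AddCommGroup X]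
    [Module R X] [AddCommGroup Y] [Module R Y] (φ : X →ₗ[R] Y) (ψ : Y →ₗ[R] X) (r : R)
    (hr : algebraMap R B r = 1) (h1 : ∀ x, ψ (φ x) = r • x) (h2 : ∀ y, φ (ψ y) = r • y) :
    Nonempty ((B ⊗[R] X) ≃ₗ[B] (B ⊗[R] Y)) := by
  have c1 : ψ ∘ₗ φ = r • LinearMap.id := LinearMap.ext fun y => by simp [h1]
  have c2 : φ ∘ₗ ψ = r • LinearMap.id := LinearMap.ext fun y => by simp [h2]
  have hz : ∀ (Y : Type) [AddCommGroup Y] [Module R Y] (z : B ⊗[R] Y), r • z = z := by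
    intro Y _ _ z
    rw [← algebraMap_smul B r z, hr, one_smul]
  refine ⟨LinearEquiv.ofLinearMap (φ.baseChange B) (ψ.baseChange B) ?_ ?_⟩
  · rw [← LinearMap.baseChange_comp, c2, LinearMap.baseChange_smul]
    refine LinearMap.ext fun z => ?_
    simp [hz]
  · rw [← LinearMap.baseChange_comp, c1, LinearMap.baseChange_smul]
    refine LinearMap.ext fun z => ?_
    simp [hz]

open TensorProduct in
theorem bc_split {R B M : Type} [CommRing R] [CommRing B] [Algebra R B] [AddCommGroup M]
    [Module R M] (n u : ℕ) (h : Nonempty ((B ⊗[R] (M × (Fin u → R))) ≃ₗ[B]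
      (B ⊗[R] (Fin (u + n) → R)))) :
    Nonempty (((Fin u → B) × (Fin n → B)) ≃ₗ[B] ((Fin u → B) × (B ⊗[R] M))) := by
  obtain ⟨E⟩ := h
  let E1 : (B ⊗[R] (Fin (u + n) → R)) ≃ₗ[B] (Fin (u + n) → B) := piScalarRight R B B _
  let E2 : (Fin (u + n) → B) ≃ₗ[B] ((Fin u → B) × (Fin n → B)) :=
    (LinearEquiv.funCongrLeft B B finSumFinEquiv).trans (LinearEquiv.sumArrowLequivProdArrow _ _ _ _)
  let E3 : (B ⊗[R] (M × (Fin u → R))) ≃ₗ[B] ((B ⊗[R] M) × (B ⊗[R] (Fin u → R))) :=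
    prodRight R B B _ _
  let E4 : ((B ⊗[R] M) × (B ⊗[R] (Fin u → R))) ≃ₗ[B] ((Fin u → B) × (B ⊗[R] M)) :=
    (LinearEquiv.prodComm B _ _).trans ((piScalarRight R B B (Fin u)).prodCongr (LinearEquiv.refl B _))
  exact ⟨E2.symm.trans (E1.symm.trans (E.symm.trans (E3.trans E4)))⟩

open TensorProduct in
theorem free_quot (n u : ℕ) (b : R)
    (h : Appr b (M × (Fin u → R)) (Fin (u + n) → R)) :
    Nonempty (((Fin u → R ⧸ Ideal.span {b}) × (Fin n → R ⧸ Ideal.span {b})) ≃ₗ[R ⧸ Ideal.span {b}]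
      ((Fin u → R ⧸ Ideal.span {b}) × ((R ⧸ Ideal.span {b}) ⊗[R] M))) := by
  obtain ⟨φ, ψ, r, hr, h1, h2⟩ := h
  refine bc_split n u (bc_equiv φ ψ r ?_ h1 h2)
  rw [← sub_eq_zero, ← map_one (algebraMap R _), ← map_sub]
  exact Ideal.Quotient.eq_zero_iff_mem.2 (Ideal.mem_span_singleton.2 hr)

open TensorProduct in
theorem freeMod_of_equiv (n : ℕ) (b r : R) (hr : b ∣ r - 1) (hF : Fac M r)
    (h : Nonempty ((Fin n → R ⧸ Ideal.span {b}) ≃ₗ[R ⧸ Ideal.span {b}]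
      ((R ⧸ Ideal.span {b}) ⊗[R] M))) : FreeMod n M b := by
  classical
  obtain ⟨E⟩ := h
  let B := R ⧸ Ideal.span {b}
  let ι : M →ₗ[R] B ⊗[R] M := TensorProduct.mk R B M 1
  have hι : Function.Surjective ι := TensorProduct.mk_surjective R M B Ideal.Quotient.mk_surjective
  have hker : LinearMap.ker ι = (Ideal.span {b}) • ⊤ := LinearMap.ker_tensorProductMk M
  choose w hw using fun i : Fin n => hι (E (Pi.single i 1))
  obtain ⟨P, _, _, _, α, β, hαβ⟩ := hF
  let π : R →ₗ[R] B := (Ideal.span {b}).mkQ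
  have hπ : Function.Surjective π := Submodule.mkQ_surjective _
  have hrB : π r = 1 := by
    change algebraMap R B r = 1
    rw [← sub_eq_zero, ← map_one (algebraMap R B), ← map_sub]
    exact Ideal.Quotient.eq_zero_iff_mem.2 (Ideal.mem_span_singleton.2 hr)
  let g : Fin n → M →ₗ[R] B := fun i =>
    (LinearMap.proj i ∘ₗ (E.symm.toLinearMap)).restrictScalars R ∘ₗ ι
  choose l hl using fun i => Module.projective_lifting_property π (g i ∘ₗ β) hπ
  have hf : ∀ i x, π (l i (α x)) = g i x := by
    intro i x
    have := LinearMap.congr_fun (hl i) (α x)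
    simp only [LinearMap.comp_apply] at this
    rw [this, hαβ, map_smul, Algebra.smul_def]
    change π r * _ = _
    rw [hrB, one_mul]
  refine ⟨w, fun i => l i ∘ₗ α, ?_, ?_⟩
  · intro i j
    rw [← Ideal.mem_span_singleton, ← Ideal.Quotient.eq_zero_iff_mem, map_sub, sub_eq_zero]
    have := hf i (w j)
    have e : g i (w j) = if i = j then 1 else 0 := by
      simp only [g, LinearMap.comp_apply, LinearMap.restrictScalars_apply, hw]
      simp [Pi.single_apply]
    rw [e] at this
    change π (l i (α (w j))) = _
    rw [this]
    split_ifs <;> simp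
  · intro N hN hb
    rw [eq_top_iff]
    intro x _
    have key : ∃ c : Fin n → R, ι (∑ i, c i • w i) = ι x := by
      choose c hc using fun i : Fin n => hπ (E.symm (ι x) i)
      refine ⟨c, ?_⟩
      rw [map_sum]
      simp only [map_smul, hw]
      have : ∀ i, c i • E (Pi.single i 1) = E (π (c i) • Pi.single i (1 : B)) := by
        intro i
        rw [map_smul]
        exact (algebraMap_smul B (c i) _).symm
      simp only [this, hc]
      rw [← map_sum]
      rw [← E.eq_symm_apply]
      ext j
      simp [Finset.sum_apply, Pi.single_apply]
    obtain ⟨c, hc⟩ := key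
    have hm : x - ∑ i, c i • w i ∈ LinearMap.ker ι := by
      rw [LinearMap.mem_ker, map_sub, hc, sub_self]
    rw [hker, Submodule.ideal_span_singleton_smul] at hm
    obtain ⟨y, -, hy⟩ := (Submodule.mem_smul_pointwise_iff_exists _ _ _).1 hm
    have : x = b • y + ∑ i, c i • w i := by rw [hy]; abel
    rw [this]
    exact add_mem (hb y) (sum_mem fun i _ => N.smul_mem _ (hN i))

theorem freeMod_main (n : ℕ) (hdim : ringKrullDim R ≤ n)
    (hTF : ∀ (r : R) (x : M), r • x = 0 → r = 0 ∨ x = 0)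
    (hrk : Module.rank R M = n) (S : Finset (Ideal R))
    (hsplit : ∀ q : PrimeSpectrum R, q.asIdeal ∉ S → HasSplit n M q.asIdeal) (h : R)
    (hst : ∀ b r : R, IsCoprime b h → b ∣ r - 1 → Fac M r →
        ∃ u v : ℕ, Appr b (M × (Fin u → R)) (Fin v → R))
    (b : R) (hbh : IsCoprime b h) (hbS : ∀ q ∈ S, b ∉ q) (hb0 : b ≠ 0) : FreeMod n M b := by
  classical
  by_cases hbu : IsUnit b
  · refine ⟨0, 0, fun i j => hbu.dvd, fun N _ hN => ?_⟩
    rw [eq_top_iff]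
    intro x _
    obtain ⟨c, rfl⟩ := hbu
    have := hN ((↑c⁻¹ : R) • x)
    rwa [smul_smul, Units.mul_inv, one_smul] at this
  have htop : FacIdeal M ⊔ Ideal.span {b} = ⊤ := by
    apply eq_top_of_max
    intro q _ hq
    have hbq : b ∈ q.asIdeal := hq (Ideal.mem_sup_right (Ideal.mem_span_singleton_self b))
    obtain ⟨e, f, D, hD, hfe⟩ := hsplit q (fun hqS => hbS _ hqS hbq)
    have hD0 : D ≠ 0 := by rintro rfl; exact hD (zero_mem _)
    apply hD
    apply hq
    apply Ideal.mem_sup_left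
    refine ⟨Fin n → R, inferInstance, inferInstance, inferInstance, LinearMap.pi f,
      Fintype.linearCombination R e, fun x => ?_⟩
    rw [Fintype.linearCombination_apply]
    exact full_of_rank hTF n hrk e f D hD0 hfe x
  obtain ⟨r, hr, s, hs, hrs⟩ := Submodule.mem_sup.1 ((Ideal.eq_top_iff_one _).1 htop)
  have hr1 : b ∣ r - 1 := by
    rw [← hrs]
    have := Ideal.mem_span_singleton.1 hs
    simpa using this
  obtain ⟨u, v, hA⟩ := hst b r hbh hr1 hr
  obtain rfl := rank_appr hTF n u v hrk b hbu hA
  refine freeMod_of_equiv n b r hr1 hr ?_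
  refine bass n (fun q => ?_) u _ (free_quot n u b hA)
  rcases n with _ | n
  · exfalso
    apply hbu
    obtain ⟨p, hp, hle⟩ := Ideal.exists_le_maximal (Ideal.span {b})
      (by rw [Ne, Ideal.span_singleton_eq_top]; exact hbu)
    have hbp : b ∈ p := hle (Ideal.mem_span_singleton_self b)
    exfalso
    have hlt : (⟨⊥, Ideal.isPrime_bot⟩ : PrimeSpectrum R) < ⟨p, hp.isPrime⟩ :=
      lt_of_le_of_ne (bot_le (α := Ideal R)) (by
        intro he
        have : (⊥ : Ideal R) = p := congrArg PrimeSpectrum.asIdeal he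
        rw [← this] at hbp
        exact hb0 hbp)
    have h1 := (Order.coheight_add_one_le hlt).trans (coheight_le_of_dim hdim _)
    simp at h1
  · have := coheight_le_of_dim (dim_quot_lt hdim b (by
      intro q hq
      rw [IsDomain.minimalPrimes_eq_singleton_bot] at hq
      rw [Set.mem_singleton_iff.1 hq]
      exact hb0)) q
    refine this.trans_lt ?_
    exact_mod_cast Nat.lt_succ_self n

end fm

theorem main
    (k : Type) [Field k] [IsAlgClosed k] [CharZero k]
    (R : Type) [CommRing R] [IsDomain R] [Algebra k R] [Algebra.FiniteType k R]
    (M : Type) [AddCommGroup M] [Module R M] [Module.Finite R M]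
    (hrefl : Module.IsReflexive R M)
    (l : ℕ) (hpd : CategoryTheory.HasProjectiveDimensionLT (ModuleCat.of R M) (l + 1))
    (S : Finset (Ideal R)) (hS : ∀ m ∈ S, m.IsMaximal)
    (hloc : ∀ (p : Ideal R) [p.IsPrime], p ∉ S →
        Module.Free (Localization.AtPrime p) (LocalizedModule p.primeCompl M))
    (hne : S.Nonempty)
    (n : ℕ)
    (hrk : Module.rank R M = n)
    (hdim : ringKrullDim R ≤ n)
    (r : ℕ) (N : Type) [AddCommGroup N] [Module R N]
      (hE : Nonempty (((Fin r → R) × M) ≃ₗ[R] ((Fin r → R) × N))) : Nonempty (M ≃ₗ[R] N) := by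
  classical
  haveI : IsNoetherianRing R := Algebra.FiniteType.isNoetherianRing k R
  have hTF := tf_of_reflexive hrefl
  obtain ⟨h, h0, hhS, hst⟩ := stably S hS hne l M hpd
  have hsplit : ∀ q : PrimeSpectrum R, q.asIdeal ∉ S → HasSplit n M q.asIdeal :=
    fun q hq => hasSplit_of_free n hrk q.asIdeal (hloc _ hq)
  refine cancel_iter (A := R) (fun X _ _ => Module.Finite R X ∧ ∃ m : ℕ, ringKrullDim R ≤ m ∧
    (m = 0 → Subsingleton X) ∧
    (∀ q : PrimeSpectrum R, q.asIdeal ∉ S → HasSplit m X q.asIdeal) ∧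
    (∀ b : R, IsCoprime b h → (∀ q ∈ S, b ∉ q) → b ≠ 0 → FreeMod m X b)) ?_ ?_ ?_ r M N ?_ hE
  · rintro X _ _ ⟨h1, m, h2, h3, h4, h5⟩
    refine ⟨inferInstance, m + 1, h2.trans (by exact_mod_cast Nat.le_succ m), by simp,
      fun q hq => (h4 q hq).prod, fun b hb hb' hb'' => (h5 b hb hb' hb'').prod⟩
  · rintro X _ _ ⟨h1, _⟩
    exact h1
  · rintro X _ _ ⟨h1, m, h2, h3, h4, h5⟩ a x hu
    rcases m with _ | m
    · haveI := h3 rfl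
      exact ⟨0, fun y => ⟨0, Subsingleton.elim _ _⟩, rfl⟩
    · refine Zstep k m (sprop k m) R h2 X S hS h hhS h4 (fun q hq => ?_) (fun b hb hb' hb'' => ?_)
        a x hu
      · have hlt : (⟨⊥, Ideal.isPrime_bot⟩ : PrimeSpectrum R) < q :=
          lt_of_le_of_ne (bot_le (α := Ideal R)) (by
            rintro rfl
            exact h0 hq)
        have h1 := (Order.coheight_add_one_le hlt).trans (coheight_le_of_dim h2 _)
        exact (ENat.add_one_le_iff (ne_top_of_le_ne_top (by simp : ((m + 1 : ℕ) : ℕ∞) ≠ ⊤)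
          (coheight_le_of_dim h2 _))).1 h1
      · refine h5 b hb hb' ?_
        apply hb'' ⊥
        rw [IsDomain.minimalPrimes_eq_singleton_bot]
        rfl
  · refine ⟨inferInstance, n, hdim, ?_, hsplit, fun b hb hb' hb'' => freeMod_main n hdim hTF hrk S
      hsplit h hst b hb hb' hb''⟩
    rintro rfl
    refine subsingleton_of_forall_eq 0 fun x => ?_
    have := full_of_rank hTF 0 hrk (fun i => i.elim0) (fun i => i.elim0) 1 one_ne_zero
      (fun i => i.elim0) x
    simpa using this.symm

end RMC

/-- **Theorem (cancellation for reflexive modules).**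
Let `R` be an affine domain over an algebraically closed field `k` of characteristic zero,
`M` a finitely generated reflexive `R`-module of finite homological dimension which is
locally free outside a finite set of maximal ideals.  If `rank M ≥ dim R`, then `M` is
cancellative. -/
theorem reflexive_module_cancellation
    (k : Type) [Field k] [IsAlgClosed k] [CharZero k]
    (R : Type) [CommRing R] [IsDomain R] [Algebra k R] [Algebra.FiniteType k R]
    (M : Type) [AddCommGroup M] [Module R M] [Module.Finite R M]
    (hrefl : Module.IsReflexive R M)
    (hfd : FiniteProjectiveDimension R M)
    (hloc : ∃ S : Finset (Ideal R), (∀ m ∈ S, m.IsMaximal) ∧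
      ∀ (p : Ideal R) [p.IsPrime], p ∉ S →
        Module.Free (Localization.AtPrime p) (LocalizedModule p.primeCompl M))
    (n : ℕ)
    (hrank : Module.rank (FractionRing R) (FractionRing R ⊗[R] M) = n)
    (hdim : ringKrullDim R ≤ n) :
    ∀ (r : ℕ) (N : Type) (_ : AddCommGroup N) (_ : Module R N),
      Nonempty (((Fin r → R) × M) ≃ₗ[R] ((Fin r → R) × N)) → Nonempty (M ≃ₗ[R] N) := by
  classical
  intro r N _ _ hE
  obtain ⟨P, d, ε, l, hP, hs, h0, hex, hn⟩ := hfd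
  obtain ⟨S, hS, hfree⟩ := hloc
  have hpd := RMC.pd_of_res l P d M ε hP hs h0 hex hn
  have hpd' : CategoryTheory.HasProjectiveDimensionLT (ModuleCat.of R M) (l + 1) :=
    CategoryTheory.hasProjectiveDimensionLT_of_ge _ l (l + 1) (Nat.le_succ l)
  obtain ⟨m0, hm0⟩ := Ideal.exists_maximal R
  refine RMC.main k R M hrefl l hpd' (insert m0 S) ?_ ?_ (Finset.insert_nonempty _ _) n
    (RMC.rank_of_frac n hrank) hdim r N hE
  · intro m hm
    rcases Finset.mem_insert.1 hm with rfl | hm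
    · exact hm0
    · exact hS m hm
  · intro p _ hp
    exact hfree p (fun h => hp (Finset.mem_insert_of_mem h))
end

section
/- Let $A$ be an affine algebra of Krull dimension $n$ over an infinite field $k$, let $Q$ be a finitely generated projective $A$-module of constant rank, let $a \in A$, and let $I \subset A$ be an ideal of height $n$. Then there exist $x \in I$ and a nonzero scalar $\lambda \in k$ such that, setting $f = \lambda + a + x$, the localization $Q_f$ is a free $A_f$-module. -/
/-- The height of an ideal `I`: the infimum of the heights of the primes containing it. -/
noncomputable def idealHeight (A : Type) [CommRing A] (I : Ideal A) : ℕ∞ :=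
  ⨅ p : {p : PrimeSpectrum A // I ≤ p.asIdeal}, Order.height p.1

/-- A projective module has constant rank if its localization at every prime ideal is
free of the same rank. -/
def HasConstantRank (A : Type) [CommRing A] (Q : Type) [AddCommGroup Q] [Module A Q] : Prop :=
  ∃ r : ℕ, ∀ (p : Ideal A) [p.IsPrime],
    Module.Free (Localization.AtPrime p) (LocalizedModule p.primeCompl Q) ∧
    Module.rank (Localization.AtPrime p) (LocalizedModule p.primeCompl Q) = r

open TensorProduct in
theorem aux_free_main (A : Type) [CommRing A] [IsNoetherianRing A]
    (Q : Type) [AddCommGroup Q] [Module A Q] [Module.Finite A Q] [Module.Projective A Q]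
    (r : ℕ) (hr : ∀ p : PrimeSpectrum A, Module.rankAtStalk Q p = r)
    (I : Ideal A) [IsArtinianRing (A ⧸ I)] :
    ∃ g : A, g - 1 ∈ I ∧ ∀ c : A, Module.Free (Localization.Away (c * g))
        (LocalizedModule (Submonoid.powers (c * g)) Q) := by
  obtain ⟨b⟩ := Module.nonempty_basis_of_flat_of_finrank_eq (A ⧸ I) ((A ⧸ I) ⊗[A] Q) r (by
    intro P
    let := Ideal.Quotient.field P.1
    have h := congrFun (Module.rankAtStalk_eq_finrank_of_free (R := (A ⧸ I) ⧸ P.1)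
      (M := ((A ⧸ I) ⧸ P.1) ⊗[A ⧸ I] ((A ⧸ I) ⊗[A] Q))) ⊥
    rw [Module.rankAtStalk_baseChange, Module.rankAtStalk_baseChange, hr] at h
    simpa using h.symm)
  have hs : Function.Surjective (TensorProduct.mk A (A ⧸ I) Q 1) :=
    TensorProduct.mk_surjective _ _ _ Ideal.Quotient.mk_surjective
  choose q hq using fun i => hs (b i)
  let φ : (Fin r → A) →ₗ[A] Q := Fintype.linearCombination A q
  have hsup : (⊤ : Submodule A Q) ≤ LinearMap.range φ ⊔ I • ⊤ := by
    intro z _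
    choose c hc using fun i => Ideal.Quotient.mk_surjective (b.repr (1 ⊗ₜ z) i)
    have h0 : (1 : A ⧸ I) ⊗ₜ[A] (z - φ c) = 0 := by
      rw [TensorProduct.tmul_sub, sub_eq_zero]
      conv_lhs => rw [← b.sum_repr (1 ⊗ₜ z)]
      simp only [φ, Fintype.linearCombination_apply, TensorProduct.tmul_sum]
      refine Finset.sum_congr rfl fun i _ => ?_
      rw [← hc, TensorProduct.tmul_smul, ← hq]
      rfl
    have h1 : z - φ c ∈ I • (⊤ : Submodule A Q) := by
      have := congrArg (TensorProduct.quotTensorEquivQuotSMul Q I) h0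
      rw [map_zero] at this
      rw [← Submodule.Quotient.mk_eq_zero, ← this]
      simp
    have : z = φ c + (z - φ c) := by abel
    rw [this]
    exact Submodule.add_mem_sup ⟨c, rfl⟩ h1
  obtain ⟨g, hgI, hg⟩ := Submodule.exists_sub_one_mem_and_smul_le_of_fg_of_le_sup
    (I := I) (P := (⊤ : Submodule A Q)) (N' := ⊤) (N := LinearMap.range φ)
    (Module.Finite.fg_top) le_top hsup
  refine ⟨g, hgI, fun c => ?_⟩
  set f := c * g with hf
  let ψ := LocalizedModule.map (Submonoid.powers f) φ
  have hψ : Function.Surjective ψ := by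
    intro y
    induction y using LocalizedModule.induction_on with
    | h m s =>
      have : g • m ∈ LinearMap.range φ := hg (Submodule.smul_mem_pointwise_smul m g ⊤ trivial)
      obtain ⟨w, hw⟩ := this
      refine ⟨LocalizedModule.mk (c • w) (⟨f, Submonoid.mem_powers f⟩ * s), ?_⟩
      rw [LocalizedModule.map_mk, map_smul, hw, smul_smul, ← hf]
      exact LocalizedModule.mk_cancel_common_left ⟨f, Submonoid.mem_powers f⟩ s m
  have : Module.Free (Localization.Away f) (LocalizedModule (Submonoid.powers f) (Fin r → A)) :=
      Module.free_of_isLocalizedModule (Submonoid.powers f)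
        (LocalizedModule.mkLinearMap (Submonoid.powers f) (Fin r → A))
  have : Module.Projective (Localization.Away f) (LocalizedModule (Submonoid.powers f) Q) :=
      Module.projective_of_isLocalizedModule (Submonoid.powers f)
        (LocalizedModule.mkLinearMap (Submonoid.powers f) Q)
  refine Module.Free.of_equiv (LinearEquiv.ofBijective ψ
    (Module.bijective_of_surjective_of_rankAtStalk_eq hψ fun m _ => ?_))
  have hA : Nontrivial A := (PrimeSpectrum.comap (algebraMap A (Localization.Away f))
    ⟨m, inferInstance⟩).nontrivial
  rw [Module.rankAtStalk_isBaseChange (LocalizedModule.isBaseChange (Submonoid.powers f) _),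
    Module.rankAtStalk_isBaseChange (LocalizedModule.isBaseChange (Submonoid.powers f) _), hr,
    Module.rankAtStalk_eq_finrank_of_free]
  simp

/-- **Lemma 1.** Over an affine algebra `A` of dimension `n` over an infinite field `k`,
given a finitely generated projective module `Q` of constant rank, `a ∈ A` and an ideal
`I` of height `n`, there are `x ∈ I` and `0 ≠ λ ∈ k` such that `Q` becomes free after
inverting `f = λ + a + x`. -/
theorem free_after_localization
    (k : Type) [Field k] [Infinite k]
    (A : Type) [CommRing A] [Algebra k A] [Algebra.FiniteType k A]
    (n : ℕ) (hdim : ringKrullDim A = n)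
    (Q : Type) [AddCommGroup Q] [Module A Q] [Module.Finite A Q]
    (hproj : Module.Projective A Q) (hconst : HasConstantRank A Q)
    (a : A) (I : Ideal A) (hI : idealHeight A I = (n : ℕ∞)) :
    ∃ (x : A) (lam : k), x ∈ I ∧ lam ≠ 0 ∧
      Module.Free (Localization.Away (algebraMap k A lam + a + x))
        (LocalizedModule (Submonoid.powers (algebraMap k A lam + a + x)) Q) := by
  have : IsNoetherianRing A := Algebra.FiniteType.isNoetherianRing k A
  obtain ⟨r, hr⟩ := hconst
  have hmax : ∀ p : PrimeSpectrum A, I ≤ p.asIdeal → p.asIdeal.IsMaximal := by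
    intro p hp
    rw [← PrimeSpectrum.isMax_iff]
    have h1 : (n : ℕ∞) ≤ Order.height p := hI ▸ iInf_le (fun p : {p : PrimeSpectrum A // I ≤ p.asIdeal} => Order.height p.1) ⟨p, hp⟩
    intro q hpq
    by_contra hne
    have hlt : p < q := lt_of_le_not_ge hpq hne
    have h2 : Order.height p + 1 ≤ Order.height q := Order.height_add_one_le hlt
    have h3 : (Order.height q : WithBot ℕ∞) ≤ (n : ℕ∞) := by
      have := Order.height_le_krullDim q
      rw [ringKrullDim] at hdim
      rw [hdim] at this
      exact this
    have h4 : Order.height q ≤ (n : ℕ∞) := WithBot.coe_le_coe.mp h3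
    have h5 : (n : ℕ∞) + 1 ≤ n := (add_le_add_left h1 1).trans (h2.trans h4)
    exact absurd h5 (by norm_cast; omega)
  have : Ring.KrullDimLE 0 (A ⧸ I) := Ring.krullDimLE_zero_iff.mpr fun J hJ => by
    have := hmax (PrimeSpectrum.comap (Ideal.Quotient.mk I) ⟨J, hJ⟩) (by
      intro x hx
      simp [Ideal.Quotient.eq_zero_iff_mem.mpr hx])
    have hm : (J.comap (Ideal.Quotient.mk I)).IsMaximal := this
    have h2 := Ideal.map_eq_top_or_isMaximal_of_surjective (Ideal.Quotient.mk I)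
      Ideal.Quotient.mk_surjective hm
    rw [Ideal.map_comap_of_surjective _ Ideal.Quotient.mk_surjective] at h2
    exact h2.resolve_left hJ.ne_top
  have : IsArtinianRing (A ⧸ I) := IsNoetherianRing.isArtinianRing_of_krullDimLE_zero
  obtain ⟨g, hg, hfree⟩ := aux_free_main A Q r (fun p => by
    have := (hr p.asIdeal).2
    exact Module.finrank_eq_of_rank_eq this) I
  refine ⟨(1 + a) * (g - 1), 1, I.mul_mem_left _ hg, one_ne_zero, ?_⟩
  have e : algebraMap k A 1 + a + (1 + a) * (g - 1) = (1 + a) * g := by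
    rw [map_one]; ring
  rw [e]
  exact hfree _
end

section
/- Let $A$ be an affine algebra of Krull dimension $n$ over an infinite field $k$, let $Q$ be a finitely generated projective $A$-module of constant rank, let $a \in A$, and let $I \subset A$ be an ideal of height $n$. Then there exists $x \in I$ such that either $a + x$ is a unit in $A$, or the quotient $Q/(a+x)Q$ is a free module over $A/(a+x)A$. -/
open TensorProduct in
noncomputable def quotEquivAux {A : Type} [CommRing A] (Q : Type) [AddCommGroup Q] [Module A Q]
    (J : Ideal A) : ((A ⧸ J) ⊗[A] Q) ≃ₗ[A ⧸ J] (Q ⧸ (J • ⊤ : Submodule A Q)) :=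
  (quotTensorEquivQuotSMul Q J).extendScalarsOfSurjective Ideal.Quotient.mk_surjective

theorem quot_rank_aux {A : Type} [CommRing A] (Q : Type) [AddCommGroup Q] [Module A Q]
    [Module.Finite A Q] [Module.Flat A Q] (r : ℕ)
    (hr : ∀ p : PrimeSpectrum A, Module.rankAtStalk Q p = r) (J : Ideal A) :
    Module.Finite (A ⧸ J) (Q ⧸ (J • ⊤ : Submodule A Q)) ∧
    Module.Flat (A ⧸ J) (Q ⧸ (J • ⊤ : Submodule A Q)) ∧
    ∀ p : PrimeSpectrum (A ⧸ J), Module.rankAtStalk (Q ⧸ (J • ⊤ : Submodule A Q)) p = r := by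
  refine ⟨Module.Finite.equiv (quotEquivAux Q J), Module.Flat.of_linearEquiv (quotEquivAux Q J).symm,
    fun p => ?_⟩
  rw [← Module.rankAtStalk_eq_of_equiv (quotEquivAux Q J), Module.rankAtStalk_baseChange, hr]

theorem finrank_aux {R : Type} [CommRing R] (M : Type) [AddCommGroup M] [Module R M]
    [Module.Finite R M] [Module.Flat R M] (r : ℕ)
    (hr : ∀ p : PrimeSpectrum R, Module.rankAtStalk M p = r) (P : MaximalSpectrum R) :
    Module.finrank (R ⧸ P.1) (TensorProduct R (R ⧸ P.1) M) = r := by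
  have := P.2
  letI := Ideal.Quotient.field P.1
  have p : PrimeSpectrum (R ⧸ P.1) := ⟨⊥, Ideal.isPrime_bot⟩
  have h := Module.rankAtStalk_baseChange (R := R) (M := M) p
  rw [hr, Module.rankAtStalk_eq_finrank_of_free] at h
  exact h

theorem exists_lift_aux {A : Type} [CommRing A] (Q : Type) [AddCommGroup Q] [Module A Q]
    [Module.Finite A Q] [Module.Flat A Q] (r : ℕ)
    (hr : ∀ p : PrimeSpectrum A, Module.rankAtStalk Q p = r) (I : Ideal A)
    [Finite (MaximalSpectrum (A ⧸ I))] :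
    ∃ (q : Fin r → Q) (s : A), s - 1 ∈ I ∧
      ∀ y : Q, s • y ∈ Submodule.span A (Set.range q) := by
  obtain ⟨h1, h2, h3⟩ := quot_rank_aux Q r hr I
  obtain ⟨b⟩ := Module.nonempty_basis_of_flat_of_finrank_eq (A ⧸ I)
    (Q ⧸ (I • ⊤ : Submodule A Q)) r (finrank_aux _ r h3)
  choose q hq using fun i => Submodule.mkQ_surjective _ (b i)
  refine ⟨q, ?_⟩
  set N := Submodule.span A (Set.range q) with hN
  have hle : (⊤ : Submodule A Q) ≤ N ⊔ I • ⊤ := by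
    intro y _
    have hy := b.sum_repr (Submodule.mkQ _ y)
    choose c hc using fun i => Ideal.Quotient.mk_surjective (b.repr (Submodule.mkQ _ y) i)
    have : y - ∑ i, c i • q i ∈ (I • ⊤ : Submodule A Q) := by
      rw [← Submodule.Quotient.mk_eq_zero, ← Submodule.mkQ_apply, map_sub, map_sum, sub_eq_zero,
        ← hy]
      refine Finset.sum_congr rfl fun i _ => ?_
      rw [map_smul, hq, ← hc]
      rfl
    have h4 : ∑ i, c i • q i ∈ N :=
      Submodule.sum_mem _ fun i _ => N.smul_mem _ (Submodule.subset_span ⟨i, rfl⟩)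
    have := Submodule.add_mem_sup h4 this
    simpa using this
  have hle2 : (⊤ : Submodule A (Q ⧸ N)) ≤ I • ⊤ := by
    have := Submodule.map_mono (f := N.mkQ) hle
    simpa [Submodule.map_sup, Submodule.map_smul''] using this
  obtain ⟨s, hs, hs'⟩ := Submodule.exists_sub_one_mem_and_smul_eq_zero_of_fg_of_le_smul I _
    Module.Finite.fg_top hle2
  refine ⟨s, hs, fun y => ?_⟩
  have := hs' (N.mkQ y) trivial
  rwa [← map_smul, Submodule.mkQ_apply, Submodule.Quotient.mk_eq_zero] at this

theorem free_aux {A : Type} [CommRing A] (Q : Type) [AddCommGroup Q] [Module A Q]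
    [Module.Finite A Q] [Module.Flat A Q] (r : ℕ)
    (hr : ∀ p : PrimeSpectrum A, Module.rankAtStalk Q p = r) (J : Ideal A)
    (q : Fin r → Q) (s t : A) (hst : t * s - 1 ∈ J)
    (hs : ∀ y : Q, s • y ∈ Submodule.span A (Set.range q)) :
    Module.Free (A ⧸ J) (Q ⧸ (J • ⊤ : Submodule A Q)) := by
  obtain ⟨h1, h2, h3⟩ := quot_rank_aux Q r hr J
  let φ : (Fin r → A ⧸ J) →ₗ[A ⧸ J] (Q ⧸ (J • ⊤ : Submodule A Q)) :=
    Fintype.linearCombination (A ⧸ J) (fun i => Submodule.mkQ _ (q i))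
  have hφ : Function.Surjective φ := by
    intro z
    obtain ⟨y, rfl⟩ := Submodule.mkQ_surjective _ z
    obtain ⟨c, hc⟩ := (Submodule.mem_span_range_iff_exists_fun A).1 (hs y)
    refine ⟨fun i => Ideal.Quotient.mk J (t * c i), ?_⟩
    have e1 : φ (fun i => Ideal.Quotient.mk J (t * c i)) =
        Submodule.mkQ (J • ⊤ : Submodule A Q) ((t * s) • y) := by
      rw [mul_smul, ← hc, Fintype.linearCombination_apply, Finset.smul_sum, map_sum]
      refine Finset.sum_congr rfl fun i _ => ?_
      rw [smul_smul, map_smul]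
      rfl
    rw [e1, ← sub_eq_zero, ← map_sub, Submodule.mkQ_apply, Submodule.Quotient.mk_eq_zero]
    have := Submodule.smul_mem_smul hst (Submodule.mem_top (R := A) (x := y))
    rwa [sub_smul, one_smul] at this
  have hb : Function.Bijective φ := by
    refine Module.bijective_of_surjective_of_rankAtStalk_eq hφ fun m hm => ?_
    have : Nontrivial (A ⧸ J) := ⟨0, 1, fun h => hm.ne_top ((Ideal.eq_top_iff_one _).2
      (h ▸ m.zero_mem))⟩
    rw [h3, Module.rankAtStalk_eq_finrank_of_free]
    simp
  exact Module.Free.of_equiv (LinearEquiv.ofBijective φ hb)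

/-- **Corollary 1.** Over an affine algebra `A` of dimension `n` over an infinite field `k`,
given a finitely generated projective module `Q` of constant rank, `a ∈ A` and an ideal
`I` of height `n`, there is `x ∈ I` such that either `a + x` is a unit, or
`Q/(a+x)Q` is free over `A/(a+x)A`. -/
theorem free_quotient_or_unit
    (k : Type) [Field k] [Infinite k]
    (A : Type) [CommRing A] [Algebra k A] [Algebra.FiniteType k A]
    (n : ℕ) (hdim : ringKrullDim A = n)
    (Q : Type) [AddCommGroup Q] [Module A Q] [Module.Finite A Q]
    (hproj : Module.Projective A Q) (hconst : HasConstantRank A Q)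
    (a : A) (I : Ideal A) (hI : idealHeight A I = (n : ℕ∞)) :
    ∃ x ∈ I, IsUnit (a + x) ∨
      Module.Free (A ⧸ Ideal.span {a + x})
        (Q ⧸ (Ideal.span {a + x} • ⊤ : Submodule A Q)) := by
  obtain ⟨r, hr⟩ := hconst
  have hr' : ∀ p : PrimeSpectrum A, Module.rankAtStalk Q p = r := fun p => by
    rw [Module.rankAtStalk, Module.finrank, (hr p.asIdeal).2, Cardinal.toNat_natCast]
  have : IsNoetherianRing A := Algebra.FiniteType.isNoetherianRing k A
  have hdim0 : Ring.KrullDimLE 0 (A ⧸ I) := by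
    rw [Ideal.krullDimLE_zero_quotient_iff_forall_minimalPrimes_isMaximal]
    intro P hP
    have hPp : P.IsPrime := hP.1.1
    obtain ⟨m, hm, hPm⟩ := Ideal.exists_le_maximal P hPp.ne_top
    by_contra hne
    have hlt : (⟨P, hPp⟩ : PrimeSpectrum A) < ⟨m, hm.isPrime⟩ := by
      refine lt_of_le_of_ne hPm fun h => hne ?_
      have : P = m := congrArg PrimeSpectrum.asIdeal h
      rwa [this]
    have h1 : (n : ℕ∞) ≤ Order.height (⟨P, hPp⟩ : PrimeSpectrum A) := by
      rw [← hI]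
      exact iInf_le (fun p : {p : PrimeSpectrum A // I ≤ p.asIdeal} => Order.height p.1)
        ⟨⟨P, hPp⟩, hP.1.2⟩
    have h2 := Order.height_add_one_le hlt
    have h3 : Order.height (⟨m, hm.isPrime⟩ : PrimeSpectrum A) ≤ (n : ℕ∞) := by
      have := Order.height_le_krullDim (⟨m, hm.isPrime⟩ : PrimeSpectrum A)
      rw [← ringKrullDim, hdim] at this
      exact_mod_cast this
    have h4 : ((n + 1 : ℕ) : ℕ∞) ≤ n := by
      push_cast
      exact (add_le_add_left h1 1).trans (h2.trans h3)
    have : n + 1 ≤ n := by exact_mod_cast h4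
    omega
  have : IsArtinianRing (A ⧸ I) := isArtinianRing_iff_krullDimLE_zero.2 hdim0
  obtain ⟨q, s, hs, hq⟩ := exists_lift_aux Q r hr' I
  refine ⟨(a - 1) * (s - 1), I.mul_mem_left _ hs, Or.inr ?_⟩
  refine free_aux Q r hr' _ q s (1 - a) ?_ hq
  rw [Ideal.mem_span_singleton]
  exact ⟨-1, by ring⟩
end

section
/- Let $A$ be an integral domain, $M$ a finitely generated torsion-free $A$-module of rank $n$, $0 \neq a \in A$, and $m \in M$ such that $M/aM$ is a projective $A/aA$-module of rank $n$ and the image of $m$ in $M/aM$ is a unimodular element. Then the $A$-linear map $A \to A \oplus M$ sending $1 \mapsto (a, m)$ is a split injection. -/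
open TensorProduct

/-- `Q` is a projective `B`-module of rank `n`: it is projective and its localization at
every prime ideal is free of rank `n`. -/
def ProjectiveOfRank (B : Type) [CommRing B] (Q : Type) [AddCommGroup Q] [Module B Q]
    (n : ℕ) : Prop :=
  Module.Projective B Q ∧ ∀ (p : Ideal B) [p.IsPrime],
    Module.Free (Localization.AtPrime p) (LocalizedModule p.primeCompl Q) ∧
    Module.rank (Localization.AtPrime p) (LocalizedModule p.primeCompl Q) = n

lemma aux_notMem (B : Type) [CommRing B] (Q : Type) [AddCommGroup Q] [Module B Q]
    (p : Ideal B) (hp : p ≠ ⊤) (q : Q) (φ : Q →ₗ[B] B) (hφ : φ q = 1) :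
    q ∉ (p • ⊤ : Submodule B Q) := by
  intro hmem
  have key : (p • ⊤ : Submodule B Q) ≤ Submodule.comap φ p := by
    rw [Submodule.smul_le]
    intro r hr u _
    rw [Submodule.mem_comap, map_smul]
    exact Ideal.mul_mem_right _ _ hr
  have h1 : φ q ∈ p := key hmem
  rw [hφ] at h1
  exact hp ((Ideal.eq_top_iff_one _).2 h1)

lemma aux_basis (B : Type) [CommRing B] (Q : Type) [AddCommGroup Q] [Module B Q]
    [Module.Finite B Q] (n : ℕ) (h : ProjectiveOfRank B Q n) (p : Ideal B) [hp : p.IsMaximal]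
    (q : Q) (hq : q ∉ (p • ⊤ : Submodule B Q)) :
    ∃ (ι : Type) (_ : Fintype ι) (x : ι → Q) (i₀ : ι), Fintype.card ι = n ∧ x i₀ = q ∧
      ∀ z, ∃ c : ι → B, z - ∑ i, c i • x i ∈ (p • ⊤ : Submodule B Q) := by
  classical
  have hproj := h.1
  let : Field (B ⧸ p) := Ideal.Quotient.field p
  have hf : Module.finrank (B ⧸ p) ((B ⧸ p) ⊗[B] Q) = n := by
    have h1 := Module.rankAtStalk_baseChange (R := B) (M := Q) (S := B ⧸ p) ⊥
    rw [Module.rankAtStalk_eq_finrank_of_free] at h1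
    have h2 := (h.2 (PrimeSpectrum.comap (algebraMap B (B ⧸ p)) ⊥).asIdeal).2
    have h3 := Module.finrank_eq_of_rank_eq h2
    rw [Module.rankAtStalk, h3] at h1
    simpa using h1
  let e := (TensorProduct.quotTensorEquivQuotSMul Q p).extendScalarsOfSurjective
    (S := B ⧸ p) Ideal.Quotient.mk_surjective
  rw [e.finrank_eq] at hf
  let v : Q ⧸ (p • ⊤ : Submodule B Q) := Submodule.Quotient.mk q
  have hv : v ≠ 0 := by
    intro h0
    exact hq ((Submodule.Quotient.mk_eq_zero _).1 h0)
  have hli : LinearIndepOn (B ⧸ p) id ({v} : Set (Q ⧸ (p • ⊤ : Submodule B Q))) :=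
    LinearIndepOn.singleton (by simpa using hv)
  let b := Module.Basis.extend hli
  have : Module.Finite (B ⧸ p) (Q ⧸ (p • ⊤ : Submodule B Q)) := .of_restrictScalars_finite B _ _
  let := Module.Basis.fintypeIndexOfRankLtAleph0 b (Module.rank_lt_aleph0 _ _)
  let i₀ : hli.extend (Set.subset_univ _) := ⟨v, hli.subset_extend _ rfl⟩
  have hb0 : b i₀ = v := by simp [b, i₀]
  have hsur : ∀ i, ∃ x : Q, Submodule.Quotient.mk x = b i :=
    fun i => Submodule.Quotient.mk_surjective _ _
  choose x hx using hsur
  have key : ∀ i, (Submodule.Quotient.mk (Function.update x i₀ q i) :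
      Q ⧸ (p • ⊤ : Submodule B Q)) = b i := by
    intro i
    by_cases hi : i = i₀
    · subst hi; simp only [Function.update_self]; rw [hb0]
    · simp only [Function.update_of_ne hi, hx]
  refine ⟨_, inferInstance, Function.update x i₀ q, i₀, ?_, by simp, ?_⟩
  · rw [← hf, Module.finrank_eq_card_basis b]
  · intro z
    choose c hc using fun i => Ideal.Quotient.mk_surjective (I := p) (b.repr (Submodule.Quotient.mk z) i)
    refine ⟨c, ?_⟩
    rw [← Submodule.Quotient.mk_eq_zero, Submodule.Quotient.mk_sub, sub_eq_zero,
      ← Submodule.mkQ_apply, ← Submodule.mkQ_apply, map_sum]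
    simp only [map_smul, Submodule.mkQ_apply, key]
    conv_lhs => rw [← b.sum_repr (Submodule.Quotient.mk z)]
    refine Finset.sum_congr rfl fun i _ => ?_
    rw [← hc i]
    exact algebraMap_smul (B ⧸ p) (c i) (b i)

lemma aux_functional (A : Type) [CommRing A] [IsDomain A]
    (M : Type) [AddCommGroup M] [Module A M] [Module.Finite A M]
    (n : ℕ) (hrank : Module.rank (FractionRing A) (FractionRing A ⊗[A] M) = n)
    (P : Ideal A) (hP : P ≠ ⊤) (ι : Type) [Fintype ι] (hι : Fintype.card ι = n)
    (y : ι → M) (i₀ : ι)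
    (hy : ∀ z, ∃ c : ι → A, z - ∑ i, c i • y i ∈ (P • ⊤ : Submodule A M)) :
    ∃ f : M →ₗ[A] A, f (y i₀) ∉ P := by
  classical
  obtain ⟨s, hs1, hs⟩ := Submodule.exists_sub_one_mem_and_smul_le_of_fg_of_le_sup
    (I := P) (N := Submodule.span A (Set.range y)) (N' := ⊤) (P := ⊤)
    Module.Finite.fg_top le_rfl (by
      intro z _
      obtain ⟨c, hc⟩ := hy z
      refine Submodule.mem_sup.2 ⟨∑ i, c i • y i, ?_, _, hc, by simp⟩
      exact Submodule.sum_mem _ fun i _ => Submodule.smul_mem _ _ (Submodule.subset_span ⟨i, rfl⟩))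
  have hsP : s ∉ P := fun h => hP ((Ideal.eq_top_iff_one _).2 (by
    have := P.sub_mem h hs1; simpa using this))
  have hs0 : s ≠ 0 := fun h => hsP (h ▸ P.zero_mem)
  have hsM : ∀ z : M, s • z ∈ Submodule.span A (Set.range y) := fun z =>
    hs (Submodule.smul_mem_pointwise_smul _ _ _ trivial)
  let K := FractionRing A
  let j : M →ₗ[A] K ⊗[A] M := TensorProduct.mk A K M 1
  have hliK : LinearIndependent K (fun i => j (y i)) := by
    refine linearIndependent_of_top_le_span_of_card_eq_finrank ?_ ?_
    · have hj : ∀ z, z ∈ Submodule.span A (Set.range y) →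
          j z ∈ Submodule.span K (Set.range fun i => j (y i)) := by
        intro z hz
        induction hz using Submodule.span_induction with
        | mem z h => obtain ⟨i, rfl⟩ := h; exact Submodule.subset_span ⟨i, rfl⟩
        | zero => simp
        | add a b _ _ h1 h2 => rw [map_add]; exact add_mem h1 h2
        | smul a b _ h => rw [map_smul]; exact Submodule.smul_of_tower_mem _ a h
      intro t _
      induction t using TensorProduct.induction_on with
      | zero => exact zero_mem _
      | add a b h1 h2 => exact add_mem (h1 trivial) (h2 trivial)
      | tmul k z =>
        have h1 := hj _ (hsM z)
        have h2 := Submodule.smul_mem _ (k * (algebraMap A K s)⁻¹) h1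
        have hs' : algebraMap A K s ≠ 0 := by
          simpa using hs0
        convert h2 using 1
        rw [map_smul, ← algebraMap_smul K s (j z), smul_smul, mul_assoc, inv_mul_cancel₀ hs',
          mul_one]
        simp [j, TensorProduct.smul_tmul']
    · rw [hι]; exact (Module.finrank_eq_of_rank_eq hrank).symm
  have hli : LinearIndependent A y := by
    have h1 : LinearIndependent A (fun i => j (y i)) :=
      hliK.restrict_scalars' A
    exact LinearIndependent.of_comp j h1
  let b := Module.Basis.span hli
  refine ⟨(b.coord i₀).comp ((LinearMap.lsmul A M s).codRestrict _ hsM), ?_⟩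
  have : (LinearMap.lsmul A M s).codRestrict _ hsM (y i₀) = s • b i₀ := by
    ext; simp [b, Module.Basis.span_apply]; rfl
  rw [LinearMap.comp_apply, this]
  simpa using hsP

/-- If `M` is a finitely generated torsion-free module of rank `n` over a domain `A`,
`0 ≠ a ∈ A`, `M/aM` is projective of rank `n` over `A/aA` and the image of `m` in `M/aM`
is unimodular, then `1 ↦ (a, m)` is a split injection `A → A ⊕ M`. -/
theorem split_injection_of_unimodular
    (A : Type) [CommRing A] [IsDomain A]
    (M : Type) [AddCommGroup M] [Module A M] [Module.Finite A M] [NoZeroSMulDivisors A M]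
    (n : ℕ)
    (hrank : Module.rank (FractionRing A) (FractionRing A ⊗[A] M) = n)
    (a : A) (ha : a ≠ 0) (m : M)
    (hproj : ProjectiveOfRank (A ⧸ Ideal.span {a})
      (M ⧸ (Ideal.span {a} • ⊤ : Submodule A M)) n)
    (hunim : ∃ φ : (M ⧸ (Ideal.span {a} • ⊤ : Submodule A M)) →ₗ[A ⧸ Ideal.span {a}]
        (A ⧸ Ideal.span {a}),
      φ (Submodule.Quotient.mk m) = 1) :
    Function.Injective (LinearMap.toSpanSingleton A (A × M) (a, m)) ∧
      ∃ g : (A × M) →ₗ[A] A,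
        g.comp (LinearMap.toSpanSingleton A (A × M) (a, m)) = LinearMap.id := by
  classical
  have hfin : Module.Finite (A ⧸ Ideal.span {a}) (M ⧸ (Ideal.span {a} • ⊤ : Submodule A M)) :=
    .of_restrictScalars_finite A _ _
  obtain ⟨φ, hφ⟩ := hunim
  have hex : ∃ f : M →ₗ[A] A, Ideal.Quotient.mk (Ideal.span {a}) (f m) = 1 := by
    let I : Ideal A := LinearMap.range (LinearMap.applyₗ (R := A) (M₂ := A) m)
    have hJ : I.map (Ideal.Quotient.mk (Ideal.span {a})) = ⊤ := by
      by_contra hne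
      obtain ⟨p, hp, hle⟩ := Ideal.exists_le_maximal _ hne
      have hq : (Submodule.Quotient.mk m : M ⧸ (Ideal.span {a} • ⊤ : Submodule A M)) ∉
          (p • ⊤ : Submodule (A ⧸ Ideal.span {a}) (M ⧸ (Ideal.span {a} • ⊤ : Submodule A M))) := by
        exact aux_notMem _ _ p hp.ne_top _ φ hφ
      obtain ⟨ι, _, x, i₀, hc, hx0, hx⟩ := aux_basis _ _ n hproj p _ hq
      choose y' hy' using fun i => Submodule.Quotient.mk_surjective _ (x i)
      let y := Function.update y' i₀ m
      have hy : ∀ i, Submodule.Quotient.mk (y i) = x i := by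
        intro i
        by_cases hi : i = i₀
        · subst hi; simp only [y, Function.update_self]; rw [hx0]
        · simp only [y, Function.update_of_ne hi, hy']
      let P : Ideal A := p.comap (Ideal.Quotient.mk (Ideal.span {a}))
      have hP : P ≠ ⊤ := Ideal.comap_ne_top _ hp.ne_top
      have haP : Ideal.span {a} ≤ P := by
        intro r hr
        change Ideal.Quotient.mk _ r ∈ p
        rw [Ideal.Quotient.eq_zero_iff_mem.2 hr]
        exact p.zero_mem
      have hlift : ∀ w ∈ (p • ⊤ : Submodule (A ⧸ Ideal.span {a})
          (M ⧸ (Ideal.span {a} • ⊤ : Submodule A M))), ∃ z ∈ (P • ⊤ : Submodule A M),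
          Submodule.Quotient.mk z = w := by
        intro w hw
        induction hw using Submodule.smul_induction_on' with
        | smul r hr u _ =>
          obtain ⟨r, rfl⟩ := Ideal.Quotient.mk_surjective r
          obtain ⟨u, rfl⟩ := Submodule.Quotient.mk_surjective _ u
          exact ⟨r • u, Submodule.smul_mem_smul hr trivial, rfl⟩
        | add u _ v _ h1 h2 =>
          obtain ⟨z1, h1, rfl⟩ := h1
          obtain ⟨z2, h2, rfl⟩ := h2
          exact ⟨z1 + z2, add_mem h1 h2, rfl⟩
      obtain ⟨f, hf⟩ := aux_functional A M n hrank P hP ι hc y i₀ (by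
        intro z
        obtain ⟨c, hc⟩ := hx (Submodule.Quotient.mk z)
        choose c' hc' using fun i => Ideal.Quotient.mk_surjective (c i)
        refine ⟨c', ?_⟩
        obtain ⟨w, hw, hw'⟩ := hlift _ hc
        have h3 : (Submodule.Quotient.mk (z - ∑ i, c' i • y i) :
            M ⧸ (Ideal.span {a} • ⊤ : Submodule A M)) = Submodule.Quotient.mk w := by
          rw [hw', Submodule.Quotient.mk_sub]
          congr 1
          rw [← Submodule.mkQ_apply, map_sum]
          refine Finset.sum_congr rfl fun i _ => ?_
          rw [← hc' i, ← hy i]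
          rfl
        rw [Submodule.Quotient.eq] at h3
        have h4 := Submodule.smul_mono_left (N := (⊤ : Submodule A M)) haP h3
        simpa using add_mem h4 hw)
      apply hf
      have : y i₀ = m := by simp [y]
      rw [this]
      exact hle (Ideal.mem_map_of_mem _ ⟨f, rfl⟩)
    have h1 : (1 : A ⧸ Ideal.span {a}) ∈ I.map (Ideal.Quotient.mk (Ideal.span {a})) := by
      rw [hJ]; trivial
    obtain ⟨_, ⟨f, rfl⟩, hf⟩ :=
      (Ideal.mem_map_iff_of_surjective _ Ideal.Quotient.mk_surjective).1 h1
    exact ⟨f, hf⟩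
  obtain ⟨f, hf⟩ := hex
  rw [← map_one (Ideal.Quotient.mk (Ideal.span {a})), Ideal.Quotient.eq,
    Ideal.mem_span_singleton'] at hf
  obtain ⟨c, hc⟩ := hf
  have hg : ((LinearMap.toSpanSingleton A A (-c)).coprod f).comp
      (LinearMap.toSpanSingleton A (A × M) (a, m)) = LinearMap.id := by
    ext
    simp
    linear_combination -hc
  refine ⟨?_, _, hg⟩
  intro u v huv
  have := congrArg ((LinearMap.toSpanSingleton A A (-c)).coprod f) huv
  rwa [← LinearMap.comp_apply, ← LinearMap.comp_apply, hg] at this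
end

section
/- Let $A$ be an integral domain, $M$ a finitely generated torsion-free $A$-module of rank $n$, $0 \neq a \in A$, and $m \in M$ such that $M/aM$ is a projective $A/aA$-module of rank $n$ and the image of $m$ in $M/aM$ is a unimodular element. Then for every $m' \in M$ and every positive integer $d$, there is an $A$-module isomorphism $(A \oplus M)/A\cdot(a^d, m) \cong (A \oplus M)/A\cdot(a^d, m + am')$, where $A\cdot(a^d,m)$ denotes the cyclic submodule of $A \oplus M$ generated by $(a^d, m)$. -/
open TensorProduct

section Moves
variable {A M : Type} [CommRing A] [AddCommGroup M] [Module A M]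

/-- Two vectors are in the same orbit of the automorphism group. -/
def SameOrb (x : A) (m₁ m₂ : M) : Prop :=
  ∃ e : (A × M) ≃ₗ[A] (A × M), e (x, m₁) = (x, m₂)

theorem SameOrb.symm {x : A} {m₁ m₂ : M} (h : SameOrb x m₁ m₂) : SameOrb x m₂ m₁ := by
  obtain ⟨e, he⟩ := h
  exact ⟨e.symm, by rw [← he, e.symm_apply_apply]⟩

theorem SameOrb.trans {x : A} {m₁ m₂ m₃ : M} (h : SameOrb x m₁ m₂) (h' : SameOrb x m₂ m₃) :
    SameOrb x m₁ m₃ := by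
  obtain ⟨e, he⟩ := h
  obtain ⟨e', he'⟩ := h'
  exact ⟨e.trans e', by rw [LinearEquiv.trans_apply, he, he']⟩

/-- block endomorphisms of `A × M` -/
def blk (α : A) (ξ : M →ₗ[A] A) (w : M) (ψ : M →ₗ[A] A) (y : M) : (A × M) →ₗ[A] (A × M) where
  toFun z := (α * z.1 + ξ z.2, z.1 • w + z.2 + ψ z.2 • y)
  map_add' z z' := by
    ext
    · simp; ring
    · simp; module
  map_smul' c z := by
    ext
    · simp; ring
    · simp [mul_smul]

theorem move1 (x : A) (m w : M) : SameOrb x m (m + x • w) := by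
  refine ⟨LinearEquiv.ofLinearMap (blk 1 0 w 0 0) (blk 1 0 (-w) 0 0) ?_ ?_, ?_⟩
  · apply LinearMap.ext; rintro ⟨z, y⟩; simp [blk]
  · apply LinearMap.ext; rintro ⟨z, y⟩; simp [blk]
  · simp [blk, add_comm]

theorem move2 (x : A) (m y : M) (ψ : M →ₗ[A] A) (hy : ψ y = 0) :
    SameOrb x m (m + ψ m • y) := by
  refine ⟨LinearEquiv.ofLinearMap (blk 1 0 0 ψ y) (blk 1 0 0 ψ (-y)) ?_ ?_, ?_⟩
  · apply LinearMap.ext; rintro ⟨z, y⟩; simp [blk, hy]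
  · apply LinearMap.ext; rintro ⟨z, y⟩; simp [blk, hy]
  · simp [blk]

theorem move3 (x f : A) (m : M) (ψ : M →ₗ[A] A) (hf : IsCoprime f x) (hu : IsCoprime (ψ m) x) :
    SameOrb x m (f • m) := by
  obtain ⟨p, q, hpq⟩ := hu.mul_left hf
  obtain ⟨s, r, h⟩ : ∃ s r, f - 1 = r * x + s * ψ m * f :=
    ⟨(f - 1) * p, (f - 1) * q, by linear_combination (1 - f) * hpq⟩
  set u := ψ m with hu
  refine ⟨LinearEquiv.ofLinearMap (blk (1 - s * u) ((x * s) • ψ) (r • m) ψ ((s * f) • m))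
    (blk (1 + s * f * u) (-((x * s) • ψ)) (-(r • m)) ψ (-(s • m))) ?_ ?_, ?_⟩
  · apply LinearMap.ext; rintro ⟨z, y⟩
    ext
    · simp [blk, ← hu]
      linear_combination (s * u * z) * h
    · simp [blk, ← hu]
      linear_combination (norm := module) (s * ψ y) • congrArg (· • m) h
  · apply LinearMap.ext; rintro ⟨z, y⟩
    ext
    · simp [blk, ← hu]
      linear_combination (s * u * z) * h
    · simp [blk, ← hu]
      linear_combination (norm := module) (s * ψ y) • congrArg (· • m) h
  · ext
    · simp [blk, ← hu]; ring
    · simp [blk, ← hu]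
      linear_combination (norm := module) (-1 : A) • congrArg (· • m) h

theorem orb_of_coprime (x : A) (m m₂ : M) (ψ : M →ₗ[A] A) (h : IsCoprime (ψ m) x)
    (h₂ : IsCoprime (ψ m₂) x) : SameOrb x m m₂ := by
  have h1 : SameOrb x m (ψ m₂ • m) := move3 x _ m ψ h₂ h
  have h4 : SameOrb x m₂ (ψ m • m₂) := move3 x _ m₂ ψ h h₂
  obtain ⟨q, r, hqr⟩ := h.mul_left h₂
  set y := ψ m • m₂ - ψ m₂ • m with hy
  have hy0 : ψ y = 0 := by simp [hy]; ring
  have h2 : SameOrb x (ψ m₂ • m) (ψ m₂ • m + ψ (ψ m₂ • m) • (q • y)) :=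
    move2 x _ _ ψ (by simp [hy0])
  have h3 := move1 x (ψ m₂ • m + ψ (ψ m₂ • m) • (q • y)) (r • y)
  have e : ψ m₂ • m + ψ (ψ m₂ • m) • (q • y) + x • r • y = ψ m • m₂ := by
    have : (ψ m₂ * ψ m * q + x * r) • y = y := by
      rw [show ψ m₂ * ψ m * q + x * r = 1 by linear_combination hqr, one_smul]
    rw [map_smul, smul_eq_mul, add_assoc, smul_smul, smul_smul, ← add_smul, this, hy]
    abel
  rw [e] at h3
  exact h1.trans (h2.trans (h3.trans h4.symm))

theorem SameOrb.quot {x : A} {m₁ m₂ : M} (h : SameOrb x m₁ m₂) :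
    Nonempty (((A × M) ⧸ Submodule.span A {((x, m₁) : A × M)}) ≃ₗ[A]
      ((A × M) ⧸ Submodule.span A {((x, m₂) : A × M)})) := by
  obtain ⟨e, he⟩ := h
  refine ⟨Submodule.Quotient.equiv _ _ e ?_⟩
  rw [Submodule.map_span, Set.image_singleton]
  simp [he]

end Moves

section Functional

variable {A M : Type} [CommRing A] [IsDomain A] [AddCommGroup M] [Module A M]

theorem exists_gens [Module.Finite A M] (n : ℕ) (a : A)
    (hproj : ProjectiveOfRank (A ⧸ Ideal.span {a})
      (M ⧸ (Ideal.span {a} • ⊤ : Submodule A M)) n) (p : Ideal A) [hp : p.IsPrime] (hap : a ∈ p) :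
    ∃ v : Fin n → M, ∀ y : M, ∃ s ∉ p, ∃ w ∈ Submodule.span A (Set.range v), ∃ z : M,
      s • y = w + a • z := by
  set I := Ideal.span {a} with hI
  have hIp : I ≤ p := by rw [hI, Ideal.span_singleton_le_iff_mem]; exact hap
  set P : Ideal (A ⧸ I) := p.map (Ideal.Quotient.mk I) with hP
  haveI : P.IsPrime := Ideal.map_isPrime_of_surjective Ideal.Quotient.mk_surjective (by simpa using hIp)
  have hPp : ∀ r : A, Ideal.Quotient.mk I r ∈ P ↔ r ∈ p := fun r => Ideal.mem_quotient_iff_mem hIp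
  obtain ⟨hfree, hrk⟩ := hproj.2 P
  let Q := (M ⧸ (I • ⊤ : Submodule A M))
  let f := LocalizedModule.mkLinearMap P.primeCompl Q
  have b0 := Module.Free.chooseBasis (Localization.AtPrime P) (LocalizedModule P.primeCompl Q)
  have hc : Cardinal.mk (Module.Free.ChooseBasisIndex (Localization.AtPrime P) (LocalizedModule P.primeCompl Q)) = n := by
    rw [← hrk]; exact b0.mk_eq_rank''
  obtain ⟨eqv⟩ := Cardinal.eq.1 (hc.trans (Cardinal.mk_fin n).symm)
  let e := b0.reindex eqv
  obtain ⟨s0, hs0⟩ := IsLocalizedModule.exist_integer_multiples_of_finite P.primeCompl f e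
  choose q hq using hs0
  choose v hv using fun i => Submodule.Quotient.mk_surjective _ (q i)
  refine ⟨v, fun y => ?_⟩
  obtain ⟨t, ht⟩ := IsLocalization.exist_integer_multiples_of_finite P.primeCompl
    (fun i => e.repr (f (Submodule.Quotient.mk y)) i)
  choose c hc' using ht
  choose c' hcc using fun i => Ideal.Quotient.mk_surjective (c i)
  have key : f ((s0 * t : P.primeCompl) • (Submodule.Quotient.mk y : Q)) = f (∑ i, c i • q i) := by
    rw [map_sum, mul_smul]
    simp only [map_smul, Submonoid.smul_def]
    conv_lhs => rw [← e.sum_repr (f (Submodule.Quotient.mk y))]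
    rw [Finset.smul_sum, Finset.smul_sum]
    refine Finset.sum_congr rfl fun i _ => ?_
    rw [hq i, ← smul_assoc t.1, ← hc' i, algebraMap_smul, smul_comm]
  obtain ⟨r, hr⟩ := (IsLocalizedModule.eq_iff_exists P.primeCompl f).1 key
  obtain ⟨s', hs'⟩ := Ideal.Quotient.mk_surjective (r * (s0 * t) : P.primeCompl).1
  obtain ⟨r', hr'⟩ := Ideal.Quotient.mk_surjective r.1
  refine ⟨s', ?_, r' • ∑ i, c' i • v i, ?_, ?_⟩
  · rw [← hPp, hs']; exact (r * (s0 * t)).2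
  · exact Submodule.smul_mem _ _ (Submodule.sum_mem _ fun i _ => Submodule.smul_mem _ _ (Submodule.subset_span ⟨i, rfl⟩))
  have h2 : (Submodule.Quotient.mk (s' • y) : Q) = Submodule.Quotient.mk (r' • ∑ i, c' i • v i) := by
    have e1 : (Submodule.Quotient.mk (s' • y) : Q) = Ideal.Quotient.mk I s' • (Submodule.Quotient.mk y : Q) := rfl
    have e2 : (Submodule.Quotient.mk (r' • ∑ i, c' i • v i) : Q) =
        Ideal.Quotient.mk I r' • (Submodule.Quotient.mk (∑ i, c' i • v i) : Q) := rfl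
    have e3 : (Submodule.Quotient.mk (∑ i, c' i • v i) : Q) = ∑ i, c i • q i := by
      refine (map_sum (Submodule.mkQ _) _ _).trans (Finset.sum_congr rfl fun i _ => ?_)
      rw [← hcc i, ← hv i]
      rfl
    rw [e1, e2, e3, hs', hr']
    rw [← Submonoid.smul_def, ← Submonoid.smul_def, mul_smul]
    exact hr
  rw [Submodule.Quotient.eq, hI, Submodule.ideal_span_singleton_smul, Submodule.mem_smul_pointwise_iff_exists] at h2
  obtain ⟨z, -, hz⟩ := h2
  exact ⟨z, by rw [hz]; abel⟩

theorem exists_kill [Module.Finite A M] (a : A) (p : Ideal A) [hp : p.IsPrime] (hap : a ∈ p)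
    (N : Submodule A M) (h : ∀ y : M, ∃ s ∉ p, ∃ w ∈ N, ∃ z : M, s • y = w + a • z) :
    ∃ s ∉ p, ∀ y : M, s • y ∈ N := by
  have h1 : (⟨p, hp⟩ : PrimeSpectrum A) ∉ Module.support A (M ⧸ N) := by
    intro hmem
    have h2 : (⟨p, hp⟩ : PrimeSpectrum A) ∈
        Module.support A ((M ⧸ N) ⧸ (Ideal.span {a} • ⊤ : Submodule A (M ⧸ N))) := by
      rw [Module.support_quotient]
      refine ⟨hmem, ?_⟩
      simpa [PrimeSpectrum.mem_zeroLocus] using hap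
    rw [Module.mem_support_iff'] at h2
    obtain ⟨y, hy⟩ := h2
    obtain ⟨y, rfl⟩ := Submodule.Quotient.mk_surjective _ y
    obtain ⟨y, rfl⟩ := Submodule.Quotient.mk_surjective _ y
    obtain ⟨s, hs, w, hw, z, e⟩ := h y
    apply hy s hs
    rw [← Submodule.Quotient.mk_smul, ← Submodule.Quotient.mk_smul, e, Submodule.Quotient.mk_eq_zero,
      Submodule.Quotient.mk_add, (Submodule.Quotient.mk_eq_zero N).2 hw, zero_add,
      Submodule.Quotient.mk_smul]
    exact Submodule.smul_mem_smul (Ideal.mem_span_singleton_self a) trivial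
  rw [Module.mem_support_iff_of_finite, SetLike.not_le_iff_exists] at h1
  obtain ⟨s, hs, hsp⟩ := h1
  refine ⟨s, hsp, fun y => ?_⟩
  rw [← Submodule.Quotient.mk_eq_zero, Submodule.Quotient.mk_smul]
  exact Module.mem_annihilator.1 hs _

theorem linInd (n : ℕ)
    (hrank : Module.rank (FractionRing A) (FractionRing A ⊗[A] M) = n)
    (v : Fin n → M) (s : A) (hs : s ≠ 0) (h : ∀ y : M, s • y ∈ Submodule.span A (Set.range v)) :
    LinearIndependent A v := by
  have hfr : Module.finrank (FractionRing A) (FractionRing A ⊗[A] M) = n :=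
    Module.finrank_eq_of_rank_eq hrank
  let g : M →ₗ[A] FractionRing A ⊗[A] M := TensorProduct.mk A (FractionRing A) M 1
  have hsp : ⊤ ≤ Submodule.span (FractionRing A) (Set.range (g ∘ v)) := by
    have hg : ∀ w ∈ Submodule.span A (Set.range v),
        g w ∈ Submodule.span (FractionRing A) (Set.range (g ∘ v)) := by
      intro w hw
      induction hw using Submodule.span_induction with
      | mem x hx => obtain ⟨i, rfl⟩ := hx; exact Submodule.subset_span ⟨i, rfl⟩
      | zero => simp
      | add x y _ _ hx hy => rw [map_add]; exact Submodule.add_mem _ hx hy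
      | smul c x _ hx =>
        rw [map_smul, ← algebraMap_smul (FractionRing A) c]; exact Submodule.smul_mem _ _ hx
    rintro x -
    induction x using TensorProduct.induction_on with
    | zero => simp
    | add x y hx hy => exact Submodule.add_mem _ hx hy
    | tmul k y =>
      have hs' : algebraMap A (FractionRing A) s ≠ 0 := by simpa using hs
      have := Submodule.smul_mem _ (k * (algebraMap A (FractionRing A) s)⁻¹) (hg _ (h y))
      convert this using 1
      rw [map_smul, ← algebraMap_smul (FractionRing A) s, smul_smul, mul_assoc,
        inv_mul_cancel₀ hs', mul_one]
      simp [g, TensorProduct.smul_tmul']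
  have := linearIndependent_of_top_le_span_of_card_eq_finrank hsp (by simp [hfr])
  have h2 : LinearIndependent A (g ∘ v) := this.restrict_scalars' A
  exact LinearIndependent.of_comp g h2

theorem exists_functional [Module.Finite A M] (n : ℕ)
    (hrank : Module.rank (FractionRing A) (FractionRing A ⊗[A] M) = n)
    (a : A) (m : M)
    (hproj : ProjectiveOfRank (A ⧸ Ideal.span {a})
      (M ⧸ (Ideal.span {a} • ⊤ : Submodule A M)) n)
    (hunim : ∃ φ : (M ⧸ (Ideal.span {a} • ⊤ : Submodule A M)) →ₗ[A ⧸ Ideal.span {a}]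
        (A ⧸ Ideal.span {a}),
      φ (Submodule.Quotient.mk m) = 1) :
    ∃ ψ : M →ₗ[A] A, IsCoprime (ψ m) a := by
  by_contra hcon
  let J : Ideal A := LinearMap.range (LinearMap.applyₗ m : (M →ₗ[A] A) →ₗ[A] A) ⊔ Ideal.span {a}
  have hJ : J ≠ ⊤ := by
    intro hJ
    have : (1 : A) ∈ J := hJ ▸ trivial
    obtain ⟨y, ⟨ψ, rfl⟩, z, hz, e⟩ := Submodule.mem_sup.1 this
    obtain ⟨c, rfl⟩ := Ideal.mem_span_singleton'.1 hz
    exact hcon ⟨ψ, 1, c, by simpa using e⟩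
  obtain ⟨p, hp, hJp⟩ := Ideal.exists_le_maximal J hJ
  haveI := hp.isPrime
  have hap : a ∈ p := hJp (Submodule.mem_sup_right (Ideal.mem_span_singleton_self a))
  have hψ : ∀ ψ : M →ₗ[A] A, ψ m ∈ p := fun ψ => hJp (Submodule.mem_sup_left ⟨ψ, rfl⟩)
  obtain ⟨v, hv⟩ := exists_gens n a hproj p hap
  obtain ⟨s, hs, hsv⟩ := exists_kill a p hap _ hv
  have hli := linInd n hrank v s (by rintro rfl; exact hs p.zero_mem) hsv
  let b := Module.Basis.span hli
  let g : M →ₗ[A] Submodule.span A (Set.range v) := (LinearMap.lsmul A M s).codRestrict _ hsv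
  obtain ⟨φ, hφ⟩ := hunim
  have h1 : s • m = ∑ i, b.coord i (g m) • v i := by
    have := congrArg Subtype.val (b.sum_repr (g m))
    have e0 : ((g m : Submodule.span A (Set.range v)) : M) = s • m := rfl
    rw [e0] at this
    simpa [b, Module.Basis.span_apply] using this.symm
  have h2 : ∀ (c : A) (y : M), φ (Submodule.Quotient.mk (c • y)) = Ideal.Quotient.mk _ c * φ (Submodule.Quotient.mk y) := by
    intro c y
    exact map_smul φ (Ideal.Quotient.mk _ c) (Submodule.Quotient.mk y)
  have h3 : Ideal.Quotient.mk (Ideal.span {a}) s = ∑ i, Ideal.Quotient.mk (Ideal.span {a}) (b.coord i (g m)) * φ (Submodule.Quotient.mk (v i)) := by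
    rw [← mul_one (Ideal.Quotient.mk _ s), ← hφ, ← h2, h1]
    simp_rw [← h2]
    rw [← map_sum]
    congr 1
    exact map_sum (Submodule.mkQ _) _ _
  have hIp : Ideal.span {a} ≤ p := by rw [Ideal.span_singleton_le_iff_mem]; exact hap
  apply hs
  rw [← Ideal.mem_quotient_iff_mem hIp, h3]
  refine Ideal.sum_mem _ fun i _ => Ideal.mul_mem_right _ _ (Ideal.mem_map_of_mem _ ?_)
  exact hψ ((b.coord i).comp g)

end Functional

/-- **Lemma 2.** With `A` a domain, `M` finitely generated torsion-free of rank `n`,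
`0 ≠ a ∈ A`, `M/aM` projective of rank `n` over `A/aA`, and the image of `m` in `M/aM`
unimodular: for every `m' ∈ M` and every `d ≥ 1`,
`(A ⊕ M)/(aᵈ, m) ≅ (A ⊕ M)/(aᵈ, m + a m')`. -/
theorem quotient_iso_of_transvection
    (A : Type) [CommRing A] [IsDomain A]
    (M : Type) [AddCommGroup M] [Module A M] [Module.Finite A M] [NoZeroSMulDivisors A M]
    (n : ℕ)
    (hrank : Module.rank (FractionRing A) (FractionRing A ⊗[A] M) = n)
    (a : A) (ha : a ≠ 0) (m : M)
    (hproj : ProjectiveOfRank (A ⧸ Ideal.span {a})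
      (M ⧸ (Ideal.span {a} • ⊤ : Submodule A M)) n)
    (hunim : ∃ φ : (M ⧸ (Ideal.span {a} • ⊤ : Submodule A M)) →ₗ[A ⧸ Ideal.span {a}]
        (A ⧸ Ideal.span {a}),
      φ (Submodule.Quotient.mk m) = 1)
    (m' : M) (d : ℕ) (hd : 0 < d) :
    Nonempty (((A × M) ⧸ Submodule.span A {((a ^ d, m) : A × M)}) ≃ₗ[A]
      ((A × M) ⧸ Submodule.span A {((a ^ d, m + a • m') : A × M)})) := by
  obtain ⟨ψ, hψ⟩ := exists_functional n hrank a m hproj hunim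
  refine (orb_of_coprime (a ^ d) m (m + a • m') ψ hψ.pow_right ?_).quot
  apply IsCoprime.pow_right
  rw [map_add, map_smul, smul_eq_mul]
  exact hψ.add_mul_left_left _
end

section
/- Let $A$ be an integral domain, $M$ a finitely generated torsion-free $A$-module of rank $n \geq 2$, $0 \neq a \in A$, and $m \in M$ such that $M/aM$ is a projective $A/aA$-module of rank $n$ and the image of $m$ in $M/aM$ is a unimodular element. Let $m' \in M$, $d$ a positive integer, $B = A[t]$, and let $N = (B \oplus M[t])/B\cdot(a^d, m + atm')$, where $M[t] = M \otimes_A B$. Then $N$ is extended from $A$, i.e., $N \cong (N/tN) \otimes_A B$ as $B$-modules. -/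
open TensorProduct Polynomial

/-- The `A[t]`-module `N = (A[t] ⊕ M[t]) / (aᵈ, m + a t m')`, where `M[t] = A[t] ⊗ M`. -/
abbrev ExtModN (A : Type) [CommRing A] (M : Type) [AddCommGroup M] [Module A M]
    (a : A) (m m' : M) (d : ℕ) : Type :=
  ((Polynomial A) × ((Polynomial A) ⊗[A] M)) ⧸
    Submodule.span (Polynomial A)
      {((((C a) ^ d : Polynomial A),
        ((1 : Polynomial A) ⊗ₜ[A] m + ((C a) * X) ⊗ₜ[A] m')) :
          (Polynomial A) × ((Polynomial A) ⊗[A] M))}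

/-- `N/tN`. -/
abbrev ExtModN0 (A : Type) [CommRing A] (M : Type) [AddCommGroup M] [Module A M]
    (a : A) (m m' : M) (d : ℕ) : Type :=
  (ExtModN A M a m m' d) ⧸
    (Ideal.span {(X : Polynomial A)} • ⊤ : Submodule (Polynomial A) (ExtModN A M a m m' d))


lemma mat_aux {B W : Type} [CommRing B] [AddCommGroup W] [Module B W] (Φ : W →ₗ[B] B) (μ : W)
    (s α' β' γ δ' : B) (hs : Φ μ = s) (h : α' + δ' + s * α' * δ' = γ * β') :
    ∃ σ : (B × W) ≃ₗ[B] (B × W), ∀ x y,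
      σ (x, y) = ((1 + s * α') * x + β' * Φ y, y + (γ * x + δ' * Φ y) • μ) := by
  refine ⟨LinearEquiv.ofBijective
    { toFun := fun p => ((1 + s * α') * p.1 + β' * Φ p.2, p.2 + (γ * p.1 + δ' * Φ p.2) • μ)
      map_add' := ?_
      map_smul' := ?_ } ?_, fun x y => rfl⟩
  · rintro ⟨x, y⟩ ⟨x', y'⟩
    ext
    · simp; ring
    · simp; module
  · rintro c ⟨x, y⟩
    ext
    · simp; ring
    · simp; module
  · rw [Function.bijective_iff_has_inverse]
    refine ⟨fun p => ((1 + s * δ') * p.1 - β' * Φ p.2, p.2 + (-γ * p.1 + α' * Φ p.2) • μ), ?_, ?_⟩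
    · rintro ⟨x, y⟩
      ext
      · simp [hs]; linear_combination (s * x) * h
      · simp only [LinearMap.coe_mk, AddHom.coe_mk, map_add, map_smul, hs, smul_eq_mul, add_assoc,
          add_eq_left, ← add_smul]
        convert zero_smul B μ
        linear_combination (Φ y) * h
    · rintro ⟨x, y⟩
      ext
      · simp [hs]; linear_combination (s * x) * h
      · simp only [LinearMap.coe_mk, AddHom.coe_mk, map_add, map_smul, hs, smul_eq_mul, add_assoc,
          add_eq_left, ← add_smul]
        convert zero_smul B μ
        linear_combination (Φ y) * h

lemma shear_aux {B W : Type} [CommRing B] [AddCommGroup W] [Module B W] (Φ : W →ₗ[B] B) (v w : W)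
    (hw : Φ w = 0) :
    ∃ σ : (B × W) ≃ₗ[B] (B × W), ∀ x y, σ (x, y) = (x, y + x • v + Φ y • w) := by
  refine ⟨LinearEquiv.ofBijective
    { toFun := fun p => (p.1, p.2 + p.1 • v + Φ p.2 • w)
      map_add' := ?_
      map_smul' := ?_ } ?_, fun x y => rfl⟩
  · rintro ⟨x, y⟩ ⟨x', y'⟩
    ext
    · simp
    · simp; module
  · rintro c ⟨x, y⟩
    ext
    · simp
    · simp; module
  · rw [Function.bijective_iff_has_inverse]
    refine ⟨fun p => (p.1, p.2 - p.1 • v - (Φ p.2 - p.1 * Φ v) • w), ?_, ?_⟩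
    · rintro ⟨x, y⟩
      ext
      · simp
      · simp [hw]; module
    · rintro ⟨x, y⟩
      ext
      · simp
      · simp [hw]; module

lemma move_aux {B W : Type} [CommRing B] [AddCommGroup W] [Module B W] (Φ : W →ₗ[B] B) (μ ν : W)
    (q b τ k g : B) (hs : Φ μ + q * b = 1) (hk : (1 + τ * Φ ν) * k = 1 + q * g) :
    ∃ σ : (B × W) ≃ₗ[B] (B × W), σ (q, μ) = (q, μ + τ • ν) := by
  obtain ⟨s, hs'⟩ : ∃ s, Φ μ = s := ⟨_, rfl⟩
  obtain ⟨c, hc⟩ : ∃ c, Φ ν = c := ⟨_, rfl⟩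
  rw [hs'] at hs
  rw [hc] at hk
  obtain rfl : s = 1 - q * b := by linear_combination hs
  obtain ⟨σ, hσ⟩ := mat_aux Φ μ (1 - q * b) (k - 1) (-q * (k - 1)) ((1 - q * b) * g + b * (τ * c))
    (τ * c - q * g) hs' (by linear_combination hk)
  obtain ⟨ρ, hρ⟩ := shear_aux Φ
    ((τ * b) • ν - ((g - b - q * g * b) * τ) • ((1 - q * b) • ν - c • μ))
    ((τ * k) • ((1 - q * b) • ν - c • μ)) (by simp [hs', hc]; ring)
  refine ⟨σ.trans ρ, ?_⟩
  rw [LinearEquiv.trans_apply, hσ, hs', hρ]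
  ext
  · simp; ring
  · simp only [map_add, map_smul, hs', smul_eq_mul]
    match_scalars <;> grind

lemma ext_aux (A N P : Type) [CommRing A] [AddCommGroup N] [Module A[X] N] [AddCommGroup P]
    [Module A P] (e : N ≃ₗ[A[X]] A[X] ⊗[A] P) :
    letI : Module A (N ⧸ (Ideal.span {(X : A[X])} • ⊤ : Submodule A[X] N)) :=
      Module.compHom _ (algebraMap A A[X])
    Nonempty (N ≃ₗ[A[X]] A[X] ⊗[A] (N ⧸ (Ideal.span {(X : A[X])} • ⊤ : Submodule A[X] N))) := by
  let _ : Module A (N ⧸ (Ideal.span {(X : A[X])} • ⊤ : Submodule A[X] N)) :=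
      Module.compHom _ (algebraMap A A[X])
  show Nonempty (N ≃ₗ[A[X]] A[X] ⊗[A] (N ⧸ (Ideal.span {(X : A[X])} • ⊤ : Submodule A[X] N)))
  let f : P →ₗ[A] (N ⧸ (Ideal.span {(X : A[X])} • ⊤ : Submodule A[X] N)) :=
    { toFun := fun p => Submodule.Quotient.mk (e.symm (1 ⊗ₜ p))
      map_add' := fun x y => by simp [tmul_add]
      map_smul' := fun c x => by
        rw [tmul_smul, ← algebraMap_smul A[X] c (1 ⊗ₜ[A] x), map_smul]
        rfl }
  let ev : A[X] ⊗[A] P →ₗ[A] P :=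
    (TensorProduct.lid A P).toLinearMap ∘ₗ (Polynomial.lcoeff A 0).rTensor P
  have hev : ∀ z ∈ (Ideal.span {(X : A[X])} • ⊤ : Submodule A[X] (A[X] ⊗[A] P)), ev z = 0 := by
    intro z hz
    rw [Submodule.ideal_span_singleton_smul] at hz
    obtain ⟨y, -, rfl⟩ := hz
    induction y with
    | zero => simp
    | add x y hx hy => simp at hx hy ⊢; simp [hx, hy]
    | tmul p x => simp [ev, smul_tmul']
  have hsub : ∀ z : A[X] ⊗[A] P, z - 1 ⊗ₜ ev z ∈
      (Ideal.span {(X : A[X])} • ⊤ : Submodule A[X] (A[X] ⊗[A] P)) := by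
    intro z
    induction z with
    | zero => simp
    | add x y hx hy =>
      rw [map_add, tmul_add, add_sub_add_comm]
      exact add_mem hx hy
    | tmul p x =>
      rw [Submodule.ideal_span_singleton_smul]
      refine ⟨p.divX ⊗ₜ x, trivial, ?_⟩
      have : p ⊗ₜ[A] x = (X * p.divX + C (p.coeff 0)) ⊗ₜ[A] x := by rw [X_mul_divX_add]
      rw [this, add_tmul]
      simp [ev, smul_tmul', smul_eq_C_mul]
  have hmap : ∀ z, z ∈ (Ideal.span {(X : A[X])} • ⊤ : Submodule A[X] N) ↔
      e z ∈ (Ideal.span {(X : A[X])} • ⊤ : Submodule A[X] (A[X] ⊗[A] P)) := by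
    intro z
    have : (Ideal.span {(X : A[X])} • ⊤ : Submodule A[X] (A[X] ⊗[A] P)) =
      (Ideal.span {(X : A[X])} • ⊤ : Submodule A[X] N).map e.toLinearMap := by
      rw [Submodule.map_smul'']
      simp
    rw [this]
    exact ((Submodule.mem_map_equiv (e := e) (x := e z) _).trans (by simp)).symm
  have hf : Function.Bijective f := by
    constructor
    · rw [injective_iff_map_eq_zero]
      intro p hp
      have := (Submodule.Quotient.mk_eq_zero _).1 hp
      rw [hmap] at this
      simpa [ev] using hev _ this
    · intro y
      obtain ⟨y, rfl⟩ := Submodule.Quotient.mk_surjective _ y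
      refine ⟨ev (e y), ?_⟩
      refine ((Submodule.Quotient.eq _).2 ?_)
      rw [← neg_mem_iff, hmap]
      simpa using hsub (e y)
  exact ⟨e.trans ((LinearEquiv.ofBijective f hf).baseChange A A[X] _ _)⟩

lemma quot_aux (A M : Type) [CommRing A] [AddCommGroup M] [Module A M] (a : A) (m : M) :
    Nonempty (((A[X] × (A[X] ⊗[A] M)) ⧸ Submodule.span A[X] {(C a, (1 : A[X]) ⊗ₜ[A] m)}) ≃ₗ[A[X]]
      A[X] ⊗[A] ((A × M) ⧸ Submodule.span A {(a, m)})) := by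
  let e : A[X] ⊗[A] (A × M) ≃ₗ[A[X]] A[X] × (A[X] ⊗[A] M) :=
    (TensorProduct.prodRight A A[X] A[X] A M).trans
      ((AlgebraTensorModule.rid A A[X] A[X]).prodCongr (LinearEquiv.refl _ _))
  refine ⟨(Submodule.Quotient.equiv _ _ e ?_).symm.trans
    (AlgebraTensorModule.tensorQuotientEquiv A[X] A A[X] (Submodule.span A {(a, m)})).symm⟩
  have h : LinearMap.range (AlgebraTensorModule.lTensor A[X] A[X]
      (((Submodule.span A {(a, m)}).subtype).restrictScalars A)) =
      (Submodule.span A {(a, m)}).baseChange A[X] := rfl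
  rw [h, Submodule.baseChange_span, Submodule.map_span]
  congr 1
  simp [e, smul_eq_C_mul]

lemma func_aux (A M κ : Type) [CommRing A] [IsDomain A] [AddCommGroup M] [Module A M]
    [Module.Finite A M] (n : ℕ)
    (hrank : Module.rank (FractionRing A) (FractionRing A ⊗[A] M) = n)
    [Field κ] [Algebra A κ] (hsurj : Function.Surjective (algebraMap A κ))
    (hκ : Module.rank κ (κ ⊗[A] M) = n) (m : M) (f : M →ₗ[A] κ) (hf : f m = 1) :
    ∃ φ : M →ₗ[A] A, algebraMap A κ (φ m) ≠ 0 := by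
  classical
  let v : M →ₗ[A] κ ⊗[A] M := TensorProduct.mk A κ M 1
  have hvm : v m ≠ 0 := by
    intro h
    have := congrArg (TensorProduct.lift ((LinearMap.mul' A κ).comp (f.lTensor κ) |>.comp
      (LinearMap.id) |> TensorProduct.curry)) h
    simp [v, hf] at this
  have hker : ∀ y, v y = 0 → y ∈ (RingHom.ker (algebraMap A κ) • ⊤ : Submodule A M) := by
    intro y hy
    have e := Ideal.quotientKerAlgEquivOfSurjective (f := Algebra.ofId A κ) hsurj
    have h := congrArg (e.symm.toLinearEquiv.toLinearMap.rTensor M) hy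
    rw [map_zero] at h
    have h2 : y ∈ LinearMap.ker (TensorProduct.mk A (A ⧸ RingHom.ker (Algebra.ofId A κ)) M 1) := by
      rw [LinearMap.mem_ker, ← h]
      simp [v]
    rw [LinearMap.ker_tensorProductMk] at h2
    exact h2
  obtain ⟨b, -, hmb, hspan, hli⟩ := exists_linearIndepOn_extension (K := κ) (v := v) (s := {m})
    (t := Set.univ) (LinearIndepOn.singleton hvm) (Set.subset_univ _)
  have hmb : m ∈ b := hmb rfl
  have hfr : Module.finrank κ (κ ⊗[A] M) = n := Module.finrank_eq_of_rank_eq hκ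
  have htop : ⊤ ≤ Submodule.span κ (Set.range fun i : b => v i) := by
    have h1 : (Set.range fun i : b => v i) = v '' b := by
      ext; simp
    rw [h1]
    intro z _
    induction z with
    | zero => simp
    | add x y hx hy => exact add_mem (hx trivial) (hy trivial)
    | tmul c x =>
      have : c ⊗ₜ[A] x = c • v x := by simp [v, smul_tmul']
      rw [this]
      exact Submodule.smul_mem _ _ (hspan ⟨x, trivial, rfl⟩)
  let bas := Module.Basis.mk (v := fun i : b => v i) hli htop
  have : Fintype b := by
    have : Module.Finite κ (κ ⊗[A] M) := inferInstance
    exact FiniteDimensional.fintypeBasisIndex bas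
  have hcard : Fintype.card b = n := by
    rw [← hfr, Module.finrank_eq_card_basis bas]
  obtain ⟨r, hr1, hr⟩ := Submodule.exists_sub_one_mem_and_smul_le_of_fg_of_le_sup
    (I := RingHom.ker (algebraMap A κ)) (N := Submodule.span A (Set.range ((↑) : b → M)))
    (N' := ⊤) (P := ⊤) Module.Finite.fg_top le_rfl (by
      intro y _
      choose c hc using fun i => hsurj (bas.repr (v y) i)
      have h1 : v (y - ∑ i, c i • (i : M)) = 0 := by
        rw [map_sub, map_sum, sub_eq_zero]
        conv_lhs => rw [← bas.sum_repr (v y)]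
        refine Finset.sum_congr rfl fun i _ => ?_
        rw [← hc, map_smul, algebraMap_smul]
        exact congrArg (c i • ·) (Module.Basis.mk_apply hli htop i)
      rw [← add_sub_cancel (∑ i, c i • (i : M)) y]
      refine Submodule.add_mem_sup ?_ (hker _ h1)
      exact Submodule.sum_mem _ fun i _ => Submodule.smul_mem _ _ (Submodule.subset_span ⟨i, rfl⟩))
  have hr0 : algebraMap A κ r = 1 := by
    simpa [sub_eq_zero] using hr1
  have hrne : r ≠ 0 := by rintro rfl; simp at hr0
  have hrm : ∀ y, r • y ∈ Submodule.span A (Set.range ((↑) : b → M)) := fun y =>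
    hr (Submodule.smul_mem_pointwise_smul _ _ _ trivial)
  let K := FractionRing A
  let w : M →ₗ[A] K ⊗[A] M := TensorProduct.mk A K M 1
  have hK : LinearIndependent K (fun i : b => w i) := by
    apply linearIndependent_of_top_le_span_of_card_eq_finrank
    · intro z _
      induction z with
      | zero => simp
      | add x y hx hy => exact add_mem (hx trivial) (hy trivial)
      | tmul c x =>
        have h1 : c ⊗ₜ[A] x = (c * (algebraMap A K r)⁻¹) • w (r • x) := by
          have : algebraMap A K r ≠ 0 := by simpa using hrne
          rw [map_smul, ← algebraMap_smul K r, smul_smul, mul_assoc, inv_mul_cancel₀ this]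
          simp [w, smul_tmul']
        rw [h1]
        refine Submodule.smul_mem _ _ ?_
        have h2 := Submodule.mem_map_of_mem (f := w) (hrm x)
        rw [Submodule.map_span, ← Set.range_comp] at h2
        exact Submodule.span_le_restrictScalars A K _ h2
    · rw [hcard, Module.finrank_eq_of_rank_eq hrank]
  have hA : LinearIndependent A ((↑) : b → M) :=
    LinearIndependent.of_comp w (hK.restrict_scalars' A)
  let bs := Module.Basis.span hA
  refine ⟨bs.coord ⟨m, hmb⟩ ∘ₗ LinearMap.codRestrict _ (LinearMap.lsmul A M r) hrm, ?_⟩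
  have h3 : LinearMap.codRestrict _ (LinearMap.lsmul A M r) hrm m = r • bs ⟨m, hmb⟩ := by
    apply Subtype.ext
    rw [Submodule.coe_smul, Module.Basis.span_apply]
    rfl
  rw [LinearMap.comp_apply, h3, map_smul]
  simp [hr0]

lemma rank_aux (A M : Type) [CommRing A] [AddCommGroup M] [Module A M] (I : Ideal A) (n : ℕ)
    (p : Ideal (A ⧸ I)) [p.IsPrime]
    (h1 : Module.Free (Localization.AtPrime p) (LocalizedModule p.primeCompl
      (M ⧸ (I • ⊤ : Submodule A M))))
    (h2 : Module.rank (Localization.AtPrime p) (LocalizedModule p.primeCompl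
      (M ⧸ (I • ⊤ : Submodule A M))) = n) :
    Module.rank p.ResidueField (p.ResidueField ⊗[A] M) = n := by
  have e0 : ((A ⧸ I) ⊗[A] M) ≃ₗ[A ⧸ I] (M ⧸ (I • ⊤ : Submodule A M)) :=
    (TensorProduct.quotTensorEquivQuotSMul M I).extendScalarsOfSurjective Ideal.Quotient.mk_surjective
  let κ := p.ResidueField
  let L := Localization.AtPrime p
  have e1 : κ ⊗[A] M ≃ₗ[κ] κ ⊗[L] LocalizedModule p.primeCompl (M ⧸ (I • ⊤ : Submodule A M)) :=
    (AlgebraTensorModule.cancelBaseChange A (A ⧸ I) κ κ M).symm ≪≫ₗ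
    (e0.baseChange (A ⧸ I) κ _ _) ≪≫ₗ
    (AlgebraTensorModule.cancelBaseChange (A ⧸ I) L κ κ _).symm ≪≫ₗ
    ((LocalizedModule.equivTensorProduct p.primeCompl _).symm.baseChange L κ _ _)
  rw [e1.rank_eq, Module.rank_baseChange, h2]
  simp

lemma functional_aux (A M : Type) [CommRing A] [IsDomain A] [AddCommGroup M] [Module A M]
    [Module.Finite A M] (n : ℕ)
    (hrank : Module.rank (FractionRing A) (FractionRing A ⊗[A] M) = n)
    (a : A) (m : M)
    (hproj : ProjectiveOfRank (A ⧸ Ideal.span {a})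
      (M ⧸ (Ideal.span {a} • ⊤ : Submodule A M)) n)
    (hunim : ∃ φ : (M ⧸ (Ideal.span {a} • ⊤ : Submodule A M)) →ₗ[A ⧸ Ideal.span {a}]
        (A ⧸ Ideal.span {a}),
      φ (Submodule.Quotient.mk m) = 1) (d : ℕ) :
    ∃ (φ : M →ₗ[A] A) (b : A), φ m + a ^ d * b = 1 := by
  let I : Ideal A := LinearMap.range (LinearMap.applyₗ m : (M →ₗ[A] A) →ₗ[A] A)
  have hI : I ⊔ Ideal.span {a} = ⊤ := by
    by_contra hne
    obtain ⟨P, hP, hle⟩ := Ideal.exists_le_maximal _ hne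
    have haP : Ideal.span {a} ≤ P := le_sup_right.trans hle
    let p : Ideal (A ⧸ Ideal.span {a}) := P.map (Ideal.Quotient.mk (Ideal.span {a}))
    have hp : p.IsMaximal := Ideal.IsMaximal.map_of_surjective_of_ker_le
      Ideal.Quotient.mk_surjective (by simpa using haP)
    obtain ⟨h1, h2⟩ := hproj.2 p
    have hr := rank_aux A M (Ideal.span {a}) n p h1 h2
    obtain ⟨ψ, hψ⟩ := hunim
    let f : M →ₗ[A] p.ResidueField :=
      (Algebra.linearMap (A ⧸ Ideal.span {a}) p.ResidueField).restrictScalars A ∘ₗ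
        ψ.restrictScalars A ∘ₗ Submodule.mkQ _
    have hf : f m = 1 := by
      change algebraMap (A ⧸ Ideal.span {a}) p.ResidueField (ψ (Submodule.Quotient.mk m)) = 1
      rw [hψ, map_one]
    have hsurj : Function.Surjective (algebraMap A p.ResidueField) := by
      rw [IsScalarTower.algebraMap_eq A (A ⧸ Ideal.span {a}) p.ResidueField]
      exact p.algebraMap_residueField_surjective.comp Ideal.Quotient.mk_surjective
    obtain ⟨φ, hφ⟩ := func_aux A M p.ResidueField n hrank hsurj hr m f hf
    apply hφ
    rw [IsScalarTower.algebraMap_apply A (A ⧸ Ideal.span {a}) p.ResidueField,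
      Ideal.algebraMap_residueField_eq_zero]
    exact Ideal.mem_map_of_mem _ (hle (Ideal.mem_sup_left ⟨φ, rfl⟩))
  have hc := (Ideal.isCoprime_iff_sup_eq.2 hI).pow_right (n := d)
  rw [Ideal.span_singleton_pow, Ideal.isCoprime_iff_exists] at hc
  obtain ⟨_, ⟨φ, rfl⟩, j, hj, h⟩ := hc
  obtain ⟨b, rfl⟩ := Ideal.mem_span_singleton'.1 hj
  exact ⟨φ, b, by rw [mul_comm]; exact h⟩

/-- With `A` a domain, `M` finitely generated torsion-free of rank `n ≥ 2`, `0 ≠ a ∈ A`,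
`M/aM` projective of rank `n` over `A/aA`, the image of `m` in `M/aM` unimodular,
`m' ∈ M` and `d ≥ 1`: the `A[t]`-module `N = (A[t] ⊕ M[t])/(aᵈ, m + a t m')` is extended
from `A`, i.e. `N ≅ A[t] ⊗_A (N/tN)`. -/
theorem extended_module
    (A : Type) [CommRing A] [IsDomain A]
    (M : Type) [AddCommGroup M] [Module A M] [Module.Finite A M] [NoZeroSMulDivisors A M]
    (n : ℕ) (hn : 2 ≤ n)
    (hrank : Module.rank (FractionRing A) (FractionRing A ⊗[A] M) = n)
    (a : A) (ha : a ≠ 0) (m : M)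
    (hproj : ProjectiveOfRank (A ⧸ Ideal.span {a})
      (M ⧸ (Ideal.span {a} • ⊤ : Submodule A M)) n)
    (hunim : ∃ φ : (M ⧸ (Ideal.span {a} • ⊤ : Submodule A M)) →ₗ[A ⧸ Ideal.span {a}]
        (A ⧸ Ideal.span {a}),
      φ (Submodule.Quotient.mk m) = 1)
    (m' : M) (d : ℕ) (hd : 0 < d) :
    letI : Module A (ExtModN0 A M a m m' d) :=
      Module.compHom (ExtModN0 A M a m m' d) (algebraMap A (Polynomial A))
    Nonempty ((ExtModN A M a m m' d) ≃ₗ[Polynomial A]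
      (Polynomial A) ⊗[A] (ExtModN0 A M a m m' d)) := by
  obtain ⟨φ, b, hb⟩ := functional_aux A M n hrank a m hproj hunim d
  let Φ : A[X] ⊗[A] M →ₗ[A[X]] A[X] :=
    (AlgebraTensorModule.rid A A[X] A[X]).toLinearMap ∘ₗ φ.baseChange A[X]
  have hΦ : Φ (1 ⊗ₜ m) = C (φ m) := by simp [Φ, smul_eq_C_mul]
  obtain ⟨k, g, hkg⟩ : IsCoprime (1 + (C a * X) * Φ (1 ⊗ₜ m')) (C a ^ d) :=
    IsCoprime.pow_right ⟨1, -X * Φ (1 ⊗ₜ m'), by ring⟩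
  obtain ⟨σ, hσ⟩ := move_aux Φ (1 ⊗ₜ m) (1 ⊗ₜ m') (C a ^ d) (C b) (C a * X) k (-g)
    (by rw [hΦ, ← C_pow, ← C_mul, ← C_add, hb, C_1]) (by linear_combination hkg)
  obtain ⟨e⟩ := quot_aux A M (a ^ d) m
  refine ext_aux A (ExtModN A M a m m' d) _
    ((Submodule.Quotient.equiv _ _ σ ?_).symm.trans e)
  rw [Submodule.map_span, Set.image_singleton, C_pow]
  have h2 : σ (C a ^ d, 1 ⊗ₜ m) = (C a ^ d, 1 ⊗ₜ[A] m + (C a * X) ⊗ₜ[A] m') := by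
    rw [hσ, smul_tmul', smul_eq_mul, mul_one]
  exact congrArg (fun z => Submodule.span A[X] {z}) h2
end

section
/- Let $k$ be a field and $R = k[x,y,z,t]$ the polynomial ring in four variables. Let $M_1$ be the cokernel of the $R$-linear map $R \to R^3$, $1 \mapsto (x, y, zt-1)$, and $M_2$ the cokernel of the $R$-linear map $R \to R^3$, $1 \mapsto (x, yz, zt-1)$. Then $M_1$ and $M_2$ are reflexive $R$-modules of rank $2$. -/
open TensorProduct MvPolynomial

/-- The polynomial ring `k[x,y,z,t]`. -/
abbrev R4 (k : Type) [Field k] : Type := MvPolynomial (Fin 4) k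

/-- The cokernel of `R → R³`, `1 ↦ v`. -/
abbrev CokerVec (k : Type) [Field k] (v : Fin 3 → R4 k) : Type :=
  (Fin 3 → R4 k) ⧸ Submodule.span (R4 k) {v}

section Aux

variable {R : Type} [CommRing R] [IsDomain R]

/-- The dual vector on the cokernel given by a vector orthogonal to `v`. -/
noncomputable def auxDual (a b c : R) (p0 p1 p2 : R) (h : p0 * a + p1 * b + p2 * c = 0) :
    Module.Dual R ((Fin 3 → R) ⧸ Submodule.span R {![a, b, c]}) :=
  Submodule.liftQ _ (p0 • LinearMap.proj 0 + p1 • LinearMap.proj 1 + p2 • LinearMap.proj 2)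
    (by
      rw [Submodule.span_singleton_le_iff_mem, LinearMap.mem_ker]
      simpa using h)


theorem auxDual_mk (a b c : R) (p0 p1 p2 : R) (h : p0 * a + p1 * b + p2 * c = 0) (u : Fin 3 → R) :
    auxDual a b c p0 p1 p2 h (Submodule.Quotient.mk u) = p0 * u 0 + p1 * u 1 + p2 * u 2 := by
  simp [auxDual]

theorem aux_koszul (a b c : R) (ha : a ≠ 0) (h1 : ∀ s, a ∣ b * s → a ∣ s)
    (h2 : ∀ s α β, c * s = a * α + b * β → ∃ α' β', s = a * α' + b * β')
    (q1 q2 q3 : R) (h : a * q1 + b * q2 + c * q3 = 0) :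
    ∃ r1 r2 r3, q1 = -c * r2 + b * r3 ∧ q2 = c * r1 - a * r3 ∧ q3 = -b * r1 + a * r2 := by
  obtain ⟨α, β, e⟩ := h2 q3 (-q1) (-q2) (by linear_combination h)
  obtain ⟨g, hg⟩ := h1 (q2 + c * β) ⟨-(q1 + c * α), by rw [e] at h; linear_combination h⟩
  refine ⟨-β, α, -g, ?_, by linear_combination hg, by rw [e]; ring⟩
  apply mul_left_cancel₀ ha
  rw [e] at h
  linear_combination h - b * hg

theorem aux_reflexive (a b c : R) (ha : a ≠ 0) (h1 : ∀ s, a ∣ b * s → a ∣ s)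
    (h2 : ∀ s α β, c * s = a * α + b * β → ∃ α' β', s = a * α' + b * β') :
    Module.IsReflexive R ((Fin 3 → R) ⧸ Submodule.span R {![a, b, c]}) := by
  let K1 := auxDual a b c 0 c (-b) (by ring)
  let K2 := auxDual a b c (-c) 0 a (by ring)
  let K3 := auxDual a b c b (-a) 0 (by ring)
  have e1 : ∀ u, K1 (Submodule.Quotient.mk u) = 0 * u 0 + c * u 1 + -b * u 2 := auxDual_mk _ _ _ _ _ _ _
  have e2 : ∀ u, K2 (Submodule.Quotient.mk u) = -c * u 0 + 0 * u 1 + a * u 2 := auxDual_mk _ _ _ _ _ _ _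
  have e3 : ∀ u, K3 (Submodule.Quotient.mk u) = b * u 0 + -a * u 1 + 0 * u 2 := auxDual_mk _ _ _ _ _ _ _
  refine ⟨?_, ?_⟩
  · rw [← LinearMap.ker_eq_bot, LinearMap.ker_eq_bot']
    intro m hm
    obtain ⟨u, rfl⟩ := Submodule.Quotient.mk_surjective _ m
    have k2 := LinearMap.congr_fun hm K2
    have k3 := LinearMap.congr_fun hm K3
    simp only [Module.Dual.eval_apply, LinearMap.zero_apply] at k2 k3
    rw [e2] at k2
    rw [e3] at k3
    obtain ⟨s, hs⟩ := h1 (u 0) ⟨u 1, by linear_combination k3⟩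
    rw [Submodule.Quotient.mk_eq_zero, Submodule.mem_span_singleton]
    refine ⟨s, ?_⟩
    have t1 : u 1 = b * s := by
      apply mul_left_cancel₀ ha
      rw [hs] at k3; linear_combination -k3
    have t2 : u 2 = c * s := by
      apply mul_left_cancel₀ ha
      rw [hs] at k2; linear_combination k2
    ext i
    fin_cases i
    · simp [hs, mul_comm]
    · simp [t1, mul_comm]
    · simp [t2, mul_comm]
  · intro φ
    have rel : a • K1 + b • K2 + c • K3 = 0 := by
      apply LinearMap.ext
      intro m
      obtain ⟨u, rfl⟩ := Submodule.Quotient.mk_surjective _ m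
      simp only [LinearMap.add_apply, LinearMap.smul_apply, e1, e2, e3, smul_eq_mul,
        LinearMap.zero_apply]
      ring
    have rel2 := congrArg φ rel
    simp only [map_add, map_smul, smul_eq_mul, map_zero] at rel2
    obtain ⟨r1, r2, r3, k1, k2, k3⟩ := aux_koszul a b c ha h1 h2 _ _ _ rel2
    refine ⟨Submodule.Quotient.mk ![-r1, -r2, -r3], ?_⟩
    apply LinearMap.ext
    intro f
    have hf : ∀ u : Fin 3 → R, f (Submodule.Quotient.mk u) =
        u 0 * f (Submodule.Quotient.mk (Pi.single 0 1)) +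
        u 1 * f (Submodule.Quotient.mk (Pi.single 1 1)) +
        u 2 * f (Submodule.Quotient.mk (Pi.single 2 1)) := by
      intro u
      have : u = u 0 • Pi.single 0 1 + u 1 • Pi.single 1 1 + u 2 • Pi.single 2 1 := by
        ext i; fin_cases i <;> simp
      conv_lhs => rw [this]
      simp only [Submodule.Quotient.mk_add, Submodule.Quotient.mk_smul, map_add, map_smul,
        smul_eq_mul]
    have hz : f (Submodule.Quotient.mk ![a, b, c]) = 0 := by
      rw [(Submodule.Quotient.mk_eq_zero _).2 (Submodule.mem_span_singleton_self _), map_zero]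
    rw [hf] at hz
    obtain ⟨s1, s2, s3, l1, l2, l3⟩ := aux_koszul a b c ha h1 h2 _ _ _ hz
    have fe : f = s1 • K1 + s2 • K2 + s3 • K3 := by
      apply LinearMap.ext
      intro m
      obtain ⟨u, rfl⟩ := Submodule.Quotient.mk_surjective _ m
      simp only [LinearMap.add_apply, LinearMap.smul_apply, e1, e2, e3, smul_eq_mul]
      rw [hf, l1, l2, l3]
      ring
    rw [fe]
    simp only [Module.Dual.eval_apply, map_add, map_smul, LinearMap.add_apply,
      LinearMap.smul_apply, e1, e2, e3, smul_eq_mul, k1, k2, k3]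
    simp only [Matrix.cons_val]
    ring

theorem aux_rank (v : Fin 3 → R) (hv : v ≠ 0) :
    Module.rank (FractionRing R)
      (FractionRing R ⊗[R] ((Fin 3 → R) ⧸ Submodule.span R {v})) = 2 := by
  rw [IsFractionRing.rank_right_eq R,
    IsLocalizedModule.rank_eq (nonZeroDivisors R) le_rfl
      (TensorProduct.mk R (FractionRing R) ((Fin 3 → R) ⧸ Submodule.span R {v}) 1)]
  have h := rank_quotient_add_rank_of_isDomain (Submodule.span R {v})
  rw [← (LinearEquiv.toSpanNonzeroSingleton R _ v hv).rank_eq, Module.rank_self, rank_fin_fun] at h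
  have h3 : ((3 : ℕ) : Cardinal) = 2 + 1 := by norm_num
  rw [h3] at h
  exact Cardinal.add_one_inj.1 h

end Aux

section Poly

variable (k : Type) [Field k]

/-- Substitution `x = 0`. -/
noncomputable def auxS : R4 k →ₐ[k] R4 k := aeval ![0, X 1, X 2, X 3]

theorem auxS_dvd (s : R4 k) : (X 0 : R4 k) ∣ s - auxS k s := by
  rw [← Ideal.mem_span_singleton, ← Ideal.Quotient.eq]
  have : (Ideal.Quotient.mkₐ k (Ideal.span {(X 0 : R4 k)})) =
      (Ideal.Quotient.mkₐ k (Ideal.span {(X 0 : R4 k)})).comp (auxS k) := by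
    apply MvPolynomial.algHom_ext
    intro i
    fin_cases i
    · simp [auxS, Ideal.Quotient.eq_zero_iff_mem, Ideal.mem_span_singleton]
    · simp [auxS]
    · simp [auxS]
    · simp [auxS]
  exact DFunLike.congr_fun this s

theorem aux_ndvd (i : Fin 4) (f : R4 k) (p : Fin 4 → k) (hp : p i = 0) (hf : eval p f ≠ 0) :
    ¬ (X i : R4 k) ∣ f := by
  rintro ⟨g, rfl⟩
  simp [hp] at hf

theorem aux_h2 (b : R4 k) (hb : auxS k b = b)
    (H : ∀ s : R4 k, b ∣ (X 2 * X 3 - 1) * s → b ∣ s) (s α β : R4 k)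
    (h : (X 2 * X 3 - 1) * s = X 0 * α + b * β) : ∃ α' β', s = X 0 * α' + b * β' := by
  have h' := congrArg (auxS k) h
  have z0 : auxS k (X 0) = 0 := by simp [auxS]
  have z2 : auxS k (X 2) = X 2 := by simp [auxS]
  have z3 : auxS k (X 3) = X 3 := by simp [auxS]
  simp only [map_mul, map_sub, map_add, map_one, z0, z2, z3, hb] at h'
  obtain ⟨β', e⟩ := H (auxS k s) ⟨auxS k β, by linear_combination h'⟩
  obtain ⟨α', e'⟩ := auxS_dvd k s
  exact ⟨α', β', by linear_combination e' + e⟩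

theorem aux_y (s : R4 k) (h : (X 1 : R4 k) ∣ (X 2 * X 3 - 1) * s) : (X 1 : R4 k) ∣ s :=
  ((X_prime (i := (1 : Fin 4)) (R := k)).dvd_or_dvd h).resolve_left
    (aux_ndvd k 1 _ (fun _ => 0) rfl (by simp))

theorem aux_yz (s : R4 k) (h : (X 1 * X 2 : R4 k) ∣ (X 2 * X 3 - 1) * s) :
    (X 1 * X 2 : R4 k) ∣ s := by
  obtain ⟨g, hg⟩ := h
  obtain ⟨w, rfl⟩ := aux_y k s ⟨X 2 * g, by rw [hg]; ring⟩
  refine mul_dvd_mul_left _ ⟨X 3 * w - g, ?_⟩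
  apply mul_left_cancel₀ (X_ne_zero (R := k) (1 : Fin 4))
  linear_combination -hg

end Poly

/-- Let `R = k[x,y,z,t]`, `M₁ = coker(1 ↦ (x, y, zt-1))` and
`M₂ = coker(1 ↦ (x, yz, zt-1))`.  Then `M₁` and `M₂` are reflexive `R`-modules of
rank `2`. -/
theorem four_variable_modules_reflexive_rank_two (k : Type) [Field k] :
    Module.IsReflexive (R4 k) (CokerVec k ![X 0, X 1, X 2 * X 3 - 1]) ∧
    Module.IsReflexive (R4 k) (CokerVec k ![X 0, X 1 * X 2, X 2 * X 3 - 1]) ∧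
    Module.rank (FractionRing (R4 k))
      (FractionRing (R4 k) ⊗[R4 k] (CokerVec k ![X 0, X 1, X 2 * X 3 - 1])) = 2 ∧
    Module.rank (FractionRing (R4 k))
      (FractionRing (R4 k) ⊗[R4 k] (CokerVec k ![X 0, X 1 * X 2, X 2 * X 3 - 1])) = 2 := by
  have hp := X_prime (i := (0 : Fin 4)) (R := k)
  have v0 : ∀ b c : R4 k, ![X 0, b, c] ≠ 0 := fun b c h => hp.ne_zero (congrFun h 0)
  refine ⟨aux_reflexive _ _ _ hp.ne_zero ?_ ?_, aux_reflexive _ _ _ hp.ne_zero ?_ ?_,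
    aux_rank _ (v0 _ _), aux_rank _ (v0 _ _)⟩
  · intro s h
    exact (hp.dvd_or_dvd h).resolve_left
      (aux_ndvd k 0 _ ![0, 1, 1, 1] rfl (by simp))
  · exact aux_h2 k _ (by simp [auxS]) (aux_y k)
  · intro s h
    exact (hp.dvd_or_dvd h).resolve_left
      (aux_ndvd k 0 _ ![0, 1, 1, 1] rfl (by simp))
  · exact aux_h2 k _ (by simp [auxS]) (aux_yz k)
end

section
/- Let $k$ be a field and $R = k[x,y,z,t]$ the polynomial ring in four variables. Let $M_1$ be the cokernel of the $R$-linear map $R \to R^3$, $1 \mapsto (x, y, zt-1)$, and $M_2$ the cokernel of the $R$-linear map $R \to R^3$, $1 \mapsto (x, yz, zt-1)$. Then $M_1 \oplus R \cong M_2 \oplus R$ as $R$-modules. -/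
open MvPolynomial

theorem coker_ker_aux (k : Type) [Field k] (v : Fin 3 → R4 k) :
    LinearMap.ker (LinearMap.prodMap (Submodule.span (R4 k) {v}).mkQ
      (LinearMap.id : R4 k →ₗ[R4 k] R4 k)) = Submodule.span (R4 k) {(v, (0 : R4 k))} := by
  ext ⟨u, r⟩
  simp only [LinearMap.mem_ker, LinearMap.prodMap_apply, Submodule.mkQ_apply, LinearMap.id_apply,
    Prod.mk_eq_zero, Submodule.Quotient.mk_eq_zero, Submodule.mem_span_singleton, Prod.smul_mk,
    Prod.mk.injEq, smul_zero]
  constructor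
  · rintro ⟨⟨a, ha⟩, hr⟩
    exact ⟨a, ha, hr.symm⟩
  · rintro ⟨a, ha, hr⟩
    exact ⟨⟨a, ha⟩, hr.symm⟩

theorem coker_iso_aux (k : Type) [Field k] (v v' : Fin 3 → R4 k)
    (e : ((Fin 3 → R4 k) × R4 k) ≃ₗ[R4 k] ((Fin 3 → R4 k) × R4 k))
    (he : e (v, 0) = (v', 0)) :
    Nonempty ((CokerVec k v × R4 k) ≃ₗ[R4 k] (CokerVec k v' × R4 k)) := by
  have hs : ∀ w : Fin 3 → R4 k, Function.Surjective
      (LinearMap.prodMap (Submodule.span (R4 k) {w}).mkQ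
        (LinearMap.id : R4 k →ₗ[R4 k] R4 k)) := by
    intro w
    rw [LinearMap.coe_prodMap]
    exact Function.Surjective.prodMap (Submodule.mkQ_surjective _) Function.surjective_id
  refine ⟨((LinearMap.quotKerEquivOfSurjective _ (hs v)).symm.trans
    (Submodule.Quotient.equiv _ _ e ?_)).trans (LinearMap.quotKerEquivOfSurjective _ (hs v'))⟩
  rw [coker_ker_aux, coker_ker_aux, Submodule.map_span, Set.image_singleton]
  congr 2

/-- The explicit automorphism of `R³ × R`. -/
noncomputable def auxEquiv (k : Type) [Field k] (y z w s : R4 k) (h : z * s + w * w = 1) :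
    ((Fin 3 → R4 k) × R4 k) ≃ₗ[R4 k] ((Fin 3 → R4 k) × R4 k) where
  toFun p := (![p.1 0, z * p.1 1 - w * p.2, p.1 2], w * p.1 1 + s * p.2 - y * p.1 2)
  invFun p := (![p.1 0, s * p.1 1 + w * (p.2 + y * p.1 2), p.1 2],
    -w * p.1 1 + z * (p.2 + y * p.1 2))
  map_add' p q := by
    refine Prod.ext (funext fun i => ?_) ?_
    · fin_cases i <;> simp <;> ring
    · simp; ring
  map_smul' c p := by
    refine Prod.ext (funext fun i => ?_) ?_
    · fin_cases i <;> simp <;> ring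
    · simp; ring
  left_inv p := by
    refine Prod.ext (funext fun i => ?_) ?_
    · fin_cases i <;> simp
      linear_combination (p.1 1) * h
    · simp
      linear_combination p.2 * h
  right_inv p := by
    refine Prod.ext (funext fun i => ?_) ?_
    · fin_cases i <;> simp
      linear_combination (p.1 1) * h
    · simp
      linear_combination (p.2 + y * p.1 2) * h

/-- Let `R = k[x,y,z,t]`, `M₁ = coker(1 ↦ (x, y, zt-1))` and
`M₂ = coker(1 ↦ (x, yz, zt-1))`.  Then `M₁ ⊕ R ≅ M₂ ⊕ R`. -/
theorem four_variable_modules_stably_isomorphic (k : Type) [Field k] :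
    Nonempty (((CokerVec k ![X 0, X 1, X 2 * X 3 - 1]) × R4 k) ≃ₗ[R4 k]
      ((CokerVec k ![X 0, X 1 * X 2, X 2 * X 3 - 1]) × R4 k)) := by
  refine coker_iso_aux k _ _ (auxEquiv k (X 1) (X 2) (X 2 * X 3 - 1)
    (2 * X 3 - X 2 * X 3 * X 3) (by ring)) ?_
  refine Prod.ext (funext fun i => ?_) ?_
  · fin_cases i <;> simp [auxEquiv]
    ring
  · simp [auxEquiv]
    ring
end

section
/- Let $k$ be a field and $R = k[x,y,z,t]$ the polynomial ring in four variables. Let $M_1$ be the cokernel of the $R$-linear map $R \to R^3$, $1 \mapsto (x, y, zt-1)$, and $M_2$ the cokernel of the $R$-linear map $R \to R^3$, $1 \mapsto (x, yz, zt-1)$. Then $M_1$ and $M_2$ are not isomorphic as $R$-modules. -/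
open MvPolynomial

open Matrix in
theorem aux_lift {R : Type} [CommRing R] (u v : Fin 3 → R)
    (f : ((Fin 3 → R) ⧸ Submodule.span R {u}) →ₗ[R] ((Fin 3 → R) ⧸ Submodule.span R {v})) :
    ∃ A : Matrix (Fin 3) (Fin 3) R, ∀ w,
      (Submodule.span R {v}).mkQ (A *ᵥ w) = f ((Submodule.span R {u}).mkQ w) := by
  obtain ⟨g, hg⟩ := Module.projective_lifting_property (Submodule.span R {v}).mkQ
    (f ∘ₗ (Submodule.span R {u}).mkQ) (Submodule.mkQ_surjective _)
  refine ⟨LinearMap.toMatrix' g, fun w => ?_⟩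
  rw [LinearMap.toMatrix'_mulVec]
  exact LinearMap.congr_fun hg w

open Matrix in
theorem aux_diff {R : Type} [CommRing R] (u : Fin 3 → R) (C : Matrix (Fin 3) (Fin 3) R)
    (hC : ∀ w, (Submodule.span R {u}).mkQ (C *ᵥ w) = (Submodule.span R {u}).mkQ w) :
    ∃ h : Fin 3 → R, C = 1 + vecMulVec u h := by
  have h1 : ∀ j, ∃ c : R, c • u = C *ᵥ (Pi.single j 1) - Pi.single j 1 := by
    intro j
    have := hC (Pi.single j 1)
    rw [← sub_eq_zero, ← map_sub, Submodule.mkQ_apply, Submodule.Quotient.mk_eq_zero,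
      Submodule.mem_span_singleton] at this
    exact this
  choose h hh using h1
  refine ⟨h, ?_⟩
  ext i j
  have := congrFun (hh j) i
  simp only [Pi.smul_apply, smul_eq_mul, Matrix.mulVec_single_one, Pi.sub_apply,
    Matrix.col_apply] at this
  simp only [Matrix.add_apply, vecMulVec_apply, Matrix.one_apply, Pi.single_apply] at this ⊢
  linear_combination -this

open Matrix in
theorem aux_main {R : Type} [CommRing R] [IsDomain R] (u v : Fin 3 → R) (hu : u ≠ 0) (hv : v ≠ 0)
    (e : ((Fin 3 → R) ⧸ Submodule.span R {u}) ≃ₗ[R] ((Fin 3 → R) ⧸ Submodule.span R {v})) :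
    ∃ (A : Matrix (Fin 3) (Fin 3) R) (a b : R) (g h : Fin 3 → R),
      A *ᵥ u = a • v ∧ a * b = 1 + g ⬝ᵥ v ∧
      IsUnit (fromBlocks A (replicateCol Unit v) (replicateRow Unit h)
        (of fun (_ _ : Unit) => b)).det := by
  obtain ⟨A, hA⟩ := aux_lift u v e.toLinearMap
  obtain ⟨B, hB⟩ := aux_lift v u e.symm.toLinearMap
  obtain ⟨h, hh⟩ := aux_diff u (B * A) (by
    intro w; rw [← Matrix.mulVec_mulVec, hB, hA]; simp)
  obtain ⟨g, hg⟩ := aux_diff v (A * B) (by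
    intro w; rw [← Matrix.mulVec_mulVec, hA, hB]; simp)
  have ha : ∃ a : R, a • v = A *ᵥ u := by
    rw [← Submodule.mem_span_singleton, ← Submodule.Quotient.mk_eq_zero, ← Submodule.mkQ_apply, hA]
    rw [(Submodule.mkQ_apply _ u), (Submodule.Quotient.mk_eq_zero _).2
      (Submodule.mem_span_singleton_self u), map_zero]
  have hb : ∃ b : R, b • u = B *ᵥ v := by
    rw [← Submodule.mem_span_singleton, ← Submodule.Quotient.mk_eq_zero, ← Submodule.mkQ_apply, hB]
    rw [(Submodule.mkQ_apply _ v), (Submodule.Quotient.mk_eq_zero _).2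
      (Submodule.mem_span_singleton_self v), map_zero]
  obtain ⟨a, ha⟩ := ha
  obtain ⟨b, hb⟩ := hb
  obtain ⟨i, hi⟩ := Function.ne_iff.1 hv
  have hab : a * b = 1 + g ⬝ᵥ v := by
    have h1 : (A * B) *ᵥ v = (a * b) • v := by
      rw [← Matrix.mulVec_mulVec, ← hb, Matrix.mulVec_smul, ← ha, smul_smul, mul_comm]
    rw [hg, Matrix.add_mulVec, Matrix.one_mulVec, Matrix.vecMulVec_mulVec] at h1
    have h2 := congrFun h1 i
    simp at h2
    apply mul_right_cancel₀ hi
    linear_combination -h2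
  have hgA : g ᵥ* A = a • h := by
    have h1 : (A * B) * A = A * (B * A) := Matrix.mul_assoc _ _ _
    rw [hg, hh, Matrix.add_mul, Matrix.mul_add, Matrix.one_mul, Matrix.mul_one,
      Matrix.vecMulVec_mul, Matrix.mul_vecMulVec, ← ha] at h1
    have h1 := add_left_cancel h1
    ext j
    have h2 := congrFun (congrFun h1 i) j
    simp only [vecMulVec_apply, Pi.smul_apply, smul_eq_mul] at h2
    apply mul_left_cancel₀ hi
    simp only [Pi.smul_apply, smul_eq_mul]
    linear_combination h2
  refine ⟨A, a, b, g, h, ha.symm, hab, ?_⟩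
  have key : fromBlocks B (replicateCol Unit (-u)) (replicateRow Unit (-g))
        (of fun (_ _ : Unit) => a) * fromBlocks A (replicateCol Unit v) (replicateRow Unit h)
        (of fun (_ _ : Unit) => b) = 1 := by
    rw [Matrix.fromBlocks_multiply, ← Matrix.fromBlocks_one]
    congr 1
    · rw [hh]
      ext i j
      simp [Matrix.mul_apply, vecMulVec_apply]
    · ext i j
      have := congrFun hb i
      simp [Matrix.mulVec, dotProduct] at this
      simp [Matrix.mul_apply]
      linear_combination -this
    · ext i j
      have := congrFun hgA j
      simp [Matrix.vecMul, dotProduct] at this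
      simp [Matrix.mul_apply]
      linear_combination -this
    · ext i j
      simp [dotProduct] at hab
      simp [Matrix.mul_apply]
      linear_combination hab
  have := congrArg Matrix.det key
  rw [Matrix.det_mul, Matrix.det_one] at this
  exact IsUnit.of_mul_eq_one_right _ this

open Matrix in
theorem aux_map {R S : Type} [CommRing R] [CommRing S] (φ : R →+* S) (v h : Fin 3 → R)
    (A : Matrix (Fin 3) (Fin 3) R) (b : R) (hv : ∀ i, φ (v i) = 0) :
    φ (fromBlocks A (replicateCol Unit v) (replicateRow Unit h)
        (of fun (_ _ : Unit) => b)).det = (A.map φ).det * φ b := by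
  rw [RingHom.map_det, RingHom.mapMatrix_apply, Matrix.fromBlocks_map]
  have : (replicateCol Unit v).map φ = 0 := by
    ext i j; simp [hv]
  rw [this, Matrix.det_fromBlocks_zero₁₂]
  simp

/-- Let `R = k[x,y,z,t]`, `M₁ = coker(1 ↦ (x, y, zt-1))` and
`M₂ = coker(1 ↦ (x, yz, zt-1))`.  Then `M₁` and `M₂` are not isomorphic. -/
theorem four_variable_modules_not_isomorphic (k : Type) [Field k] :
    IsEmpty ((CokerVec k ![X 0, X 1, X 2 * X 3 - 1]) ≃ₗ[R4 k]
      (CokerVec k ![X 0, X 1 * X 2, X 2 * X 3 - 1])) := by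
  refine ⟨fun e => ?_⟩
  obtain ⟨A, a, b, g, h, hA, hab, hdet⟩ := aux_main _ _
    (fun H => X_ne_zero (R := k) (0 : Fin 4) (by simpa using congrFun H 0))
    (fun H => X_ne_zero (R := k) (0 : Fin 4) (by simpa using congrFun H 0)) e
  let φ : R4 k →ₐ[k] RatFunc k := aeval ![0, 0, RatFunc.X, (RatFunc.X)⁻¹]
  have hX : (RatFunc.X : RatFunc k) ≠ 0 := RatFunc.X_ne_zero
  have p0 : φ (X 0) = 0 := by simp [φ]
  have p1 : φ (X 1) = 0 := by simp [φ]
  have p2 : φ (X 2) = RatFunc.X := by simp [φ]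
  have p3 : φ (X 3) = RatFunc.X⁻¹ := by simp [φ]
  have hv : ∀ i, φ ((![X 0, X 1 * X 2, X 2 * X 3 - 1] : Fin 3 → R4 k) i) = 0 := by
    intro i; fin_cases i <;> simp [p0, p1, p2, p3, hX]
  obtain ⟨c, hc, hdc⟩ := isUnit_iff_eq_C_of_isReduced.1 hdet
  have hm := aux_map φ.toRingHom _ h A b hv
  rw [hdc] at hm
  have hφab : φ a * φ b = 1 := by
    have := congrArg φ hab
    simpa [dotProduct, Fin.sum_univ_three, p0, p1, p2, p3, hX] using this
  have hrow : ∀ i, A i 0 * X 0 + A i 1 * X 1 + A i 2 * (X 2 * X 3 - 1)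
      = a * (![X 0, X 1 * X 2, X 2 * X 3 - 1] : Fin 3 → R4 k) i := by
    intro i
    have := congrFun hA i
    simpa [Matrix.mulVec, dotProduct, Fin.sum_univ_three] using this
  have hD : ∀ d i, φ (pderiv d (A i 0 * X 0 + A i 1 * X 1 + A i 2 * (X 2 * X 3 - 1)))
     = φ (pderiv d (a * (![X 0, X 1 * X 2, X 2 * X 3 - 1] : Fin 3 → R4 k) i)) := by
    intro d i; rw [hrow]
  have hmat : A.map φ = Matrix.diagonal ![φ a, φ a * RatFunc.X, φ a] := by
    ext i j
    have h0 := hD 0 i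
    have h1 := hD 1 i
    have h3 := hD 3 i
    fin_cases i <;> fin_cases j <;>
      simp [pderiv_X, Pi.single_apply, p0, p1, p2, p3, hX] at h0 h1 h3 ⊢ <;> assumption
  have hm2 : φ (C c) = (A.map φ).det * φ b := hm
  rw [hmat, Matrix.det_diagonal] at hm2
  simp [Fin.prod_univ_three] at hm2
  have hφC : φ (C c) = RatFunc.C c := by simp [φ, algebraMap_eq]
  have hfin : RatFunc.C c = φ a * φ a * RatFunc.X := by
    rw [← hφC]
    simp
    linear_combination hm2 + φ a * φ a * RatFunc.X * hφab
  have ha0 : φ a ≠ 0 := left_ne_zero_of_mul_eq_one hφab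
  have := congrArg RatFunc.intDegree hfin
  rw [RatFunc.intDegree_C, RatFunc.intDegree_mul (mul_ne_zero ha0 ha0) hX,
    RatFunc.intDegree_mul ha0 ha0, RatFunc.intDegree_X] at this
  omega
end
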